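/- Let C be a bounded open convex subset of ℝⁿ. Then there exists a real λ > 0 such that λ₁(C ∩ H) ≥ λ for every affine plane H ⊂ ℝⁿ with C ∩ H ≠ ∅, if and only if there exists δ ≥ 0 such that (C, d_C) is δ-hyperbolic. -/

import Mathlib

open MeasureTheory Set Filter
open scoped ENNReal NNReal

noncomputable section

/-- Euclidean `n`-space. -/
abbrev Euc (n : ℕ) : Type := EuclideanSpace ℝ (Fin n)

/-- The set of parameters `t` such that `p + t • v` lies in `C`. For `C` open bounded
convex, `p ∈ C` and `v ≠ 0` this is an open interval `(t⁻, t⁺)` with `t⁻ < 0 < t⁺`;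
the points `p + t⁻ • v` and `p + t⁺ • v` are the two intersections of the boundary `∂C`
with the line through `p` directed by `v`. -/
def lineParams {n : ℕ} (C : Set (Euc n)) (p v : Euc n) : Set ℝ := {t : ℝ | p + t • v ∈ C}

open Classical in
/-- The Hilbert distance of the convex set `C`: with `a = p + t⁻ • (q - p)` and
`b = p + t⁺ • (q - p)` the two boundary points (so that `a, p, q, b` are in this order),
the cross-ratio `(‖q-a‖ ‖p-b‖)/(‖p-a‖ ‖q-b‖)` equals `((1 - t⁻) t⁺)/((-t⁻)(t⁺ - 1))`. -/
def hDist {n : ℕ} (C : Set (Euc n)) (p q : Euc n) : ℝ :=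
  if p = q then 0
  else
    (1 / 2) * Real.log
      (((1 - sInf (lineParams C p (q - p))) * sSup (lineParams C p (q - p))) /
        ((-sInf (lineParams C p (q - p))) * (sSup (lineParams C p (q - p)) - 1)))

open Classical in
/-- The Hilbert Finsler norm of `u` at `p`: with `p⁺ = p + t⁺ • u`, `p⁻ = p + t⁻ • u`
the two boundary points on the line through `p` directed by `u`, one has
`(1/2)‖u‖(1/‖p-p⁺‖ + 1/‖p-p⁻‖) = (1/2)(1/t⁺ - 1/t⁻)`. -/
def fNorm {n : ℕ} (C : Set (Euc n)) (p u : Euc n) : ℝ :=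
  if u = 0 then 0
  else (1 / 2) * (1 / sSup (lineParams C p u) - 1 / sInf (lineParams C p u))

/-- The dual norm of a linear form `l` at `p`: `sup {l u : ‖u‖_{C,p} = 1}`. -/
def dualNorm {n : ℕ} (C : Set (Euc n)) (p : Euc n) (l : Euc n →L[ℝ] ℝ) : ℝ :=
  sSup ((fun u => l u) '' {u : Euc n | fNorm C p u = 1})

/-- The tangent ball `TB_R(p) = {u : ‖u‖_{C,p} < R}`. -/
def tangentBall {n : ℕ} (C : Set (Euc n)) (p : Euc n) (R : ℝ) : Set (Euc n) :=
  {u : Euc n | fNorm C p u < R}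

/-- `ωₙ`, the Lebesgue volume of the Euclidean unit ball of `ℝⁿ`. -/
def omegaVol (n : ℕ) : ℝ := (volume (Metric.ball (0 : Euc n) 1)).toReal

/-- The Hilbert (Busemann) measure of `C`: density `ωₙ / vol_e(TB_C(p))` against
Lebesgue measure, supported on `C`. -/
def hMeasure {n : ℕ} (C : Set (Euc n)) : Measure (Euc n) :=
  (volume.restrict C).withDensity fun p =>
    ENNReal.ofReal (omegaVol n / (volume (tangentBall C p 1)).toReal)

/-- Admissible test functions: nonzero Lipschitz functions with compact support
contained in `Ω`. -/
def testFuns {n : ℕ} (Ω : Set (Euc n)) : Set (Euc n → ℝ) :=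
  {f : Euc n → ℝ |
    (∃ K : ℝ≥0, LipschitzWith K f) ∧ f ≠ 0 ∧ HasCompactSupport f ∧ tsupport f ⊆ Ω}

/-- The Rayleigh quotient of `f` on `Ω`, with respect to the Hilbert geometry of `C`
(`df` is the a.e.-defined differential of the Lipschitz function `f`). -/
def rayleigh {n : ℕ} (C Ω : Set (Euc n)) (f : Euc n → ℝ) : ℝ :=
  (∫ p in Ω, dualNorm C p (fderiv ℝ f p) ^ 2 ∂hMeasure C) /
    ∫ p in Ω, f p ^ 2 ∂hMeasure C

/-- The Dirichlet bottom of the spectrum `λ₁^C(Ω)`. -/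
def lambda1D {n : ℕ} (C Ω : Set (Euc n)) : ℝ := sInf (rayleigh C Ω '' testFuns Ω)

/-- The bottom of the spectrum `λ₁(C)` of the Hilbert geometry of `C`. -/
def lambda1 {n : ℕ} (C : Set (Euc n)) : ℝ := lambda1D C C

/-- The Gromov product `(x|y)_t = (d(x,t) + d(y,t) - d(x,y))/2`. -/
def gromovProd {n : ℕ} (d : Euc n → Euc n → ℝ) (x y t : Euc n) : ℝ :=
  (d x t + d y t - d x y) / 2

/-- `(C, d_C)` is `δ`-hyperbolic: for all `x y z t` in `C`,
`(x|y)_t ≥ min((x|z)_t, (y|z)_t) - δ`. -/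
def IsDeltaHyp {n : ℕ} (C : Set (Euc n)) (δ : ℝ) : Prop :=
  ∀ x ∈ C, ∀ y ∈ C, ∀ z ∈ C, ∀ t ∈ C,
    gromovProd (hDist C) x y t ≥
      min (gromovProd (hDist C) x z t) (gromovProd (hDist C) y z t) - δ

/-- The metric ball `B_R(x)` of the Hilbert metric of `C`. -/
def hBall {n : ℕ} (C : Set (Euc n)) (x : Euc n) (R : ℝ) : Set (Euc n) :=
  {y ∈ C | hDist C x y < R}

/-- The image of `C` under the homothety of center `P₀` and ratio `r`. -/
def homoth {n : ℕ} (P₀ : Euc n) (r : ℝ) (C : Set (Euc n)) : Set (Euc n) :=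
  (fun x => P₀ + r • (x - P₀)) '' C

/-- Diameter of a set with respect to a distance function `d`. -/
def ediamD {α : Type*} (d : α → α → ℝ) (S : Set α) : ℝ≥0∞ :=
  ⨆ x ∈ S, ⨆ y ∈ S, ENNReal.ofReal (d x y)

/-- The `k`-dimensional Hausdorff measure of `S` with respect to the distance
function `d`. -/
def hausD {α : Type*} (k : ℝ) (d : α → α → ℝ) (S : Set α) : ℝ≥0∞ :=
  ⨆ (ε : ℝ≥0∞) (_ : 0 < ε),
    ⨅ (U : ℕ → Set α) (_ : S ⊆ ⋃ i, U i) (_ : ∀ i, ediamD d (U i) ≤ ε),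
      ∑' i, ediamD d (U i) ^ k

/-- The frontier of `U` is a rectifiable closed curve (for the Hilbert metric of `C`):
it is the image of a closed continuous curve and has finite one-dimensional Hausdorff
measure. -/
def RectCurveBoundary (C U : Set (Euc 2)) : Prop :=
  ∃ c : ℝ → Euc 2, ContinuousOn c (Icc 0 1) ∧ c '' Icc (0 : ℝ) 1 = frontier U ∧
    c 0 = c 1 ∧ hausD 1 (hDist C) (frontier U) < ⊤

/-- The Cheeger constant `I_∞^C(Ω)` in dimension `2`: infimum of
`ν_C(∂U)/μ_C(U)` over open sets `U` with closure contained in `Ω` whose boundary is a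
rectifiable curve, `ν_C` being the `1`-dimensional Hausdorff measure of `(C, d_C)`. -/
def cheeger2D (C Ω : Set (Euc 2)) : ℝ :=
  sInf {r : ℝ | ∃ U : Set (Euc 2), IsOpen U ∧ U.Nonempty ∧ closure U ⊆ Ω ∧
    RectCurveBoundary C U ∧
    r = (hausD 1 (hDist C) (frontier U)).toReal / (hMeasure C U).toReal}

/-- The Cheeger constant `I_∞(C)` of a planar Hilbert geometry. -/
def cheeger2 (C : Set (Euc 2)) : ℝ := cheeger2D C C

/-- `S` is a `C¹` hypersurface: near each of its points it is the zero set of a `C¹`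
function with nonvanishing differential. -/
def IsC1Hypersurface {n : ℕ} (S : Set (Euc n)) : Prop :=
  ∀ x ∈ S, ∃ (f : Euc n → ℝ) (U : Set (Euc n)), U ∈ nhds x ∧ ContDiffOn ℝ 1 f U ∧
    (∀ y ∈ U, fderiv ℝ f y ≠ 0) ∧ S ∩ U = {y ∈ U | f y = 0}

/-- The Cheeger constant `I_∞^C(Ω)` in dimension `n`: infimum of `ν_C(∂U)/μ_C(U)` over
open sets `U` with closure contained in `Ω` whose boundary is a `C¹` hypersurface,
`ν_C` being the `(n-1)`-dimensional Hausdorff measure of `(C, d_C)`. -/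
def cheegerND {n : ℕ} (C Ω : Set (Euc n)) : ℝ :=
  sInf {r : ℝ | ∃ U : Set (Euc n), IsOpen U ∧ U.Nonempty ∧ closure U ⊆ Ω ∧
    IsC1Hypersurface (frontier U) ∧
    r = (hausD ((n : ℝ) - 1) (hDist C) (frontier U)).toReal / (hMeasure C U).toReal}

/-- The boundary of the convex set `C` is of class `C¹`: through each boundary point
passes a unique supporting hyperplane. -/
def HasC1Boundary {n : ℕ} (C : Set (Euc n)) : Prop :=
  ∀ x ∈ frontier C, ∃! l : Euc n →L[ℝ] ℝ, ‖l‖ = 1 ∧ ∀ y ∈ C, l y ≤ l x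

/-- The convex set `C` is strictly convex: the open segment joining two distinct
boundary points is contained in `C`. -/
def IsStrictlyConvexSet {n : ℕ} (C : Set (Euc n)) : Prop :=
  ∀ x ∈ frontier C, ∀ y ∈ frontier C, x ≠ y → openSegment ℝ x y ⊆ C

end


namespace HG

/-- open bounded convex -/
structure OBC {n : ℕ} (C : Set (Euc n)) : Prop where
  cv : Convex ℝ C
  op : IsOpen C
  bd : Bornology.IsBounded C

/-- gauge of `C - p` -/
noncomputable def jg {n : ℕ} (C : Set (Euc n)) (p v : Euc n) : ℝ := gauge {w | p + w ∈ C} v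

section basics
variable {n : ℕ} {C : Set (Euc n)} {p q r v w : Euc n}

lemma shift_cv (h : OBC C) : Convex ℝ {w | p + w ∈ C} := by
  exact h.cv.translate_preimage_right p

lemma shift_op (h : OBC C) : IsOpen {w | p + w ∈ C} :=
  h.op.preimage (continuous_const.add continuous_id)

lemma shift_nhds (h : OBC C) (hp : p ∈ C) : {w | p + w ∈ C} ∈ nhds (0 : Euc n) :=
  (shift_op h).mem_nhds (by simpa using hp)

lemma shift_abs (h : OBC C) (hp : p ∈ C) : Absorbent ℝ {w | p + w ∈ C} :=
  absorbent_nhds_zero (shift_nhds h hp)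

lemma shift_bd (h : OBC C) : Bornology.IsVonNBounded ℝ {w | p + w ∈ C} := by
  rw [NormedSpace.isVonNBounded_iff]
  obtain ⟨R, hR⟩ := h.bd.subset_closedBall 0
  refine (Metric.isBounded_closedBall (x := (0 : Euc n)) (r := R + ‖p‖)).subset ?_
  intro w hw
  have := hR hw
  rw [mem_closedBall_zero_iff] at *
  calc ‖w‖ = ‖(p + w) - p‖ := by simp
    _ ≤ ‖p + w‖ + ‖p‖ := norm_sub_le _ _
    _ ≤ _ := by linarith

lemma jg_nonneg : 0 ≤ jg C p v := gauge_nonneg _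

@[simp] lemma jg_zero : jg C p 0 = 0 := gauge_zero

lemma jg_smul {t : ℝ} (ht : 0 ≤ t) : jg C p (t • v) = t * jg C p v := by
  unfold jg
  rw [gauge_smul_of_nonneg ht]; rfl

lemma jg_add (h : OBC C) (hp : p ∈ C) : jg C p (v + w) ≤ jg C p v + jg C p w :=
  gauge_add_le (shift_cv h) (shift_abs h hp) _ _

lemma jg_pos (h : OBC C) (hp : p ∈ C) (hv : v ≠ 0) : 0 < jg C p v :=
  (gauge_pos (shift_abs h hp) (shift_bd h)).2 hv

lemma jg_cont (h : OBC C) (hp : p ∈ C) : Continuous (jg C p) :=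
  continuous_gauge (shift_cv h) (shift_nhds h hp)

lemma jg_lt_one (h : OBC C) (hp : p ∈ C) : jg C p v < 1 ↔ p + v ∈ C := by
  have := setOfPred_gauge_lt_one_eq_self_of_isOpen (shift_cv h (p := p)) (by simpa using hp) (shift_op h)
  have h2 := Set.ext_iff.1 this v
  simpa [jg] using h2

lemma jg_le_one (h : OBC C) (hp : p ∈ C) (hv : p + v ∈ closure C) : jg C p v ≤ 1 := by
  have h1 : closure C ⊆ {z | jg C p (z - p) ≤ 1} := by
    apply closure_minimal
    · intro z hz
      exact ((jg_lt_one h hp).2 (by simpa using hz)).le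
    · exact isClosed_le ((jg_cont h hp).comp (continuous_id.sub continuous_const)) continuous_const
  simpa using h1 hv

lemma mem_iff (h : OBC C) (hp : p ∈ C) {t : ℝ} (ht : 0 ≤ t) : p + t • v ∈ C ↔ t * jg C p v < 1 := by
  rw [← jg_lt_one h hp, jg_smul ht]

lemma jg_sub_lt (h : OBC C) (hp : p ∈ C) (hq : q ∈ C) : jg C p (q - p) < 1 := by
  rw [jg_lt_one h hp]; simpa using hq

lemma lineParams_eq (h : OBC C) (hp : p ∈ C) (hv : v ≠ 0) :
    lineParams C p v = Ioo (-(1 / jg C p (-v))) (1 / jg C p v) := by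
  have h1 := jg_pos h hp hv
  have h2 := jg_pos h hp (neg_ne_zero.2 hv)
  ext t
  simp only [lineParams, mem_setOf_eq, mem_Ioo]
  rcases le_total 0 t with ht | ht
  · rw [mem_iff h hp ht, lt_div_iff₀ h1]
    have : -(1 / jg C p (-v)) < 0 := by simpa using h2
    constructor
    · intro h; exact ⟨by linarith, h⟩
    · exact fun h => h.2
  · have : p + t • v = p + (-t) • (-v) := by simp
    rw [this, mem_iff h hp (by linarith), ← lt_div_iff₀ h2]
    have : 0 < 1 / jg C p v := by positivity
    constructor
    · intro h; exact ⟨by linarith, by linarith⟩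
    · intro h; linarith [h.1]

lemma sSup_lp (h : OBC C) (hp : p ∈ C) (hv : v ≠ 0) :
    sSup (lineParams C p v) = 1 / jg C p v := by
  have h1 := jg_pos h hp hv
  have h2 := jg_pos h hp (neg_ne_zero.2 hv)
  rw [lineParams_eq h hp hv]
  apply csSup_Ioo
  have : 0 < 1 / jg C p v := by positivity
  have : 0 < 1 / jg C p (-v) := by positivity
  linarith

lemma sInf_lp (h : OBC C) (hp : p ∈ C) (hv : v ≠ 0) :
    sInf (lineParams C p v) = -(1 / jg C p (-v)) := by
  have h1 := jg_pos h hp hv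
  have h2 := jg_pos h hp (neg_ne_zero.2 hv)
  rw [lineParams_eq h hp hv]
  apply csInf_Ioo
  have : 0 < 1 / jg C p v := by positivity
  have : 0 < 1 / jg C p (-v) := by positivity
  linarith

lemma fNorm_eq (h : OBC C) (hp : p ∈ C) : fNorm C p v = (1 / 2) * (jg C p v + jg C p (-v)) := by
  unfold fNorm
  split_ifs with hv
  · simp [hv]
  · rw [sSup_lp h hp hv, sInf_lp h hp hv]
    simp

/-- Funk quantity -/
noncomputable def fk (C : Set (Euc n)) (p q : Euc n) : ℝ := 1 - jg C p (q - p)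

lemma fk_pos (h : OBC C) (hp : p ∈ C) (hq : q ∈ C) : 0 < fk C p q := by
  have := jg_sub_lt h hp hq
  unfold fk; linarith

lemma fk_le_one : fk C p q ≤ 1 := by
  have := jg_nonneg (C := C) (p := p) (v := q - p)
  unfold fk; linarith

/-- j at a shifted point, in the direction of the shift -/
lemma jg_shift (h : OBC C) (hp : p ∈ C) {t : ℝ} (ht : t * jg C p v < 1)
    (hq : p + t • v ∈ C) (hs : 0 ≤ t ∨ v = v) : jg C (p + t • v) v = jg C p v / (1 - t * jg C p v) := by
  by_cases hv : v = 0
  · simp [hv]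
  have h1 := jg_pos h hp hv
  have h2 := jg_pos h hq hv
  have e1 := sSup_lp h hp hv
  have e2 := sSup_lp h hq hv
  have hl : lineParams C (p + t • v) v = (fun s => s + (-t)) '' lineParams C p v := by
    ext s
    simp only [lineParams, mem_setOf_eq, mem_image]
    constructor
    · intro hs; exact ⟨s + t, by convert hs using 1; module, by ring⟩
    · rintro ⟨s', h', rfl⟩; convert h' using 1; module
  rw [lineParams_eq h hp hv, Set.image_add_const_Ioo, lineParams_eq h hq hv] at hl
  have hne1 : -(1 / jg C (p + t • v) (-v)) < 1 / jg C (p + t • v) v := by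
    have := jg_pos h hq (neg_ne_zero.2 hv)
    have : 0 < 1 / jg C (p + t • v) v := by positivity
    have : 0 < 1 / jg C (p + t • v) (-v) := by positivity
    linarith
  have := (congrArg sSup hl)
  rw [csSup_Ioo hne1, csSup_Ioo] at this
  · have h3 : 1 / jg C p v + -t = (1 - t * jg C p v) / jg C p v := by field_simp; ring
    rw [h3] at this
    have h4 : jg C (p + t • v) v = 1 / ((1 - t * jg C p v) / jg C p v) := by
      rw [← this]; simp
    rw [h4, one_div_div]
  · have hh : (Ioo (-(1 / jg C (p + t • v) (-v))) (1 / jg C (p + t • v) v)).Nonempty := nonempty_Ioo.2 hne1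
    rw [hl] at hh
    exact nonempty_Ioo.1 hh

lemma one_add_jg (h : OBC C) (hp : p ∈ C) (hq : q ∈ C) : 1 + jg C p (p - q) = 1 / fk C q p := by
  have hf := fk_pos h hq hp
  have := jg_shift h hq (v := p - q) (t := 1) (by simpa using jg_sub_lt h hq hp) (by simpa using hp) (Or.inr rfl)
  simp only [one_smul, add_sub_cancel, one_mul] at this
  rw [this]
  unfold fk at *
  field_simp
  ring

lemma hDist_eq (h : OBC C) (hp : p ∈ C) (hq : q ∈ C) :
    hDist C p q = -(1 / 2) * Real.log (fk C p q) - (1 / 2) * Real.log (fk C q p) := by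
  unfold hDist
  split_ifs with hpq
  · subst hpq; simp [fk]
  · have hv : q - p ≠ 0 := sub_ne_zero.2 (Ne.symm hpq)
    rw [sSup_lp h hp hv, sInf_lp h hp hv, neg_sub]
    have h1 := jg_pos h hp hv
    have h2 := jg_pos h hp (neg_ne_zero.2 hv)
    rw [neg_sub] at h2
    have h3 := fk_pos h hp hq
    have h4 := fk_pos h hq hp
    have h5 := one_add_jg h hp hq
    have : ((1 - -(1 / jg C p (p - q))) * (1 / jg C p (q - p)) /
        (-(-(1 / jg C p (p - q))) * (1 / jg C p (q - p) - 1))) = (1 + jg C p (p - q)) / fk C p q := by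
      have h6 : jg C p (q - p) < 1 := jg_sub_lt h hp hq
      have h7 : 1 - jg C p (q - p) ≠ 0 := by linarith
      unfold fk
      field_simp
      ring
    rw [this, h5, Real.log_div (by positivity) h3.ne', Real.log_div one_ne_zero h4.ne', Real.log_one]
    ring

lemma exists_of_lt_fk (h : OBC C) (hp : p ∈ C) {μ : ℝ} (hμ : μ < fk C p q) :
    ∃ c ∈ C, q = μ • p + (1 - μ) • c := by
  have hlt : jg C p (q - p) < 1 - μ := by unfold fk at hμ; linarith
  have hpos : 0 < 1 - μ := lt_of_le_of_lt jg_nonneg hlt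
  refine ⟨p + (1 - μ)⁻¹ • (q - p), ?_, ?_⟩
  · rw [mem_iff h hp (by positivity)]
    rw [inv_mul_lt_iff₀ hpos]; linarith
  · rw [smul_add, smul_smul, mul_inv_cancel₀ hpos.ne']
    module

lemma le_fk (h : OBC C) (hp : p ∈ C) {μ : ℝ} (hμ : μ ≤ 1) {c : Euc n} (hc : c ∈ closure C)
    (hq : q = μ • p + (1 - μ) • c) : μ ≤ fk C p q := by
  have : q - p = (1 - μ) • (c - p) := by rw [hq]; module
  unfold fk
  rw [this, jg_smul (by linarith)]
  have h1 : jg C p (c - p) ≤ 1 := jg_le_one h hp (by simpa using hc)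
  nlinarith [jg_nonneg (C := C) (p := p) (v := c - p)]

lemma fk_mul (h : OBC C) (hp : p ∈ C) (hq : q ∈ C) (hr : r ∈ C) :
    fk C p q * fk C q r ≤ fk C p r := by
  have key : ∀ a ∈ Ioo (0 : ℝ) (fk C p q), ∀ b ∈ Ioo (0 : ℝ) (fk C q r), a * b ≤ fk C p r := by
    rintro a ⟨ha0, ha⟩ b ⟨hb0, hb⟩
    obtain ⟨c1, hc1, e1⟩ := exists_of_lt_fk h hp ha
    obtain ⟨c2, hc2, e2⟩ := exists_of_lt_fk h hq hb
    have ha1 : a < 1 := lt_of_lt_of_le ha fk_le_one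
    have hb1 : b < 1 := lt_of_lt_of_le hb fk_le_one
    have hab : 0 < 1 - a * b := by nlinarith
    refine le_fk h hp (by linarith) (c := (b * (1 - a) / (1 - a * b)) • c1 + ((1 - b) / (1 - a * b)) • c2) ?_ ?_
    · apply subset_closure
      apply h.cv hc1 hc2
      · apply div_nonneg _ hab.le; nlinarith
      · apply div_nonneg _ hab.le; linarith
      · rw [← add_div, div_eq_one_iff_eq hab.ne']; ring
    · rw [smul_add, smul_smul, smul_smul, mul_div_cancel₀ _ hab.ne', mul_div_cancel₀ _ hab.ne', e2, e1]
      module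
  have h1 := fk_pos h hp hq
  have h2 := fk_pos h hq hr
  by_contra hcon
  push Not at hcon
  set P := fk C p r
  set x := fk C p q
  set y := fk C q r
  have hc : ContinuousAt (fun s : ℝ => (s * x) * (s * y)) 1 := by fun_prop
  have : ∀ᶠ s in nhds (1 : ℝ), P < (s * x) * (s * y) :=
    hc.eventually (lt_mem_nhds (by simpa using hcon))
  have h3 : ∀ᶠ s in nhdsWithin (1 : ℝ) (Iio 1), P < (s * x) * (s * y) := this.filter_mono nhdsWithin_le_nhds
  have h4 : ∀ᶠ s in nhdsWithin (1 : ℝ) (Iio 1), s ∈ Ioo (0:ℝ) 1 := Ioo_mem_nhdsLT (by norm_num)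
  obtain ⟨s, hs, hs'⟩ := (h3.and h4).exists
  have := key (s * x) ⟨mul_pos hs'.1 h1, by nlinarith [hs'.2]⟩ (s * y) ⟨mul_pos hs'.1 h2, by nlinarith [hs'.2]⟩
  linarith

lemma hDist_nonneg (h : OBC C) (hp : p ∈ C) (hq : q ∈ C) : 0 ≤ hDist C p q := by
  rw [hDist_eq h hp hq]
  have := Real.log_nonpos (fk_pos h hp hq).le fk_le_one
  have := Real.log_nonpos (fk_pos h hq hp).le fk_le_one
  linarith

lemma hDist_comm (h : OBC C) (hp : p ∈ C) (hq : q ∈ C) : hDist C p q = hDist C q p := by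
  rw [hDist_eq h hp hq, hDist_eq h hq hp]; ring

lemma hDist_self : hDist C p p = 0 := by simp [hDist]

lemma hDist_tri (h : OBC C) (hp : p ∈ C) (hq : q ∈ C) (hr : r ∈ C) :
    hDist C p r ≤ hDist C p q + hDist C q r := by
  rw [hDist_eq h hp hq, hDist_eq h hq hr, hDist_eq h hp hr]
  have h1 := Real.log_le_log (mul_pos (fk_pos h hp hq) (fk_pos h hq hr)) (fk_mul h hp hq hr)
  have h2 := Real.log_le_log (mul_pos (fk_pos h hr hq) (fk_pos h hq hp)) (fk_mul h hr hq hp)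
  rw [Real.log_mul (fk_pos h hp hq).ne' (fk_pos h hq hr).ne'] at h1
  rw [Real.log_mul (fk_pos h hr hq).ne' (fk_pos h hq hp).ne'] at h2
  linarith

/-- additivity of Funk along a line -/
lemma fk_line (h : OBC C) (hp : p ∈ C) (hr : r ∈ C) {t : ℝ} (ht0 : 0 ≤ t) (ht1 : t ≤ 1)
    (hq : q = p + t • (r - p)) : fk C p r = fk C p q * fk C q r := by
  have hj := jg_sub_lt h hp hr
  have hj0 := jg_nonneg (C := C) (p := p) (v := r - p)
  have htj : t * jg C p (r - p) < 1 := by nlinarith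
  have hqC : p + t • (r - p) ∈ C := (mem_iff h hp ht0).2 htj
  have e1 : q - p = t • (r - p) := by rw [hq]; module
  have e2 : r - q = (1 - t) • (r - p) := by rw [hq]; module
  unfold fk
  rw [e1, e2, jg_smul ht0, jg_smul (by linarith), hq, jg_shift h hp htj hqC (Or.inr rfl)]
  have h0 : 1 - t * jg C p (r - p) ≠ 0 := by linarith
  rw [mul_sub, mul_one, mul_left_comm, mul_div_cancel₀ _ h0]
  ring

lemma seg_mem (h : OBC C) (hp : p ∈ C) (hr : r ∈ C) {t : ℝ} (ht0 : 0 ≤ t) (ht1 : t ≤ 1) :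
    p + t • (r - p) ∈ C := h.cv.add_smul_sub_mem hp hr ⟨ht0, ht1⟩

lemma hDist_line (h : OBC C) (hp : p ∈ C) (hr : r ∈ C) {t : ℝ} (ht0 : 0 ≤ t) (ht1 : t ≤ 1)
    (hq : q = p + t • (r - p)) : hDist C p r = hDist C p q + hDist C q r := by
  have hqC : q ∈ C := hq ▸ seg_mem h hp hr ht0 ht1
  have hq' : q = r + (1 - t) • (p - r) := by rw [hq]; module
  have h1 := fk_line h hp hr ht0 ht1 hq
  have h2 := fk_line h hr hp (by linarith : 0 ≤ 1 - t) (by linarith) hq'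
  rw [hDist_eq h hp hqC, hDist_eq h hqC hr, hDist_eq h hp hr, h1, h2,
    Real.log_mul (fk_pos h hp hqC).ne' (fk_pos h hqC hr).ne',
    Real.log_mul (fk_pos h hr hqC).ne' (fk_pos h hqC hp).ne']
  ring

lemma fk_le_func (h : OBC C) (hp : p ∈ C) (l : Euc n →L[ℝ] ℝ) (c : ℝ)
    (hl : ∀ z ∈ C, 0 ≤ l z + c) : fk C p q * (l p + c) ≤ l q + c := by
  by_contra hcon
  push Not at hcon
  have hlp : 0 ≤ l p + c := hl p hp
  set x := fk C p q
  have hc : ContinuousAt (fun s : ℝ => s * (l p + c)) x := by fun_prop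
  have h1 : ∀ᶠ s in nhds x, l q + c < s * (l p + c) := hc.eventually (lt_mem_nhds (by simpa using hcon))
  have h2 : ∀ᶠ s in nhdsWithin x (Iio x), l q + c < s * (l p + c) := h1.filter_mono nhdsWithin_le_nhds
  obtain ⟨s, hs, hs'⟩ := (h2.and self_mem_nhdsWithin).exists
  obtain ⟨c1, hc1, e⟩ := exists_of_lt_fk h hp hs'
  have h3 := hl c1 hc1
  have hs1 : s < 1 := lt_of_lt_of_le hs' fk_le_one
  rw [e] at hs
  simp only [map_add, map_smul, smul_eq_mul] at hs
  nlinarith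

lemma hDist_cont (h : OBC C) (hp : p ∈ C) : ContinuousOn (fun q => hDist C p q) C := by
  have : ∀ q ∈ C, hDist C p q = -(1 / 2) * Real.log (1 - jg C p (q - p)) + (1 / 2) * Real.log (1 + jg C p (p - q)) := by
    intro q hq
    rw [hDist_eq h hp hq, one_add_jg h hp hq, Real.log_div one_ne_zero (fk_pos h hq hp).ne', Real.log_one]
    unfold fk; ring
  refine ContinuousOn.congr ?_ this
  have hj := jg_cont h hp
  apply ContinuousOn.add
  · apply ContinuousOn.mul continuousOn_const
    apply ContinuousOn.log
    · fun_prop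
    · intro q hq; have := jg_sub_lt h hp hq; linarith
  · apply ContinuousOn.mul continuousOn_const
    apply ContinuousOn.log
    · fun_prop
    · intro q hq; have := jg_nonneg (C := C) (p := p) (v := p - q); linarith

lemma jg_mono {D : Set (Euc n)} (hC : OBC C) (hp : p ∈ C) (hCD : C ⊆ D) : jg D p v ≤ jg C p v :=
  gauge_mono (shift_abs hC hp) (show {w | p + w ∈ C} ⊆ {w | p + w ∈ D} from by intro w hw; exact hCD (show p + w ∈ C from hw)) v

end basics
end HG

namespace HG

section sections
variable {n : ℕ} {C : Set (Euc n)}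

lemma sec_obc (h : OBC C) (φ : Euc 2 →ᵃⁱ[ℝ] Euc n) : OBC (φ ⁻¹' C) where
  cv := h.cv.affine_preimage φ.toAffineMap
  op := h.op.preimage φ.continuous
  bd := by
    have := φ.isometry.antilipschitz.isBounded_preimage h.bd
    exact this

lemma sec_dist (φ : Euc 2 →ᵃⁱ[ℝ] Euc n) (p q : Euc 2) :
    hDist (φ ⁻¹' C) p q = hDist C (φ p) (φ q) := by
  have hl : lineParams (φ ⁻¹' C) p (q - p) = lineParams C (φ p) (φ q - φ p) := by
    ext t
    have : φ (p + t • (q - p)) = φ p + t • (φ q - φ p) := by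
      have := AffineMap.map_vadd φ.toAffineMap p (t • (q - p))
      have h2 := AffineMap.linearMap_vsub φ.toAffineMap q p
      simp only [vadd_eq_add, vsub_eq_sub] at this h2
      rw [map_smul, h2] at this
      have h3 : φ (t • (q - p) + p) = t • (φ q - φ p) + φ p := this
      rw [add_comm, h3, add_comm]
    simp only [lineParams, mem_ofPred_eq, mem_preimage, this]
  unfold hDist
  rw [hl]
  by_cases hpq : p = q
  · simp [hpq]
  · have : φ p ≠ φ q := fun e => hpq (φ.injective e)
    simp [hpq, this]

lemma sec_hyp {δ : ℝ} (hd : IsDeltaHyp C δ) (φ : Euc 2 →ᵃⁱ[ℝ] Euc n) : IsDeltaHyp (φ ⁻¹' C) δ := by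
  intro x hx y hy z hz t ht
  have := hd _ hx _ hy _ hz _ ht
  simpa only [gromovProd, sec_dist] using this

end sections

/-- triangles are `c`-thin -/
def Thin {n : ℕ} (C : Set (Euc n)) (c : ℝ) : Prop :=
  ∀ x ∈ C, ∀ y ∈ C, ∀ z ∈ C, ∀ p ∈ segment ℝ x y,
    ∃ w, (w ∈ segment ℝ x z ∨ w ∈ segment ℝ y z) ∧ hDist C p w ≤ c

section thin
variable {n : ℕ} {C : Set (Euc n)}

lemma seg_sub (h : OBC C) {x y p : Euc n} (hx : x ∈ C) (hy : y ∈ C) (hp : p ∈ segment ℝ x y) : p ∈ C :=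
  h.cv.segment_subset hx hy hp

lemma hDist_seg (h : OBC C) {x y p : Euc n} (hx : x ∈ C) (hy : y ∈ C) (hp : p ∈ segment ℝ x y) :
    hDist C x y = hDist C x p + hDist C p y := by
  rw [segment_eq_image'] at hp
  obtain ⟨t, ht, rfl⟩ := hp
  exact hDist_line h hx hy ht.1 ht.2 rfl

lemma gp_le (h : OBC C) {x y p t : Euc n} (hx : x ∈ C) (hy : y ∈ C) (ht : t ∈ C)
    (hp : p ∈ segment ℝ x y) : gromovProd (hDist C) x y t ≤ hDist C t p := by
  have hpC := seg_sub h hx hy hp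
  have h1 := hDist_seg h hx hy hp
  have h2 := hDist_tri h hx hpC ht
  have h3 := hDist_tri h hy hpC ht
  have h4 := hDist_comm h hy hpC
  have h5 := hDist_comm h hpC ht
  unfold gromovProd
  linarith

lemma nbhd_open (h : OBC C) (x y : Euc n) {W : Set (Euc n)} (hW : W ⊆ C) (c : ℝ) :
    IsOpen {s : ℝ | ∃ w ∈ W, x + s • (y - x) ∈ C ∧ hDist C w (x + s • (y - x)) < c} := by
  have : {s : ℝ | ∃ w ∈ W, x + s • (y - x) ∈ C ∧ hDist C w (x + s • (y - x)) < c} =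
      ⋃ w ∈ W, (fun s : ℝ => x + s • (y - x)) ⁻¹' (C ∩ (fun q => hDist C w q) ⁻¹' (Iio c)) := by
    ext s; simp; tauto
  rw [this]
  refine isOpen_biUnion fun w hw => ?_
  refine IsOpen.preimage (by fun_prop) ?_
  exact (hDist_cont h (hW hw)).isOpen_inter_preimage h.op isOpen_Iio

lemma thin_pt (h : OBC C) {c : ℝ} (hc : 0 ≤ c) (hT : Thin C c) {x y t : Euc n} (hx : x ∈ C) (hy : y ∈ C)
    (ht : t ∈ C) : ∃ p ∈ segment ℝ x y, hDist C t p ≤ gromovProd (hDist C) x y t + 2 * (c + 1) := by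
  have hxt := h.cv.segment_subset hx ht
  have hyt := h.cv.segment_subset hy ht
  have hcov : Icc (0 : ℝ) 1 ⊆ {s : ℝ | ∃ w ∈ segment ℝ x t, x + s • (y - x) ∈ C ∧ hDist C w (x + s • (y - x)) < c + 1} ∪
      {s : ℝ | ∃ w ∈ segment ℝ y t, x + s • (y - x) ∈ C ∧ hDist C w (x + s • (y - x)) < c + 1} := by
    intro s hs
    have hm : x + s • (y - x) ∈ segment ℝ x y := by
      rw [segment_eq_image']; exact ⟨s, hs, rfl⟩
    have hmC := seg_sub h hx hy hm
    obtain ⟨w, hw, hd⟩ := hT x hx y hy t ht _ hm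
    rcases hw with hw | hw
    · left; exact ⟨w, hw, hmC, by rw [hDist_comm h (hxt hw) hmC]; linarith⟩
    · right; exact ⟨w, hw, hmC, by rw [hDist_comm h (hyt hw) hmC]; linarith⟩
  obtain ⟨s, hs, ⟨w1, hw1, hm, hd1⟩, w2, hw2, -, hd2⟩ := isPreconnected_Icc (a := (0 : ℝ)) (b := 1) _ _
    (nbhd_open h x y hxt (c + 1)) (nbhd_open h x y hyt (c + 1)) hcov
    ⟨0, by simp, x, left_mem_segment _ _ _, by simpa using hx, by simp [hDist_self]; linarith⟩
    ⟨1, by simp, y, left_mem_segment _ _ _, by simpa using hy, by simp [hDist_self]; linarith⟩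
  have hmm : x + s • (y - x) ∈ segment ℝ x y := by
    rw [segment_eq_image']; exact ⟨s, hs, rfl⟩
  refine ⟨_, hmm, ?_⟩
  set p := x + s • (y - x)
  have a1 := hDist_seg h hx ht hw1
  have a2 := hDist_seg h hy ht hw2
  have a3 := hDist_seg h hx hy hmm
  have b1 := hDist_tri h hx (hxt hw1) hm
  have b2 := hDist_tri h hy (hyt hw2) hm
  have b3 := hDist_tri h hm (hxt hw1) ht
  have b4 := hDist_tri h hm (hyt hw2) ht
  rw [hDist_comm h hm (hxt hw1)] at b3
  rw [hDist_comm h hm (hyt hw2)] at b4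
  rw [hDist_comm h hy hm] at b2
  rw [hDist_comm h hm ht] at b3 b4
  unfold gromovProd
  linarith

lemma thin_hyp (h : OBC C) {c : ℝ} (hc : 0 ≤ c) (hT : Thin C c) : IsDeltaHyp C (3 * c + 2) := by
  intro x hx y hy z hz t ht
  obtain ⟨p, hp, hd⟩ := thin_pt h hc hT hx hy ht
  obtain ⟨w, hw, hpw⟩ := hT x hx y hy z hz p hp
  have hpC := seg_sub h hx hy hp
  rcases hw with hw | hw
  · have hwC := seg_sub h hx hz hw
    have := gp_le h hx hz ht hw
    have := hDist_tri h ht hpC hwC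
    have := min_le_left (gromovProd (hDist C) x z t) (gromovProd (hDist C) y z t)
    linarith
  · have hwC := seg_sub h hy hz hw
    have := gp_le h hy hz ht hw
    have := hDist_tri h ht hpC hwC
    have := min_le_right (gromovProd (hDist C) x z t) (gromovProd (hDist C) y z t)
    linarith

end thin
end HG

namespace HG

section fat
variable {n : ℕ} {C : Set (Euc n)}

lemma exp_hDist (h : OBC C) {p v : Euc n} (hp : p ∈ C) {t : ℝ} (ht : 0 ≤ t) (hq : p + t • v ∈ C) :
    Real.exp (2 * hDist C p (p + t • v)) * (1 - t * jg C p v) = 1 + t * jg C p (-v) := by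
  have h1 := hDist_eq h hp hq
  have h2 := fk_pos h hp hq
  have h3 := fk_pos h hq hp
  have h4 := one_add_jg h hp hq
  have e1 : p - (p + t • v) = t • (-v) := by module
  have e2 : fk C p (p + t • v) = 1 - t * jg C p v := by
    unfold fk; rw [add_sub_cancel_left, jg_smul ht]
  rw [e1, jg_smul ht] at h4
  rw [h4, ← e2, h1]
  have : 2 * (-(1 / 2) * Real.log (fk C p (p + t • v)) - 1 / 2 * Real.log (fk C (p + t • v) p))
    = - Real.log (fk C p (p + t • v)) + - Real.log (fk C (p + t • v) p) := by ring
  rw [this, Real.exp_add, Real.exp_neg, Real.exp_neg, Real.exp_log h2, Real.exp_log h3]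
  field_simp

/-- the point at given distance -/
noncomputable def tpar (C : Set (Euc n)) (p : Euc n) (E : ℝ) (v : Euc n) : ℝ :=
  (E - 1) / (jg C p (-v) + E * jg C p v)

lemma tpar_mem (h : OBC C) {p v : Euc n} (hp : p ∈ C) (hv : v ≠ 0) {E : ℝ} (hE : 1 < E) :
    p + tpar C p E v • v ∈ C ∧ 0 < tpar C p E v ∧
      Real.exp (2 * hDist C p (p + tpar C p E v • v)) = E := by
  have h1 := jg_pos h hp hv
  have h2 := jg_pos h hp (neg_ne_zero.2 hv)
  have hd : 0 < jg C p (-v) + E * jg C p v := by positivity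
  have ht : 0 < tpar C p E v := div_pos (by linarith) hd
  have hlt : tpar C p E v * jg C p v < 1 := by
    unfold tpar
    rw [div_mul_eq_mul_div, div_lt_one hd]; linarith
  have hm : p + tpar C p E v • v ∈ C := (mem_iff h hp ht.le).2 hlt
  refine ⟨hm, ht, ?_⟩
  have h3 := exp_hDist h hp ht.le hm
  have h4 : E * (1 - tpar C p E v * jg C p v) = 1 + tpar C p E v * jg C p (-v) := by
    unfold tpar; field_simp; ring
  rw [← h4] at h3
  exact mul_right_cancel₀ (by linarith) h3

lemma tpar_le_one (h : OBC C) {p v : Euc n} (hp : p ∈ C) (hv : v ≠ 0) {E : ℝ} (hE : 1 < E)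
    (hq : p + v ∈ C) (hd : E ≤ Real.exp (2 * hDist C p (p + v))) : tpar C p E v ≤ 1 := by
  have h1 := jg_pos h hp hv
  have h2 := jg_pos h hp (neg_ne_zero.2 hv)
  have hd' : 0 < jg C p (-v) + E * jg C p v := by positivity
  have h3 := exp_hDist h hp (v := v) (t := 1) zero_le_one (by simpa using hq)
  have h4 := (jg_lt_one h hp).2 hq
  simp only [one_smul, one_mul] at h3
  unfold tpar
  rw [div_le_one hd']
  nlinarith

lemma nbhd_open' (h : OBC C) {W : Set (Euc n)} (hW : W ⊆ C) (c : ℝ) :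
    IsOpen {q | ∃ w ∈ W, q ∈ C ∧ hDist C w q < c} := by
  have : {q | ∃ w ∈ W, q ∈ C ∧ hDist C w q < c} =
      ⋃ w ∈ W, (C ∩ (fun q => hDist C w q) ⁻¹' (Iio c)) := by
    ext s; simp; tauto
  rw [this]
  exact isOpen_biUnion fun w hw => (hDist_cont h (hW hw)).isOpen_inter_preimage h.op isOpen_Iio

lemma fat (h : OBC C) {x y z p : Euc n} (hx : x ∈ C) (hy : y ∈ C) (hz : z ∈ C) (hp : p ∈ segment ℝ x y)
    {ρ c : ℝ} (hρ : 0 < ρ) (hc : 4 * ρ < c)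
    (hd : ∀ w, w ∈ segment ℝ x z ∨ w ∈ segment ℝ y z → c < hDist C p w) :
    ∃ q ∈ convexHull ℝ {x, y, z}, ∀ w, (w ∈ segment ℝ x y ∨ w ∈ segment ℝ x z ∨ w ∈ segment ℝ y z) →
      ρ ≤ hDist C w q := by
  have hpC := seg_sub h hx hy hp
  set G : Set (Euc n) := segment ℝ x z ∪ segment ℝ y z with hG
  have hGC : G ⊆ C := union_subset (h.cv.segment_subset hx hz) (h.cv.segment_subset hy hz)
  have hGp : IsPreconnected G :=
    IsPreconnected.union z (right_mem_segment _ _ _) (right_mem_segment _ _ _)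
      (convex_segment _ _).isPreconnected (convex_segment _ _).isPreconnected
  have hne : ∀ g ∈ G, g - p ≠ 0 := by
    intro g hg he
    have := hd g hg
    rw [sub_eq_zero.1 he, hDist_self] at this
    linarith
  set E := Real.exp c
  have hE : 1 < E := Real.one_lt_exp_iff.2 (by linarith)
  set s : Euc n → Euc n := fun g => p + tpar C p E (g - p) • (g - p) with hs
  have hsc : ContinuousOn s G := by
    have hj := jg_cont h hpC
    suffices hh : ContinuousOn (fun g => tpar C p E (g - p)) G by
      simp only [hs]; fun_prop
    unfold tpar
    refine ContinuousOn.div continuousOn_const (by fun_prop) ?_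
    intro g hg
    have h1 := jg_pos h hpC (hne g hg)
    have h2 := jg_pos h hpC (neg_ne_zero.2 (hne g hg))
    positivity
  have hsC : ∀ g ∈ G, s g ∈ C := fun g hg => (tpar_mem h hpC (hne g hg) hE).1
  have hsd : ∀ g ∈ G, hDist C p (s g) = c / 2 := by
    intro g hg
    have h1 := (tpar_mem h hpC (hne g hg) hE).2.2
    have h2 := Real.exp_injective h1
    simp only [hs]; linarith
  have ht1 : ∀ g ∈ G, tpar C p E (g - p) ≤ 1 := by
    intro g hg
    apply tpar_le_one h hpC (hne g hg) hE
    · simpa using hGC hg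
    · apply Real.exp_le_exp.2
      have := hd g hg
      rw [add_sub_cancel]; linarith
  have hseg : ∀ g ∈ G, s g ∈ segment ℝ p g := by
    intro g hg
    rw [segment_eq_image']
    exact ⟨_, ⟨(tpar_mem h hpC (hne g hg) hE).2.1.le, ht1 g hg⟩, rfl⟩
  have hxp := h.cv.segment_subset hx hpC
  have hyp := h.cv.segment_subset hy hpC
  have hS : IsPreconnected (s '' G) := hGp.image s hsc
  have hxG : x ∈ G := Or.inl (left_mem_segment _ _ _)
  have hyG : y ∈ G := Or.inr (left_mem_segment _ _ _)
  have hex : ∃ g ∈ G, ∀ w ∈ segment ℝ x y, ρ ≤ hDist C w (s g) := by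
    by_contra hcon
    push Not at hcon
    have hcov : s '' G ⊆ {q | ∃ w ∈ segment ℝ x p, q ∈ C ∧ hDist C w q < ρ} ∪
        {q | ∃ w ∈ segment ℝ y p, q ∈ C ∧ hDist C w q < ρ} := by
      rintro _ ⟨g, hg, rfl⟩
      obtain ⟨w, hw, hwd⟩ := hcon g hg
      have hw' : w ∈ segment ℝ x p ∪ segment ℝ p y := by
        have hp' := hp
        rw [segment_eq_image'] at hw hp'
        obtain ⟨a, ha, rfl⟩ := hw
        obtain ⟨b, hb, rfl⟩ := hp'
        rcases le_total a b with hab | hab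
        · left
          rw [segment_eq_image']
          rcases eq_or_lt_of_le hb.1 with hb0 | hb0
          · have : a = 0 := by linarith [ha.1]
            exact ⟨0, by simp, by simp [this]⟩
          · refine ⟨a / b, ⟨div_nonneg ha.1 hb.1, (div_le_one hb0).2 hab⟩, ?_⟩
            simp only [add_sub_cancel_left, smul_smul]
            rw [div_mul_cancel₀ _ hb0.ne']
        · right
          rw [segment_eq_image']
          rcases eq_or_lt_of_le hb.2 with hb0 | hb0
          · have : a = 1 := by linarith [ha.2]
            exact ⟨0, by simp, by simp [this, hb0]⟩
          · have h1b : 0 < 1 - b := by linarith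
            refine ⟨(a - b) / (1 - b), ⟨div_nonneg (by linarith) h1b.le, (div_le_one h1b).2 (by linarith [ha.2])⟩, ?_⟩
            have : y - (x + b • (y - x)) = (1 - b) • (y - x) := by module
            simp only [this, smul_smul]
            rw [div_mul_cancel₀ _ h1b.ne']
            module
      rcases hw' with hw' | hw'
      · left; exact ⟨w, hw', hsC g hg, hwd⟩
      · right; exact ⟨w, by rwa [segment_symm], hsC g hg, hwd⟩
    obtain ⟨q, ⟨g, hg, rfl⟩, ⟨w1, hw1, -, hd1⟩, w2, hw2, -, hd2⟩ := hS _ _ (nbhd_open' h hxp ρ) (nbhd_open' h hyp ρ) hcov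
      ⟨s x, ⟨x, hxG, rfl⟩, s x, by rw [segment_symm]; exact hseg x hxG, hsC x hxG, by rw [hDist_self]; exact hρ⟩
      ⟨s y, ⟨y, hyG, rfl⟩, s y, by rw [segment_symm]; exact hseg y hyG, hsC y hyG, by rw [hDist_self]; exact hρ⟩
    have hqC := hsC g hg
    have hq := hsd g hg
    have c1 := hxp hw1
    have c2 := hyp hw2
    have a1 := hDist_seg h hx hpC hw1
    have a2 := hDist_seg h hy hpC hw2
    have a3 := hDist_seg h hx hy hp
    have b1 := hDist_tri h hpC c1 hqC
    have b2 := hDist_tri h hpC c2 hqC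
    have b3 := hDist_tri h c1 hqC c2
    have b4 := hDist_tri h hx c1 c2
    have b5 := hDist_tri h hx c2 hy
    have d1 := hDist_comm h hqC c2
    have d2 := hDist_comm h hpC c1
    have d3 := hDist_comm h hpC c2
    have d4 := hDist_comm h c2 hy
    have d5 := hDist_comm h hpC hy
    linarith
  obtain ⟨g, hg, hgd⟩ := hex
  refine ⟨s g, ?_, ?_⟩
  · have hxh : x ∈ convexHull ℝ {x, y, z} := subset_convexHull _ _ (by simp)
    have hyh : y ∈ convexHull ℝ {x, y, z} := subset_convexHull _ _ (by simp)
    have hzh : z ∈ convexHull ℝ {x, y, z} := subset_convexHull _ _ (by simp)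
    have hcv := convex_convexHull ℝ ({x, y, z} : Set (Euc n))
    have hph := hcv.segment_subset hxh hyh hp
    have hgh : g ∈ convexHull ℝ {x, y, z} := by
      rcases hg with hg | hg
      · exact hcv.segment_subset hxh hzh hg
      · exact hcv.segment_subset hyh hzh hg
    exact hcv.segment_subset hph hgh (hseg g hg)
  · rintro w (hw | hw)
    · exact hgd w hw
    · have hwC : w ∈ C := hGC hw
      have h1 := hd w hw
      have h2 := hDist_tri h hpC (hsC g hg) hwC
      have h3 := hsd g hg
      have h4 := hDist_comm h (hsC g hg) hwC
      linarith

end fat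
end HG

namespace HG

section norm
variable {n : ℕ} {C : Set (Euc n)} {p u w : Euc n}

lemma fN_nonneg (h : OBC C) (hp : p ∈ C) : 0 ≤ fNorm C p u := by
  rw [fNorm_eq h hp]
  have := jg_nonneg (C := C) (p := p) (v := u)
  have := jg_nonneg (C := C) (p := p) (v := -u)
  linarith

lemma fN_pos (h : OBC C) (hp : p ∈ C) (hu : u ≠ 0) : 0 < fNorm C p u := by
  rw [fNorm_eq h hp]
  have := jg_nonneg (C := C) (p := p) (v := -u)
  have := jg_pos h hp hu
  linarith

lemma fN_zero : fNorm C p 0 = 0 := by simp [fNorm]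

lemma fN_neg (h : OBC C) (hp : p ∈ C) : fNorm C p (-u) = fNorm C p u := by
  rw [fNorm_eq h hp, fNorm_eq h hp, neg_neg]; ring

lemma fN_smul_nonneg (h : OBC C) (hp : p ∈ C) {t : ℝ} (ht : 0 ≤ t) : fNorm C p (t • u) = t * fNorm C p u := by
  rw [fNorm_eq h hp, fNorm_eq h hp, ← smul_neg, jg_smul ht, jg_smul ht]; ring

lemma fN_smul (h : OBC C) (hp : p ∈ C) (t : ℝ) : fNorm C p (t • u) = |t| * fNorm C p u := by
  rcases le_total 0 t with ht | ht
  · rw [fN_smul_nonneg h hp ht, abs_of_nonneg ht]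
  · have : t • u = (-t) • (-u) := by module
    rw [this, fN_smul_nonneg h hp (by linarith), fN_neg h hp, abs_of_nonpos ht]

lemma fN_add (h : OBC C) (hp : p ∈ C) : fNorm C p (u + w) ≤ fNorm C p u + fNorm C p w := by
  rw [fNorm_eq h hp, fNorm_eq h hp, fNorm_eq h hp]
  have h1 := jg_add h hp (v := u) (w := w)
  have h2 := jg_add h hp (v := -u) (w := -w)
  rw [← neg_add] at h2
  linarith

lemma fN_cont (h : OBC C) (hp : p ∈ C) : Continuous (fNorm C p) := by
  have : fNorm C p = fun u => (1 / 2) * (jg C p u + jg C p (-u)) := by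
    ext u; rw [fNorm_eq h hp]
  rw [this]
  have := jg_cont h hp
  fun_prop

lemma jg_lt_iff (h : OBC C) (hp : p ∈ C) {r : ℝ} (hr : 0 < r) : jg C p u < r ↔ p + r⁻¹ • u ∈ C := by
  rw [mem_iff h hp (by positivity), inv_mul_lt_iff₀ hr, mul_one]

lemma fN_lt_iff (h : OBC C) (hp : p ∈ C) {a : ℝ} : fNorm C p u < a ↔
    ∃ r : ℝ, ∃ s : ℝ, 0 < r ∧ 0 < s ∧ r + s = 2 * a ∧ p + r⁻¹ • u ∈ C ∧ p + s⁻¹ • (-u) ∈ C := by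
  rw [fNorm_eq h hp]
  have h1 := jg_nonneg (C := C) (p := p) (v := u)
  have h2 := jg_nonneg (C := C) (p := p) (v := -u)
  constructor
  · intro ha
    set e := (2 * a - jg C p u - jg C p (-u)) / 2 with he
    have he0 : 0 < e := by rw [he]; linarith
    refine ⟨jg C p u + e, jg C p (-u) + e, by linarith, by linarith, by rw [he]; ring, ?_, ?_⟩
    · exact (jg_lt_iff h hp (by linarith)).1 (by linarith)
    · exact (jg_lt_iff h hp (by linarith)).1 (by linarith)
  · rintro ⟨r, s, hr, hs, e, m1, m2⟩
    have := (jg_lt_iff h hp hr).2 m1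
    have := (jg_lt_iff h hp hs).2 m2
    linarith

lemma fN_open (h : OBC C) (a : ℝ) : IsOpen {x : Euc n × Euc n | x.1 ∈ C ∧ fNorm C x.1 x.2 < a} := by
  have : {x : Euc n × Euc n | x.1 ∈ C ∧ fNorm C x.1 x.2 < a} =
      ⋃ (r : ℝ) (s : ℝ) (_ : 0 < r ∧ 0 < s ∧ r + s = 2 * a),
        {x : Euc n × Euc n | x.1 ∈ C ∧ x.1 + r⁻¹ • x.2 ∈ C ∧ x.1 + s⁻¹ • (-x.2) ∈ C} := by
    ext x
    simp only [mem_ofPred_eq, mem_iUnion]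
    constructor
    · rintro ⟨hx, hf⟩
      obtain ⟨r, s, hr, hs, e, m1, m2⟩ := (fN_lt_iff h hx).1 hf
      exact ⟨r, s, ⟨hr, hs, e⟩, hx, m1, m2⟩
    · rintro ⟨r, s, ⟨hr, hs, e⟩, hx, m1, m2⟩
      exact ⟨hx, (fN_lt_iff h hx).2 ⟨r, s, hr, hs, e, m1, m2⟩⟩
  rw [this]
  refine isOpen_iUnion fun r => isOpen_iUnion fun s => isOpen_iUnion fun _ => ?_
  refine IsOpen.inter (h.op.preimage continuous_fst) (IsOpen.inter ?_ ?_)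
  · exact h.op.preimage (by fun_prop)
  · exact h.op.preimage (by fun_prop)

lemma tb_open (h : OBC C) (hp : p ∈ C) : IsOpen (tangentBall C p 1) :=
  isOpen_lt (fN_cont h hp) continuous_const

lemma tb_convex (h : OBC C) (hp : p ∈ C) : Convex ℝ (tangentBall C p 1) := by
  intro x hx y hy a b ha hb hab
  have h1 := fN_add h hp (u := a • x) (w := b • y)
  rw [fN_smul_nonneg h hp ha, fN_smul_nonneg h hp hb] at h1
  have hx' : fNorm C p x < 1 := hx
  have hy' : fNorm C p y < 1 := hy
  show fNorm C p (a • x + b • y) < 1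
  rcases eq_or_lt_of_le ha with h0 | h0
  · subst h0
    have : b = 1 := by linarith
    subst this; linarith
  · nlinarith

lemma fN_lower (h : OBC C) : ∃ c > 0, ∀ p ∈ C, ∀ u, c * ‖u‖ ≤ fNorm C p u := by
  obtain ⟨R, hR⟩ := h.bd.subset_closedBall 0
  have hR1 : ∀ x ∈ C, ‖x‖ ≤ |R| := fun x hx => by
    have := hR hx; rw [mem_closedBall_zero_iff] at this; exact this.trans (le_abs_self _)
  refine ⟨(2 * (|R| + 1))⁻¹, by positivity, ?_⟩
  intro p hp u
  have key : ∀ v, (2 * (|R| + 1))⁻¹ * ‖v‖ ≤ jg C p v := by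
    intro v
    by_contra hcon
    push Not at hcon
    have hv : 0 < ‖v‖ := by
      rcases eq_or_ne v 0 with e | e
      · subst e; simp at hcon
      · exact norm_pos_iff.2 e
    have h1 : 0 < (2 * (|R| + 1))⁻¹ * ‖v‖ := by positivity
    have h2 := (jg_lt_iff h hp h1).1 hcon
    have h3 := hR1 _ h2
    have h4 := hR1 _ hp
    have h5 : ‖((2 * (|R| + 1))⁻¹ * ‖v‖)⁻¹ • v‖ ≤ |R| + |R| := by
      calc _ = ‖(p + ((2 * (|R| + 1))⁻¹ * ‖v‖)⁻¹ • v) - p‖ := by simp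
        _ ≤ _ := (norm_sub_le _ _).trans (add_le_add h3 h4)
    rw [norm_smul, norm_inv, Real.norm_of_nonneg h1.le, mul_inv, inv_inv, mul_assoc, inv_mul_cancel₀ hv.ne'] at h5
    linarith
  rw [fNorm_eq h hp]
  have h1 := key u
  have h2 := key (-u)
  rw [norm_neg] at h2
  linarith

lemma tb_bdd (h : OBC C) (hp : p ∈ C) : Bornology.IsBounded (tangentBall C p 1) := by
  obtain ⟨c, hc, hl⟩ := fN_lower h
  refine (Metric.isBounded_closedBall (x := (0 : Euc n)) (r := c⁻¹)).subset ?_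
  intro u hu
  have h1 : fNorm C p u < 1 := hu
  have := hl p hp u
  rw [mem_closedBall_zero_iff, ← one_div, le_div_iff₀ hc]
  linarith

end norm
end HG

namespace HG

section meas
variable {n : ℕ} {C : Set (Euc n)} {p u w : Euc n}

lemma tb_vol_pos (h : OBC C) (hp : p ∈ C) : 0 < volume (tangentBall C p 1) :=
  (tb_open h hp).measure_pos _ ⟨0, by simp [tangentBall, fN_zero]⟩

lemma tb_vol_lt (h : OBC C) (hp : p ∈ C) : volume (tangentBall C p 1) < ⊤ :=
  (tb_bdd h hp).measure_lt_top

lemma tb_real_pos (h : OBC C) (hp : p ∈ C) : 0 < (volume (tangentBall C p 1)).toReal :=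
  ENNReal.toReal_pos (tb_vol_pos h hp).ne' (tb_vol_lt h hp).ne

lemma omega_pos : 0 < omegaVol n :=
  ENNReal.toReal_pos (Metric.measure_ball_pos _ _ zero_lt_one).ne' measure_ball_lt_top.ne

/-- real density -/
noncomputable def dens (C : Set (Euc n)) (p : Euc n) : ℝ := omegaVol n / (volume (tangentBall C p 1)).toReal

lemma dens_pos (h : OBC C) (hp : p ∈ C) : 0 < dens C p := div_pos omega_pos (tb_real_pos h hp)

lemma dens_meas (h : OBC C) : Measurable (C.indicator (dens C)) := by
  have h1 := measurable_measure_prodMk_left (ν := (volume : Measure (Euc n))) (fN_open h 1).measurableSet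
  have h2 : Measurable fun x : Euc n => omegaVol n /
      (volume (Prod.mk x ⁻¹' {x : Euc n × Euc n | x.1 ∈ C ∧ fNorm C x.1 x.2 < 1})).toReal :=
    measurable_const.div h1.ennreal_toReal
  have : C.indicator (dens C) = C.indicator fun x : Euc n => omegaVol n /
      (volume (Prod.mk x ⁻¹' {x : Euc n × Euc n | x.1 ∈ C ∧ fNorm C x.1 x.2 < 1})).toReal := by
    apply indicator_congr
    intro x hx
    unfold dens
    congr 3
    ext y
    simp [tangentBall, hx]
  rw [this]
  exact h2.indicator h.op.measurableSet

lemma fN_meas (h : OBC C) (u : Euc n) : Measurable (C.indicator fun p => fNorm C p u) := by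
  apply measurable_of_Iio
  intro a
  rcases le_or_gt a 0 with ha | ha
  · convert MeasurableSet.empty
    ext x
    simp only [mem_preimage, mem_Iio, mem_empty_iff_false, iff_false, not_lt]
    refine ha.trans (indicator_nonneg (fun x hx => fN_nonneg h hx) x)
  · have : (C.indicator fun p => fNorm C p u) ⁻¹' Iio a = Cᶜ ∪ {p | p ∈ C ∧ fNorm C p u < a} := by
      ext x
      by_cases hx : x ∈ C <;> simp [hx, ha]
    rw [this]
    refine h.op.measurableSet.compl.union ?_
    exact ((fN_open h a).preimage (f := fun p => (p, u)) (by fun_prop)).measurableSet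

lemma dual_ub (h : OBC C) (hp : p ∈ C) (l : Euc n →L[ℝ] ℝ) {K : ℝ} (hK : 0 ≤ K)
    (hl : ∀ u, l u ≤ K * fNorm C p u) : dualNorm C p l ≤ K := by
  apply Real.sSup_le _ hK
  rintro _ ⟨u, hu, rfl⟩
  have h1 : fNorm C p u = 1 := hu
  have := hl u
  rw [h1] at this; simpa using this

lemma dual_bdd (h : OBC C) (hp : p ∈ C) (l : Euc n →L[ℝ] ℝ) :
    BddAbove ((fun u => l u) '' {u : Euc n | fNorm C p u = 1}) := by
  obtain ⟨c, hc, hl⟩ := fN_lower h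
  refine ⟨‖l‖ * c⁻¹, ?_⟩
  rintro _ ⟨u, hu, rfl⟩
  have h1 : fNorm C p u = 1 := hu
  have h2 := hl p hp u
  rw [h1] at h2
  have h3 : ‖u‖ ≤ c⁻¹ := by rw [← one_div, le_div_iff₀ hc]; linarith
  calc l u ≤ ‖l u‖ := le_abs_self _
    _ ≤ ‖l‖ * ‖u‖ := l.le_opNorm u
    _ ≤ _ := by gcongr

lemma dual_le (h : OBC C) (hp : p ∈ C) (l : Euc n →L[ℝ] ℝ) (u : Euc n) :
    l u ≤ dualNorm C p l * fNorm C p u := by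
  rcases eq_or_ne u 0 with hu | hu
  · subst hu; simp [fN_zero]
  have h1 := fN_pos h hp hu
  have h2 : l ((fNorm C p u)⁻¹ • u) ≤ dualNorm C p l := by
    apply le_csSup (dual_bdd h hp l)
    refine ⟨_, ?_, rfl⟩
    show fNorm C p _ = 1
    rw [fN_smul_nonneg h hp (by positivity), inv_mul_cancel₀ h1.ne']
  rw [map_smul, smul_eq_mul, inv_mul_le_iff₀ h1] at h2
  linarith

lemma dual_nonneg (h : OBC C) (hp : p ∈ C) (l : Euc n →L[ℝ] ℝ) : 0 ≤ dualNorm C p l := by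
  by_cases hn : ∃ u : Euc n, u ≠ 0
  · obtain ⟨u, hu⟩ := hn
    have h1 := fN_pos h hp hu
    have h2 := dual_le h hp l u
    have h3 := dual_le h hp l (-u)
    rw [fN_neg h hp, map_neg] at h3
    by_contra hcon
    push Not at hcon
    nlinarith
  · push Not at hn
    apply Real.sSup_nonneg
    rintro _ ⟨u, hu, rfl⟩
    simp [hn u]

lemma abs_dual_le (h : OBC C) (hp : p ∈ C) (l : Euc n →L[ℝ] ℝ) (u : Euc n) :
    |l u| ≤ dualNorm C p l * fNorm C p u := by
  rw [abs_le]
  refine ⟨?_, dual_le h hp l u⟩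
  have h3 := dual_le h hp l (-u)
  rw [fN_neg h hp, map_neg] at h3
  linarith

lemma dual_meas (h : OBC C) (f : Euc n → ℝ) :
    Measurable (C.indicator fun p => dualNorm C p (fderiv ℝ f p)) := by
  apply measurable_of_Ioi
  intro a
  rcases lt_or_ge a 0 with ha | ha
  · convert MeasurableSet.univ
    ext x
    simp only [mem_preimage, mem_Ioi, mem_univ, iff_true]
    exact lt_of_lt_of_le ha (indicator_nonneg (fun x hx => dual_nonneg h hx _) x)
  · obtain ⟨S, hSc, hSd⟩ := TopologicalSpace.exists_countable_dense (Euc n)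
    have : (C.indicator fun p => dualNorm C p (fderiv ℝ f p)) ⁻¹' Ioi a =
        ⋃ u ∈ S, {p | p ∈ C ∧ a * C.indicator (fun p => fNorm C p u) p < fderiv ℝ f p u} := by
      ext x
      simp only [mem_preimage, mem_Ioi, mem_iUnion, mem_ofPred_eq]
      by_cases hx : x ∈ C
      · simp only [indicator_of_mem hx, hx, true_and]
        constructor
        · intro hlt
          by_contra hcon
          push Not at hcon
          have hcl : IsClosed {u | fderiv ℝ f x u ≤ a * fNorm C x u} :=
            isClosed_le (fderiv ℝ f x).continuous (continuous_const.mul (fN_cont h hx))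
          have : ∀ u, fderiv ℝ f x u ≤ a * fNorm C x u := by
            intro u
            have h1 : closure S ⊆ {u | fderiv ℝ f x u ≤ a * fNorm C x u} :=
              closure_minimal (fun u hu => by simpa using hcon u hu) hcl
            exact h1 (hSd u)
          have := dual_ub h hx _ ha this
          linarith
        · rintro ⟨u, -, hu⟩
          have h1 := dual_le h hx (fderiv ℝ f x) u
          have h2 : 0 ≤ fNorm C x u := fN_nonneg h hx
          by_contra hcon
          push Not at hcon
          nlinarith
      · simp [hx, ha]
    rw [this]
    refine MeasurableSet.biUnion hSc fun u _ => ?_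
    refine h.op.measurableSet.inter ?_
    exact measurableSet_lt (measurable_const.mul (fN_meas h u)) (measurable_fderiv_apply_const ℝ f u)

lemma hM_eq (h : OBC C) : hMeasure C = (volume.restrict C).withDensity
    fun p => ENNReal.ofReal (C.indicator (dens C) p) := by
  unfold hMeasure
  apply withDensity_congr_ae
  filter_upwards [ae_restrict_mem h.op.measurableSet] with x hx
  rw [indicator_of_mem hx]; rfl

lemma hM_restrict (h : OBC C) : (hMeasure C).restrict C = hMeasure C := by
  rw [hM_eq h, restrict_withDensity h.op.measurableSet, Measure.restrict_restrict h.op.measurableSet, inter_self]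

lemma hM_lint (h : OBC C) (g : Euc n → ℝ≥0∞) (hg : AEMeasurable g (volume.restrict C)) :
    ∫⁻ x, g x ∂(hMeasure C) = ∫⁻ x in C, ENNReal.ofReal (dens C x) * g x := by
  rw [hM_eq h, lintegral_withDensity_eq_lintegral_mul₀]
  · apply setLIntegral_congr_fun h.op.measurableSet
    intro x hx
    simp [indicator_of_mem hx]
  · exact (dens_meas h).ennreal_ofReal.aemeasurable
  · exact hg

lemma hM_apply (h : OBC C) {s : Set (Euc n)} (hs : MeasurableSet s) (hsC : s ⊆ C) :
    hMeasure C s = ∫⁻ x in s, ENNReal.ofReal (dens C x) := by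
  rw [hM_eq h, withDensity_apply _ hs, Measure.restrict_restrict hs, inter_eq_left.2 hsC]
  apply setLIntegral_congr_fun hs
  intro x hx
  simp [indicator_of_mem (hsC hx)]

lemma rayleigh_nonneg (h : OBC C) (f : Euc n → ℝ) : 0 ≤ rayleigh C C f := by
  unfold rayleigh
  apply div_nonneg <;> exact integral_nonneg fun _ => sq_nonneg _

lemma lambda1_le (h : OBC C) {f : Euc n → ℝ} (hf : f ∈ testFuns C) : lambda1 C ≤ rayleigh C C f := by
  apply csInf_le
  · refine ⟨0, ?_⟩
    rintro _ ⟨g, _, rfl⟩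
    exact rayleigh_nonneg h g
  · exact ⟨f, hf, rfl⟩

end meas
end HG

namespace HG

section tri
variable {D : Set (Euc 2)} (b : AffineBasis (Fin 3) ℝ (Euc 2))

/-- barycentric coordinate -/
noncomputable def bl (i : Fin 3) (w : Euc 2) : ℝ := b.coord i w
/-- its linear part -/
noncomputable def dl (i : Fin 3) : Euc 2 →L[ℝ] ℝ := LinearMap.toContinuousLinearMap (b.coord i).linear

lemma bl_add (i : Fin 3) (w u : Euc 2) : bl b i (w + u) = bl b i w + dl b i u := by
  have := (b.coord i).map_vadd w u
  simp only [vadd_eq_add] at this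
  unfold bl dl
  rw [add_comm, this, add_comm]; rfl

lemma bl_sum (w : Euc 2) : bl b 0 w + bl b 1 w + bl b 2 w = 1 := by
  have := b.sum_coord_apply_eq_one w
  rw [Fin.sum_univ_three] at this
  exact this

lemma dl_sum (u : Euc 2) : dl b 0 u + dl b 1 u + dl b 2 u = 0 := by
  have h1 := bl_sum b (0 + u)
  have h2 := bl_sum b 0
  rw [bl_add, bl_add, bl_add] at h1
  linarith

lemma bl_self (w : Euc 2) : w = bl b 0 w • b 0 + bl b 1 w • b 1 + bl b 2 w • b 2 := by
  have := b.linear_combination_coord_eq_self w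
  rw [Fin.sum_univ_three] at this
  exact this.symm

lemma bl_comb (c : Fin 3 → ℝ) (hc : c 0 + c 1 + c 2 = 1) (i : Fin 3) :
    bl b i (c 0 • b 0 + c 1 • b 1 + c 2 • b 2) = c i := by
  have hs : ∑ i, c i = 1 := by rw [Fin.sum_univ_three]; exact hc
  have h1 := b.coord_apply_combination_of_mem (Finset.mem_univ i) hs
  rw [Finset.affineCombination_eq_linear_combination _ _ _ hs, Fin.sum_univ_three] at h1
  exact h1

lemma bl_cont (i : Fin 3) : Continuous (bl b i) := by
  have : bl b i = fun w => bl b i 0 + dl b i w := by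
    ext w; rw [← bl_add, zero_add]
  rw [this]; fun_prop

/-- open triangle -/
def tint : Set (Euc 2) := {w | ∀ i, 0 < bl b i w}

lemma tint_open : IsOpen (tint b) := by
  have : tint b = ⋂ i, {w | 0 < bl b i w} := by ext; simp [tint]
  rw [this]
  exact isOpen_iInter_of_finite fun i => isOpen_lt continuous_const (bl_cont b i)

lemma tint_sub (h : OBC D) (hb : ∀ i, b i ∈ D) {w : Euc 2} (hw : ∀ i, 0 ≤ bl b i w) : w ∈ D := by
  rw [bl_self b w]
  have h1 := h.cv.sum_mem (t := Finset.univ) (w := fun i => bl b i w) (z := fun i => b i)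
    (fun i _ => hw i) (by rw [Fin.sum_univ_three]; exact bl_sum b w) (fun i _ => hb i)
  rwa [Fin.sum_univ_three] at h1

/-- log-derivatives -/
noncomputable def al (w : Euc 2) (i : Fin 3) : Euc 2 →L[ℝ] ℝ := (bl b i w)⁻¹ • dl b i

lemma al_apply (w u : Euc 2) (i : Fin 3) : al b w i u = (bl b i w)⁻¹ * dl b i u := rfl

lemma dl_al {w : Euc 2} (hw : w ∈ tint b) (i : Fin 3) (u : Euc 2) : dl b i u = bl b i w * al b w i u := by
  have := hw i
  rw [al_apply]; field_simp

lemma jg_le_al (h : OBC D) (hb : ∀ i, b i ∈ D) {w u : Euc 2} (hw : w ∈ tint b) {r : ℝ}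
    (hr : ∀ i, -al b w i u ≤ r) : jg D w u ≤ r := by
  have hwD : w ∈ D := tint_sub b h hb fun i => (hw i).le
  have hr0 : 0 ≤ r := by
    have h1 := dl_sum b u
    have h2 := bl_sum b w
    rw [dl_al b hw, dl_al b hw, dl_al b hw] at h1
    nlinarith [hr 0, hr 1, hr 2, hw 0, hw 1, hw 2, mul_le_mul_of_nonneg_left (hr 0) (hw 0).le,
      mul_le_mul_of_nonneg_left (hr 1) (hw 1).le, mul_le_mul_of_nonneg_left (hr 2) (hw 2).le]
  apply le_of_forall_gt
  intro s hs
  have hs0 : 0 < s := by linarith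
  rw [jg_lt_iff h hwD hs0]
  apply tint_sub b h hb
  intro i
  rw [bl_add, map_smul, smul_eq_mul, dl_al b hw]
  have h1 : 0 ≤ s + al b w i u := by linarith [hr i]
  have h2 : bl b i w + s⁻¹ * (bl b i w * al b w i u) = bl b i w * s⁻¹ * (s + al b w i u) := by
    field_simp
  rw [h2]
  exact mul_nonneg (mul_nonneg (hw i).le (by positivity)) h1

lemma fN_le_al (h : OBC D) (hb : ∀ i, b i ∈ D) {w u : Euc 2} (hw : w ∈ tint b) {N : ℝ}
    (hN : ∀ i k, al b w i u - al b w k u ≤ 2 * N) : fNorm D w u ≤ N := by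
  have hwD : w ∈ D := tint_sub b h hb fun i => (hw i).le
  obtain ⟨i0, h0⟩ := Finite.exists_min (fun i => al b w i u)
  obtain ⟨i1, h1⟩ := Finite.exists_max (fun i => al b w i u)
  have a1 := jg_le_al b h hb hw (u := u) (r := -al b w i0 u) (fun i => by linarith [h0 i])
  have a2 := jg_le_al b h hb hw (u := -u) (r := al b w i1 u) (fun i => by rw [map_neg]; linarith [h1 i])
  rw [fNorm_eq h hwD]
  linarith [hN i1 i0]

lemma al_le_fN (h : OBC D) {w u : Euc 2} (hw : w ∈ tint b) (hwD : w ∈ D)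
    (hball : ∀ z ∈ D, hDist D w z < 1 → z ∈ tint b) (i k : Fin 3) :
    al b w i u - al b w k u ≤ 4 * fNorm D w u := by
  rcases eq_or_ne u 0 with hu | hu
  · subst hu; simp [fN_zero]
  have key : ∀ v : Euc 2, v ≠ 0 → ∀ i, -al b w i v ≤ (jg D w (-v) + 3 * jg D w v) / 2 := by
    intro v hv i
    obtain ⟨m1, m2, m3⟩ := tpar_mem h hwD hv (E := 3) (by norm_num)
    have hlt : hDist D w (w + tpar D w 3 v • v) < 1 := by
      by_contra hcon
      push Not at hcon
      have h1 := Real.add_one_lt_exp (x := 2) (by norm_num)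
      have h2 : Real.exp 2 ≤ Real.exp (2 * hDist D w (w + tpar D w 3 v • v)) := Real.exp_le_exp.2 (by linarith)
      rw [m3] at h2
      linarith
    have h3 := hball _ m1 hlt i
    rw [bl_add, map_smul, smul_eq_mul, dl_al b hw] at h3
    have h4 : 0 < 1 + tpar D w 3 v * al b w i v := by
      have : bl b i w + tpar D w 3 v * (bl b i w * al b w i v) = bl b i w * (1 + tpar D w 3 v * al b w i v) := by ring
      rw [this] at h3
      exact (pos_iff_pos_of_mul_pos h3).1 (hw i)
    have h5 := jg_pos h hwD hv
    have h6 := jg_pos h hwD (neg_ne_zero.2 hv)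
    unfold tpar at h4
    have h7 : 0 < jg D w (-v) + 3 * jg D w v := by positivity
    have h8 : 1 + (3 - 1) / (jg D w (-v) + 3 * jg D w v) * al b w i v =
      (jg D w (-v) + 3 * jg D w v + 2 * al b w i v) / (jg D w (-v) + 3 * jg D w v) := by
      field_simp; ring
    rw [h8, div_pos_iff_of_pos_right h7] at h4
    linarith
  have k1 := key u hu k
  have k2 := key (-u) (neg_ne_zero.2 hu) i
  rw [map_neg, neg_neg, neg_neg] at k2
  rw [fNorm_eq h hwD]
  linarith

/-- log coordinates -/
noncomputable def Xi (q w : Euc 2) : Euc 2 :=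
  !₂[(Real.log (bl b 0 w) - Real.log (bl b 0 q)) - (Real.log (bl b 2 w) - Real.log (bl b 2 q)),
     (Real.log (bl b 1 w) - Real.log (bl b 1 q)) - (Real.log (bl b 2 w) - Real.log (bl b 2 q))]

/-- derivative of log coordinates -/
noncomputable def dXi (w : Euc 2) : Euc 2 →L[ℝ] Euc 2 :=
  (EuclideanSpace.equiv (Fin 2) ℝ).symm.toContinuousLinearMap ∘L
    ContinuousLinearMap.pi ![al b w 0 - al b w 2, al b w 1 - al b w 2]

lemma dXi_0 (w u : Euc 2) : dXi b w u 0 = al b w 0 u - al b w 2 u := by simp [dXi]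
lemma dXi_1 (w u : Euc 2) : dXi b w u 1 = al b w 1 u - al b w 2 u := by simp [dXi]

lemma bl_deriv (i : Fin 3) (w : Euc 2) : HasFDerivAt (bl b i) (dl b i) w := by
  have : bl b i = fun w => bl b i 0 + dl b i w := by
    ext w; rw [← bl_add, zero_add]
  rw [this]
  exact ((dl b i).hasFDerivAt).const_add _

lemma log_deriv {w : Euc 2} (hw : w ∈ tint b) (i : Fin 3) :
    HasFDerivAt (fun w => Real.log (bl b i w)) (al b w i) w :=
  (bl_deriv b i w).log (hw i).ne'

lemma Xi_deriv (q : Euc 2) {w : Euc 2} (hw : w ∈ tint b) : HasFDerivAt (Xi b q) (dXi b w) w := by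
  rw [← hasFDerivWithinAt_univ, hasFDerivWithinAt_euclidean]
  intro i
  rw [hasFDerivWithinAt_univ]
  fin_cases i
  · exact ((log_deriv b hw 0).sub_const _).sub ((log_deriv b hw 2).sub_const _)
  · exact ((log_deriv b hw 1).sub_const _).sub ((log_deriv b hw 2).sub_const _)

lemma Xi_contDiff (q : Euc 2) : ContDiffOn ℝ 1 (Xi b q) (tint b) := by
  rw [contDiffOn_euclidean]
  have hbl : ∀ i, ContDiff ℝ 1 (bl b i) := by
    intro i
    have : bl b i = fun w => bl b i 0 + dl b i w := by
      ext w; rw [← bl_add, zero_add]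
    rw [this]; fun_prop
  have hl : ∀ i, ContDiffOn ℝ 1 (fun w => Real.log (bl b i w)) (tint b) := fun i =>
    (hbl i).contDiffOn.log fun w hw => (hw i).ne'
  intro i
  fin_cases i
  · exact ((hl 0).sub contDiffOn_const).sub ((hl 2).sub contDiffOn_const)
  · exact ((hl 1).sub contDiffOn_const).sub ((hl 2).sub contDiffOn_const)

lemma norm2_le (x : Euc 2) : ‖x‖ ≤ |x 0| + |x 1| := by
  rw [EuclideanSpace.norm_eq, Fin.sum_univ_two, Real.norm_eq_abs, Real.norm_eq_abs]
  apply Real.sqrt_le_iff.2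
  constructor
  · positivity
  · nlinarith [abs_nonneg (x 0), abs_nonneg (x 1)]

lemma fN_le_dXi (h : OBC D) (hb : ∀ i, b i ∈ D) {w : Euc 2} (hw : w ∈ tint b) (u : Euc 2) :
    fNorm D w u ≤ ‖dXi b w u‖ := by
  have h0 := PiLp.norm_apply_le (dXi b w u) 0
  have h1 := PiLp.norm_apply_le (dXi b w u) 1
  rw [dXi_0, Real.norm_eq_abs, abs_le] at h0
  rw [dXi_1, Real.norm_eq_abs, abs_le] at h1
  have h2 := norm_nonneg (dXi b w u)
  apply fN_le_al b h hb hw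
  intro i k
  fin_cases i <;> fin_cases k <;> simp only [Fin.zero_eta, Fin.mk_one, Fin.reduceFinMk] <;> linarith

lemma dXi_le_fN (h : OBC D) {w : Euc 2} (hw : w ∈ tint b) (hwD : w ∈ D)
    (hball : ∀ z ∈ D, hDist D w z < 1 → z ∈ tint b) (u : Euc 2) : ‖dXi b w u‖ ≤ 8 * fNorm D w u := by
  have h1 := al_le_fN b h hw hwD hball (u := u)
  have h2 : |dXi b w u 0| ≤ 4 * fNorm D w u := by
    rw [dXi_0, abs_le]; constructor <;> linarith [h1 0 2, h1 2 0]
  have h3 : |dXi b w u 1| ≤ 4 * fNorm D w u := by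
    rw [dXi_1, abs_le]; constructor <;> linarith [h1 1 2, h1 2 1]
  have := norm2_le (dXi b w u)
  linarith

end tri
end HG

namespace HG

section tri2
variable {D : Set (Euc 2)} (b : AffineBasis (Fin 3) ℝ (Euc 2))

lemma dXi_det (h : OBC D) (hb : ∀ i, b i ∈ D) {w : Euc 2} (hw : w ∈ tint b) :
    LinearMap.det (dXi b w : Euc 2 →ₗ[ℝ] Euc 2) ≠ 0 := by
  intro h0
  have h1 := LinearMap.bot_lt_ker_of_det_eq_zero h0
  obtain ⟨u, hu, hu0⟩ := (Submodule.ne_bot_iff _).1 h1.ne'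
  have hwD : w ∈ D := tint_sub b h hb fun i => (hw i).le
  have h2 := fN_le_dXi b h hb hw u
  have h3 := fN_pos h hwD hu0
  have h4 : dXi b w u = 0 := hu
  rw [h4, norm_zero] at h2
  linarith

lemma vol_ball_real {r : ℝ} (hr : 0 ≤ r) : volume (Metric.ball (0 : Euc 2) r) = ENNReal.ofReal (r ^ 2 * omegaVol 2) := by
  rw [Measure.addHaar_ball _ _ hr, ENNReal.ofReal_mul (by positivity), omegaVol, ENNReal.ofReal_toReal measure_ball_lt_top.ne]
  simp

lemma dens_le_det (h : OBC D) (hb : ∀ i, b i ∈ D) {w : Euc 2} (hw : w ∈ tint b) :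
    dens D w ≤ |(dXi b w).det| := by
  have hwD : w ∈ D := tint_sub b h hb fun i => (hw i).le
  have hdet := dXi_det b h hb hw
  have hsub : (dXi b w : Euc 2 →ₗ[ℝ] Euc 2) ⁻¹' (Metric.ball 0 1) ⊆ tangentBall D w 1 := by
    intro u hu
    have : ‖dXi b w u‖ < 1 := by simpa using hu
    exact lt_of_le_of_lt (fN_le_dXi b h hb hw u) this
  have h1 := measure_mono (μ := volume) hsub
  rw [Measure.addHaar_preimage_linearMap _ hdet, vol_ball_real zero_le_one, ← ENNReal.ofReal_mul (abs_nonneg _),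
    ENNReal.ofReal_le_iff_le_toReal (tb_vol_lt h hwD).ne, one_pow, one_mul, abs_inv] at h1
  unfold dens
  have hd : 0 < |LinearMap.det (dXi b w : Euc 2 →ₗ[ℝ] Euc 2)| := abs_pos.2 hdet
  rw [div_le_iff₀ (tb_real_pos h hwD)]
  rw [inv_mul_le_iff₀ hd] at h1
  exact h1

lemma det_le_dens (h : OBC D) (hb : ∀ i, b i ∈ D) {w : Euc 2} (hw : w ∈ tint b)
    (hball : ∀ z ∈ D, hDist D w z < 1 → z ∈ tint b) :
    |(dXi b w).det| / 64 ≤ dens D w := by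
  have hwD : w ∈ D := tint_sub b h hb fun i => (hw i).le
  have hdet := dXi_det b h hb hw
  have hsub : tangentBall D w 1 ⊆ (dXi b w : Euc 2 →ₗ[ℝ] Euc 2) ⁻¹' (Metric.ball 0 8) := by
    intro u hu
    have h1 : fNorm D w u < 1 := hu
    have h2 := dXi_le_fN b h hw hwD hball u
    have : ‖dXi b w u‖ < 8 := by linarith
    simpa using this
  have h1 := measure_mono (μ := volume) hsub
  rw [Measure.addHaar_preimage_linearMap _ hdet, vol_ball_real (by norm_num), ← ENNReal.ofReal_mul (abs_nonneg _)] at h1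
  have h2 := ENNReal.toReal_mono ENNReal.ofReal_ne_top h1
  have ho := omega_pos (n := 2)
  rw [ENNReal.toReal_ofReal (by positivity), abs_inv] at h2
  unfold dens
  have hd : 0 < |LinearMap.det (dXi b w : Euc 2 →ₗ[ℝ] Euc 2)| := abs_pos.2 hdet
  rw [← div_eq_inv_mul, le_div_iff₀ hd] at h2
  rw [le_div_iff₀ (tb_real_pos h hwD)]
  show |LinearMap.det (dXi b w : Euc 2 →ₗ[ℝ] Euc 2)| / 64 * _ ≤ _
  linarith

lemma fk_ge (h : OBC D) (hb : ∀ i, b i ∈ D) {q w : Euc 2} (hq : q ∈ tint b) (hw : w ∈ tint b) {a : ℝ}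
    (ha : ∀ i, a ≤ Real.log (bl b i w) - Real.log (bl b i q)) : Real.exp a ≤ fk D q w := by
  unfold fk
  have : jg D q (w - q) ≤ 1 - Real.exp a := by
    apply jg_le_al b h hb hq
    intro i
    have h1 := Real.exp_le_exp.2 (ha i)
    rw [Real.exp_sub, Real.exp_log (hw i), Real.exp_log (hq i), le_div_iff₀ (hq i)] at h1
    have h2 := bl_add b i q (w - q)
    rw [add_sub_cancel, dl_al b hq] at h2
    have h3 := hq i
    by_contra hcon
    push Not at hcon
    nlinarith
  linarith

lemma dist_le_Xi (h : OBC D) (hb : ∀ i, b i ∈ D) {q w : Euc 2} (hq : q ∈ tint b) (hw : w ∈ tint b) :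
    hDist D q w ≤ ‖Xi b q w‖ := by
  have hwD : w ∈ D := tint_sub b h hb fun i => (hw i).le
  have hqD : q ∈ D := tint_sub b h hb fun i => (hq i).le
  set a : Fin 3 → ℝ := fun i => Real.log (bl b i w) - Real.log (bl b i q) with ha
  obtain ⟨i0, h0⟩ := Finite.exists_min a
  obtain ⟨i1, h1⟩ := Finite.exists_max a
  have f1 := fk_ge b h hb hq hw (a := a i0) h0
  have f2 := fk_ge b h hb hw hq (a := -a i1) (fun i => by have := h1 i; simp only [ha] at *; linarith)
  have g1 := Real.log_le_log (Real.exp_pos _) f1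
  have g2 := Real.log_le_log (Real.exp_pos _) f2
  rw [Real.log_exp] at g1 g2
  rw [hDist_eq h hqD hwD]
  have n0 := PiLp.norm_apply_le (Xi b q w) 0
  have n1 := PiLp.norm_apply_le (Xi b q w) 1
  have e0 : Xi b q w 0 = a 0 - a 2 := by simp [Xi, ha]
  have e1 : Xi b q w 1 = a 1 - a 2 := by simp [Xi, ha]
  rw [e0, Real.norm_eq_abs, abs_le] at n0
  rw [e1, Real.norm_eq_abs, abs_le] at n1
  have n2 := norm_nonneg (Xi b q w)
  have : a i1 - a i0 ≤ 2 * ‖Xi b q w‖ := by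
    fin_cases i0 <;> fin_cases i1 <;> simp only [Fin.zero_eta, Fin.mk_one, Fin.reduceFinMk] <;> linarith
  linarith

/-- weights of the inverse chart -/
noncomputable def wt (q ξ : Euc 2) : Fin 3 → ℝ :=
  ![bl b 0 q * Real.exp (ξ 0), bl b 1 q * Real.exp (ξ 1), bl b 2 q]

/-- inverse chart -/
noncomputable def Ph (q ξ : Euc 2) : Euc 2 :=
  (wt b q ξ 0 / (wt b q ξ 0 + wt b q ξ 1 + wt b q ξ 2)) • b 0 +
  (wt b q ξ 1 / (wt b q ξ 0 + wt b q ξ 1 + wt b q ξ 2)) • b 1 +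
  (wt b q ξ 2 / (wt b q ξ 0 + wt b q ξ 1 + wt b q ξ 2)) • b 2

lemma wt_pos {q : Euc 2} (hq : q ∈ tint b) (ξ : Euc 2) (i : Fin 3) : 0 < wt b q ξ i := by
  have h0 := hq 0
  have h1 := hq 1
  have h2 := hq 2
  fin_cases i <;> simp [wt] <;> positivity

lemma Ph_bl {q : Euc 2} (hq : q ∈ tint b) (ξ : Euc 2) (i : Fin 3) :
    bl b i (Ph b q ξ) = wt b q ξ i / (wt b q ξ 0 + wt b q ξ 1 + wt b q ξ 2) := by
  have h0 := wt_pos b hq ξ 0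
  have h1 := wt_pos b hq ξ 1
  have h2 := wt_pos b hq ξ 2
  exact bl_comb b (fun i => wt b q ξ i / (wt b q ξ 0 + wt b q ξ 1 + wt b q ξ 2)) (by field_simp) i

lemma Ph_tint {q : Euc 2} (hq : q ∈ tint b) (ξ : Euc 2) : Ph b q ξ ∈ tint b := by
  intro i
  rw [Ph_bl b hq]
  have h0 := wt_pos b hq ξ 0
  have h1 := wt_pos b hq ξ 1
  have h2 := wt_pos b hq ξ 2
  have h3 := wt_pos b hq ξ i
  positivity

lemma Xi_Ph {q : Euc 2} (hq : q ∈ tint b) (ξ : Euc 2) : Xi b q (Ph b q ξ) = ξ := by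
  have h0 := wt_pos b hq ξ 0
  have h1 := wt_pos b hq ξ 1
  have h2 := wt_pos b hq ξ 2
  have hs : wt b q ξ 0 + wt b q ξ 1 + wt b q ξ 2 ≠ 0 := by positivity
  have hl : ∀ i, Real.log (bl b i (Ph b q ξ)) = Real.log (wt b q ξ i) - Real.log (wt b q ξ 0 + wt b q ξ 1 + wt b q ξ 2) := by
    intro i
    rw [Ph_bl b hq, Real.log_div (wt_pos b hq ξ i).ne' hs]
  have w0 : Real.log (wt b q ξ 0) = Real.log (bl b 0 q) + ξ 0 := by
    simp only [wt, Matrix.cons_val_zero]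
    rw [Real.log_mul (hq 0).ne' (Real.exp_pos _).ne', Real.log_exp]
  have w1 : Real.log (wt b q ξ 1) = Real.log (bl b 1 q) + ξ 1 := by
    show Real.log (bl b 1 q * Real.exp (ξ 1)) = _
    rw [Real.log_mul (hq 1).ne' (Real.exp_pos _).ne', Real.log_exp]
  have w2 : Real.log (wt b q ξ 2) = Real.log (bl b 2 q) := by
    simp [wt]
  ext i
  unfold Xi
  rw [hl, hl, hl, w0, w1, w2]
  fin_cases i <;> simp <;> ring

lemma Xi_inj {q : Euc 2} : InjOn (Xi b q) (tint b) := by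
  intro w hw w' hw' e
  have e0 := congrArg (fun x : Euc 2 => x 0) e
  have e1 := congrArg (fun x : Euc 2 => x 1) e
  simp [Xi] at e0 e1
  set t := bl b 2 w / bl b 2 w' with ht
  have ht0 : 0 < t := div_pos (hw 2) (hw' 2)
  have a2 : bl b 2 w = t * bl b 2 w' := by rw [ht]; have := hw' 2; field_simp
  have hlt : Real.log t = Real.log (bl b 2 w) - Real.log (bl b 2 w') := Real.log_div (hw 2).ne' (hw' 2).ne'
  have key : ∀ i, Real.log (bl b i w) = Real.log t + Real.log (bl b i w') → bl b i w = t * bl b i w' := by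
    intro i hi
    rw [← Real.log_mul ht0.ne' (hw' i).ne'] at hi
    exact Real.log_injOn_pos (hw i) (mul_pos ht0 (hw' i)) hi
  have a0 := key 0 (by linarith)
  have a1 := key 1 (by linarith)
  have s := bl_sum b w
  have s' := bl_sum b w'
  have : t = 1 := by
    rw [a0, a1, a2] at s
    nlinarith
  rw [this, one_mul] at a0 a1 a2
  rw [bl_self b w, bl_self b w', a0, a1, a2]

lemma Ph_Xi {q w : Euc 2} (hq : q ∈ tint b) (hw : w ∈ tint b) : Ph b q (Xi b q w) = w :=
  Xi_inj b (Ph_tint b hq _) hw (Xi_Ph b hq _)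

lemma Ph_cont {q : Euc 2} (hq : q ∈ tint b) : Continuous (Ph b q) := by
  have hw : ∀ i, Continuous (fun ξ => wt b q ξ i) := by
    intro i
    fin_cases i <;> simp [wt] <;> fun_prop
  have hs : ∀ ξ, wt b q ξ 0 + wt b q ξ 1 + wt b q ξ 2 ≠ 0 := by
    intro ξ
    have h0 := wt_pos b hq ξ 0
    have h1 := wt_pos b hq ξ 1
    have h2 := wt_pos b hq ξ 2
    positivity
  have hd : ∀ i, Continuous (fun ξ => wt b q ξ i / (wt b q ξ 0 + wt b q ξ 1 + wt b q ξ 2)) := fun i =>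
    (hw i).div (((hw 0).add (hw 1)).add (hw 2)) hs
  unfold Ph
  have := hd 0
  have := hd 1
  have := hd 2
  fun_prop

lemma Ph_image {q : Euc 2} (hq : q ∈ tint b) (S : Set (Euc 2)) : Xi b q '' (Ph b q '' S) = S := by
  rw [image_image]; simp [Xi_Ph b hq]

lemma Ph_image' {q : Euc 2} (hq : q ∈ tint b) (S : Set (Euc 2)) : Ph b q '' S = tint b ∩ Xi b q ⁻¹' S := by
  ext w
  constructor
  · rintro ⟨ξ, hξ, rfl⟩
    exact ⟨Ph_tint b hq _, by simpa [Xi_Ph b hq] using hξ⟩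
  · rintro ⟨h1, h2⟩
    exact ⟨_, h2, Ph_Xi b hq h1⟩

lemma vol_Ph {q : Euc 2} (hq : q ∈ tint b) {S : Set (Euc 2)} (hS : MeasurableSet (Ph b q '' S)) :
    ∫⁻ x in Ph b q '' S, ENNReal.ofReal |(dXi b x).det| = volume S := by
  have hsub : Ph b q '' S ⊆ tint b := by rw [Ph_image' b hq]; exact inter_subset_left
  rw [lintegral_abs_det_fderiv_eq_addHaar_image volume hS
    (fun x hx => (Xi_deriv b q (hsub hx)).hasFDerivWithinAt) ((Xi_inj b).mono hsub), Ph_image b hq]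

end tri2
end HG

namespace HG

section tri3
variable {D : Set (Euc 2)} (b : AffineBasis (Fin 3) ℝ (Euc 2))

/-- a fixed bump -/
noncomputable def bmp : ContDiffBump (0 : Euc 2) := ⟨1, 2, by norm_num, by norm_num⟩

lemma bmp_bound : ∃ K > 0, ∀ x, ‖fderiv ℝ (bmp : Euc 2 → ℝ) x‖ ≤ K := by
  have h1 : Continuous (fderiv ℝ (bmp : Euc 2 → ℝ)) := (bmp.contDiff (n := 1)).continuous_fderiv one_ne_zero
  have h2 : HasCompactSupport (fderiv ℝ (bmp : Euc 2 → ℝ)) := bmp.hasCompactSupport.fderiv (𝕜 := ℝ)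
  obtain ⟨K, hK⟩ := h2.exists_bound_of_continuous h1
  exact ⟨max K 1, by positivity, fun x => (hK x).trans (le_max_left _ _)⟩

open Classical in
/-- the test function -/
noncomputable def tf (q : Euc 2) (R : ℝ) (w : Euc 2) : ℝ := if w ∈ tint b then bmp (R⁻¹ • Xi b q w) else 0

lemma tf_zero {q : Euc 2} (hq : q ∈ tint b) {R : ℝ} (hR : 0 < R) {w : Euc 2}
    (hw : w ∉ Ph b q '' Metric.closedBall 0 (2 * R)) : tf b q R w = 0 := by
  unfold tf
  split_ifs with h
  · apply bmp.zero_of_le_dist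
    rw [dist_zero_right, norm_smul, norm_inv, Real.norm_of_nonneg hR.le]
    show (2 : ℝ) ≤ _
    rw [Ph_image' b hq] at hw
    have : 2 * R < ‖Xi b q w‖ := by
      by_contra hcon
      push Not at hcon
      exact hw ⟨h, by simpa using hcon⟩
    rw [← div_eq_inv_mul, le_div_iff₀ hR]; exact this.le
  · rfl

lemma K0_compact {q : Euc 2} (hq : q ∈ tint b) (R : ℝ) : IsCompact (Ph b q '' Metric.closedBall 0 (2 * R)) :=
  (isCompact_closedBall _ _).image (Ph_cont b hq)

lemma tf_eventually {q w : Euc 2} (R : ℝ) (hw : w ∈ tint b) : tf b q R =ᶠ[nhds w] fun w => bmp (R⁻¹ • Xi b q w) := by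
  filter_upwards [(tint_open b).mem_nhds hw] with z hz
  simp [tf, hz]

lemma tf_contDiff {q : Euc 2} (hq : q ∈ tint b) {R : ℝ} (hR : 0 < R) : ContDiff ℝ 1 (tf b q R) := by
  rw [contDiff_iff_contDiffAt]
  intro w
  by_cases hw : w ∈ tint b
  · refine ContDiffAt.congr_of_eventuallyEq ?_ (tf_eventually b R hw)
    have h1 : ContDiffAt ℝ 1 (Xi b q) w := (Xi_contDiff b q).contDiffAt ((tint_open b).mem_nhds hw)
    have h2 : ContDiff ℝ 1 (bmp : Euc 2 → ℝ) := bmp.contDiff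
    exact h2.contDiffAt.comp w (h1.const_smul R⁻¹)
  · have hw' : w ∉ Ph b q '' Metric.closedBall 0 (2 * R) := by
      rw [Ph_image' b hq]; exact fun h => hw h.1
    have : tf b q R =ᶠ[nhds w] fun _ => 0 := by
      filter_upwards [(K0_compact b hq R).isClosed.isOpen_compl.mem_nhds hw'] with z hz
      exact tf_zero b hq hR hz
    exact contDiffAt_const.congr_of_eventuallyEq this

lemma tf_compact {q : Euc 2} (hq : q ∈ tint b) {R : ℝ} (hR : 0 < R) : HasCompactSupport (tf b q R) :=
  HasCompactSupport.intro (K0_compact b hq R) fun _ hx => tf_zero b hq hR hx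

lemma tf_one {q : Euc 2} {R : ℝ} (hR : 0 < R) {w : Euc 2} (hw : w ∈ tint b) (hw2 : ‖Xi b q w‖ ≤ R) :
    tf b q R w = 1 := by
  unfold tf
  rw [if_pos hw]
  apply bmp.one_of_mem_closedBall
  rw [mem_closedBall_zero_iff, norm_smul, norm_inv, Real.norm_of_nonneg hR.le]
  show _ ≤ (1 : ℝ)
  rw [inv_mul_le_iff₀ hR]; simpa using hw2

lemma tf_mem (h : OBC D) (hb : ∀ i, b i ∈ D) {q : Euc 2} (hq : q ∈ tint b) {R : ℝ} (hR : 0 < R) :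
    tf b q R ∈ testFuns D := by
  refine ⟨?_, ?_, tf_compact b hq hR, ?_⟩
  · exact (tf_contDiff b hq hR).lipschitzWith_of_hasCompactSupport (tf_compact b hq hR) one_ne_zero
  · intro h0
    have h00 : Xi b q q = 0 := by ext i; fin_cases i <;> simp [Xi]
    have h1 := tf_one b hR hq (q := q) (by rw [h00, norm_zero]; exact hR.le)
    rw [h0] at h1
    simp at h1
  · have : tsupport (tf b q R) ⊆ Ph b q '' Metric.closedBall 0 (2 * R) := by
      apply closure_minimal _ (K0_compact b hq R).isClosed
      intro x hx
      by_contra hcon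
      exact hx (tf_zero b hq hR hcon)
    refine this.trans ?_
    rw [Ph_image' b hq]
    exact fun w hw => tint_sub b h hb fun i => (hw.1 i).le

lemma tf_dual (h : OBC D) (hb : ∀ i, b i ∈ D) {q : Euc 2} (hq : q ∈ tint b) {R K : ℝ} (hR : 0 < R) (hK : 0 < K)
    (hbmp : ∀ x, ‖fderiv ℝ (bmp : Euc 2 → ℝ) x‖ ≤ K)
    (hball : ∀ z ∈ D, hDist D q z < 2 * R + 1 → z ∈ tint b) {w : Euc 2} (hwD : w ∈ D) :
    dualNorm D w (fderiv ℝ (tf b q R) w) ≤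
      (Ph b q '' Metric.closedBall 0 (2 * R)).indicator (fun _ => 8 * K / R) w := by
  have hqD : q ∈ D := tint_sub b h hb fun i => (hq i).le
  by_cases hw : w ∈ Ph b q '' Metric.closedBall 0 (2 * R)
  · rw [indicator_of_mem hw]
    rw [Ph_image' b hq] at hw
    apply dual_ub h hwD _ (by positivity)
    intro u
    rw [(tf_eventually b R hw.1).fderiv_eq]
    have h1 : HasFDerivAt (fun w => R⁻¹ • Xi b q w) (R⁻¹ • dXi b w) w := (Xi_deriv b q hw.1).const_smul R⁻¹
    have h2 : HasFDerivAt (bmp : Euc 2 → ℝ) (fderiv ℝ (bmp : Euc 2 → ℝ) (R⁻¹ • Xi b q w)) (R⁻¹ • Xi b q w) :=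
      ((bmp.contDiff (n := 1)).differentiable one_ne_zero _).hasFDerivAt
    have h3 := (h2.comp w h1).fderiv
    have h3' : fderiv ℝ (fun w => bmp (R⁻¹ • Xi b q w)) w = (fderiv ℝ (bmp : Euc 2 → ℝ) (R⁻¹ • Xi b q w)).comp (R⁻¹ • dXi b w) := h3
    rw [h3', ContinuousLinearMap.comp_apply]
    have hn : ‖Xi b q w‖ ≤ 2 * R := by simpa using hw.2
    have hd := dist_le_Xi b h hb hq hw.1
    have h4 := dXi_le_fN b h hw.1 hwD (fun z hz hlt => hball z hz (by
      have := hDist_tri h hqD hwD hz; linarith)) u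
    calc _ ≤ ‖fderiv ℝ (bmp : Euc 2 → ℝ) (R⁻¹ • Xi b q w) ((R⁻¹ • dXi b w) u)‖ := le_abs_self _
      _ ≤ K * ‖(R⁻¹ • dXi b w) u‖ := (ContinuousLinearMap.le_opNorm _ _).trans (by gcongr; exact hbmp _)
      _ = K * (R⁻¹ * ‖dXi b w u‖) := by
        rw [ContinuousLinearMap.smul_apply, norm_smul, norm_inv, Real.norm_of_nonneg hR.le]
      _ ≤ K * (R⁻¹ * (8 * fNorm D w u)) := by gcongr
      _ = _ := by field_simp
  · rw [indicator_of_notMem hw]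
    have : tf b q R =ᶠ[nhds w] fun _ => 0 := by
      filter_upwards [(K0_compact b hq R).isClosed.isOpen_compl.mem_nhds hw] with z hz
      exact tf_zero b hq hR hz
    rw [this.fderiv_eq]
    apply dual_ub h hwD _ le_rfl
    intro u
    simp

lemma fat_ray : ∃ A > 0, ∀ (D : Set (Euc 2)) (b : AffineBasis (Fin 3) ℝ (Euc 2)) (q : Euc 2) (R : ℝ),
    OBC D → (∀ i, b i ∈ D) → q ∈ tint b → 0 < R → (∀ z ∈ D, hDist D q z < 2 * R + 1 → z ∈ tint b) →
    lambda1 D ≤ A / R ^ 2 := by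
  obtain ⟨K, hK, hbmp⟩ := bmp_bound
  refine ⟨16384 * K ^ 2, by positivity, ?_⟩
  intro D b q R h hb hq hR hball
  refine (lambda1_le h (tf_mem b h hb hq hR)).trans ?_
  have hqD : q ∈ D := tint_sub b h hb fun i => (hq i).le
  unfold rayleigh
  rw [hM_restrict h]
  set μ := hMeasure D
  set K0 := Ph b q '' Metric.closedBall 0 (2 * R) with hK0
  set B := Ph b q '' Metric.ball 0 R with hB
  have ho := omega_pos (n := 2)
  have hK0m : MeasurableSet K0 := (K0_compact b hq R).isClosed.measurableSet
  have hBm : MeasurableSet B := by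
    rw [hB, Ph_image' b hq]
    exact ((Xi_contDiff b q).continuousOn.isOpen_inter_preimage (tint_open b) Metric.isOpen_ball).measurableSet
  have hsubT : ∀ S, Ph b q '' S ⊆ tint b := fun S => by rw [Ph_image' b hq]; exact inter_subset_left
  have hTD : tint b ⊆ D := fun w hw => tint_sub b h hb fun i => (hw i).le
  have hBK : B ⊆ K0 := image_mono (Metric.ball_subset_closedBall.trans (Metric.closedBall_subset_closedBall (by linarith)))
  have m1 : μ K0 ≤ ENNReal.ofReal (4 * R ^ 2 * omegaVol 2) := by
    have : volume (Metric.closedBall (0 : Euc 2) (2 * R)) = ENNReal.ofReal (4 * R ^ 2 * omegaVol 2) := by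
      rw [Measure.addHaar_closedBall_eq_addHaar_ball, vol_ball_real (by positivity)]
      congr 1; ring
    rw [← this, ← vol_Ph b hq hK0m, hM_apply h hK0m ((hsubT _).trans hTD)]
    apply setLIntegral_mono' hK0m
    intro x hx
    exact ENNReal.ofReal_le_ofReal (dens_le_det b h hb (hsubT _ hx))
  have m2 : ENNReal.ofReal (R ^ 2 * omegaVol 2 / 64) ≤ μ B := by
    have : ENNReal.ofReal (R ^ 2 * omegaVol 2 / 64) = ENNReal.ofReal (1 / 64) * volume (Metric.ball (0 : Euc 2) R) := by
      rw [vol_ball_real hR.le, ← ENNReal.ofReal_mul (by positivity)]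
      congr 1; ring
    rw [this, ← vol_Ph b hq hBm, hM_apply h hBm ((hsubT _).trans hTD), ← lintegral_const_mul' _ _ ENNReal.ofReal_ne_top]
    apply setLIntegral_mono' hBm
    intro x hx
    rw [← ENNReal.ofReal_mul (by positivity)]
    apply ENNReal.ofReal_le_ofReal
    have hxx : x ∈ K0 := hBK hx
    rw [hK0, Ph_image' b hq] at hxx
    have hn : ‖Xi b q x‖ ≤ 2 * R := by simpa using hxx.2
    have hd := dist_le_Xi b h hb hq hxx.1
    have := det_le_dens b h hb hxx.1 (fun z hz hlt => hball z hz (by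
      have := hDist_tri h hqD (hTD hxx.1) hz; linarith))
    linarith
  have hfin : μ K0 < ⊤ := m1.trans_lt ENNReal.ofReal_lt_top
  have hfinB : μ B < ⊤ := (measure_mono hBK).trans_lt hfin
  have hmem : ∀ᵐ w ∂μ, w ∈ D := by
    have := ae_restrict_mem (μ := μ) h.op.measurableSet
    rwa [hM_restrict h] at this
  have num : ∫ p, dualNorm D p (fderiv ℝ (tf b q R) p) ^ 2 ∂μ ≤ (8 * K / R) ^ 2 * (4 * R ^ 2 * omegaVol 2) := by
    calc _ ≤ ∫ p, K0.indicator (fun _ => (8 * K / R) ^ 2) p ∂μ := by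
          apply integral_mono_of_nonneg
          · exact Eventually.of_forall fun _ => sq_nonneg _
          · exact (integrable_indicator_iff hK0m).2 (integrableOn_const hfin.ne)
          · filter_upwards [hmem] with w hw
            have h1 := tf_dual b h hb hq hR hK hbmp hball hw
            have h2 := dual_nonneg h hw (fderiv ℝ (tf b q R) w)
            by_cases hwK : w ∈ K0
            · rw [indicator_of_mem hwK] at h1 ⊢
              gcongr
            · rw [indicator_of_notMem hwK] at h1 ⊢
              have : dualNorm D w (fderiv ℝ (tf b q R) w) = 0 := le_antisymm h1 h2
              simp [this]
      _ = (μ K0).toReal * (8 * K / R) ^ 2 := by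
          rw [integral_indicator hK0m, setIntegral_const]; rfl
      _ ≤ (4 * R ^ 2 * omegaVol 2) * (8 * K / R) ^ 2 := by
          gcongr
          exact ENNReal.toReal_le_of_le_ofReal (by positivity) m1
      _ = _ := by ring
  have den : R ^ 2 * omegaVol 2 / 64 ≤ ∫ p, tf b q R p ^ 2 ∂μ := by
    have hmeas : Continuous (tf b q R) := (tf_contDiff b hq hR).continuous
    calc _ ≤ (μ B).toReal := (ENNReal.ofReal_le_iff_le_toReal hfinB.ne).1 m2
      _ = ∫ p, B.indicator (fun _ => (1 : ℝ)) p ∂μ := by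
          rw [integral_indicator hBm, setIntegral_const]; simp [Measure.real]
      _ ≤ _ := by
          apply integral_mono
          · exact (integrable_indicator_iff hBm).2 (integrableOn_const hfinB.ne)
          · refine Integrable.mono' (g := K0.indicator (fun _ => (1 : ℝ))) ((integrable_indicator_iff hK0m).2 (integrableOn_const hfin.ne))
              (hmeas.pow 2).aestronglyMeasurable (Eventually.of_forall fun w => ?_)
            by_cases hwK : w ∈ K0
            · rw [indicator_of_mem hwK]
              have h0 : 0 ≤ tf b q R w := by
                unfold tf; split_ifs
                · exact bmp.nonneg
                · exact le_rfl
              have h1 : tf b q R w ≤ 1 := by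
                unfold tf; split_ifs
                · exact bmp.le_one
                · exact zero_le_one
              rw [Real.norm_of_nonneg (sq_nonneg _)]
              nlinarith
            · rw [tf_zero b hq hR hwK]
              simp [indicator_of_notMem hwK]
          · intro w
            by_cases hw : w ∈ B
            · rw [indicator_of_mem hw]
              have hw' := hw
              rw [hB, Ph_image' b hq] at hw'
              have : ‖Xi b q w‖ < R := by simpa using hw'.2
              simp [tf_one b hR hw'.1 this.le]
            · rw [indicator_of_notMem hw]
              exact sq_nonneg _
  have hpos : 0 < R ^ 2 * omegaVol 2 / 64 := by positivity
  rw [div_le_iff₀ (hpos.trans_le den)]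
  refine num.trans ?_
  have : (8 * K / R) ^ 2 * (4 * R ^ 2 * omegaVol 2) = 16384 * K ^ 2 / R ^ 2 * (R ^ 2 * omegaVol 2 / 64) := by
    field_simp; ring
  rw [this]
  gcongr

end tri3
end HG

namespace HG

lemma exists_plane {n : ℕ} {x y z : Euc n} (hai : AffineIndependent ℝ ![x, y, z]) :
    ∃ (φ : Euc 2 →ᵃⁱ[ℝ] Euc n) (v : Fin 3 → Euc 2), ∀ i, φ (v i) = ![x, y, z] i := by
  have hli := (affineIndependent_iff_linearIndependent_vsub ℝ _ (0 : Fin 3)).1 hai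
  set S : Submodule ℝ (Euc n) := vectorSpan ℝ (Set.range ![x, y, z]) with hS
  have hfr : Module.finrank ℝ S = 2 := hai.finrank_vectorSpan (by simp)
  let e := ((stdOrthonormalBasis ℝ S).reindex (finCongr hfr)).repr
  let L : Euc 2 →ₗᵢ[ℝ] Euc n := S.subtypeₗᵢ.comp e.symm.toLinearIsometry
  let φ : Euc 2 →ᵃⁱ[ℝ] Euc n :=
    (AffineIsometryEquiv.constVAdd ℝ (Euc n) x).toAffineIsometry.comp L.toAffineIsometry
  have hm : ∀ i, ![x, y, z] i - x ∈ S := fun i =>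
    vsub_mem_vectorSpan ℝ (mem_range_self i) (mem_range_self (0 : Fin 3))
  refine ⟨φ, fun i => e ⟨_, hm i⟩, fun i => ?_⟩
  show x + ((e.symm (e ⟨_, hm i⟩) : S) : Euc n) = _
  rw [LinearIsometryEquiv.symm_apply_apply]
  simp

lemma seg_of_zero (a b w : Euc 2) (s t : ℝ) (hs : 0 ≤ s) (ht : 0 ≤ t) (hst : s + t = 1)
    (hw : w = s • a + t • b) : w ∈ segment ℝ a b := ⟨s, t, hs, ht, hst, hw.symm⟩

lemma side_of_zero (b : AffineBasis (Fin 3) ℝ (Euc 2)) {w : Euc 2} (h0 : ∀ i, 0 ≤ bl b i w) (h1 : ∃ i, bl b i w = 0) :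
    w ∈ segment ℝ (b 0) (b 1) ∨ w ∈ segment ℝ (b 0) (b 2) ∨ w ∈ segment ℝ (b 1) (b 2) := by
  have hs := bl_sum b w
  have he := bl_self b w
  obtain ⟨i, hi⟩ := h1
  fin_cases i
  · simp only [Fin.zero_eta] at hi
    rw [hi] at he hs
    right; right; exact seg_of_zero _ _ _ _ _ (h0 1) (h0 2) (by linarith) (by rw [zero_smul, zero_add] at he; exact he)
  · simp only [Fin.mk_one] at hi
    rw [hi] at he hs
    right; left; exact seg_of_zero _ _ _ _ _ (h0 0) (h0 2) (by linarith) (by rw [zero_smul, add_zero] at he; exact he)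
  · simp only [Fin.reduceFinMk] at hi
    rw [hi] at he hs
    left; exact seg_of_zero _ _ _ _ _ (h0 0) (h0 1) (by linarith) (by rw [zero_smul, add_zero] at he; exact he)

lemma exists_fat_tri {D : Set (Euc 2)} (h : OBC D) (b : AffineBasis (Fin 3) ℝ (Euc 2)) (hb : ∀ i, b i ∈ D) {ρ : ℝ}
    (hρ : 0 < ρ) {q : Euc 2} (hq : q ∈ convexHull ℝ {b 0, b 1, b 2})
    (hd : ∀ w, (w ∈ segment ℝ (b 0) (b 1) ∨ w ∈ segment ℝ (b 0) (b 2) ∨ w ∈ segment ℝ (b 1) (b 2)) →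
      ρ ≤ hDist D w q) : q ∈ tint b ∧ ∀ z ∈ D, hDist D q z < ρ → z ∈ tint b := by
  have hcv : Convex ℝ {w | ∀ i, 0 ≤ bl b i w} := by
    intro u hu v hv s t hs ht hst i
    have : bl b i (s • u + t • v) = s * bl b i u + t * bl b i v := by
      rw [bl_self b u, bl_self b v]
      have h3 := bl_comb b (fun i => s * bl b i u + t * bl b i v) (by
        linear_combination s * bl_sum b u + t * bl_sum b v + hst) i
      rw [← bl_self b u, ← bl_self b v, ← h3]
      congr 1
      conv_lhs => rw [bl_self b u, bl_self b v]
      module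
    rw [this]
    have := hu i; have := hv i; positivity
  have hv : ∀ i j, 0 ≤ bl b i (b j) := by
    intro i j
    unfold bl; rw [b.coord_apply]; split_ifs <;> norm_num
  have hq0 : ∀ i, 0 ≤ bl b i q := by
    have : convexHull ℝ {b 0, b 1, b 2} ⊆ {w | ∀ i, 0 ≤ bl b i w} := by
      apply convexHull_min _ hcv
      rintro w (rfl | rfl | rfl) <;> exact fun i => hv i _
    exact this hq
  have hqD : q ∈ D := tint_sub b h hb hq0
  have key : ∀ w, w ∈ D → hDist D q w < ρ → (∀ i, 0 ≤ bl b i w) → w ∈ tint b := by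
    intro w hw hdw h0 
    intro i
    refine lt_of_le_of_ne (h0 i) fun hi => ?_
    have := hd w (side_of_zero b h0 ⟨i, hi.symm⟩)
    rw [hDist_comm h hw hqD] at this
    linarith
  have hqt : q ∈ tint b := key q hqD (by rw [hDist_self]; exact hρ) hq0
  refine ⟨hqt, fun z hz hdz => ?_⟩
  by_contra hzt
  obtain ⟨w, hw1, hw2⟩ : ∃ w ∈ segment ℝ q z, w ∈ frontier (tint b) := by
    by_contra hno
    push Not at hno
    rw [(tint_open b).frontier_eq] at hno
    obtain ⟨w, -, hw1, hw2⟩ := (convex_segment (𝕜 := ℝ) q z).isPreconnected (tint b) (closure (tint b))ᶜ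
      (tint_open b) isClosed_closure.isOpen_compl (by
        intro w hw
        by_cases hw2 : w ∈ closure (tint b)
        · left; by_contra hw3; exact hno w hw ⟨hw2, hw3⟩
        · right; exact hw2)
      ⟨q, left_mem_segment _ _ _, hqt⟩ ⟨z, right_mem_segment _ _ _, fun hzc => hno z (right_mem_segment _ _ _) ⟨hzc, hzt⟩⟩
    exact hw2 (subset_closure hw1)
  have hwD := seg_sub h hqD hz hw1
  have hcl : closure (tint b) ⊆ {w | ∀ i, 0 ≤ bl b i w} := by
    apply closure_minimal (fun w hw i => (hw i).le)
    have : {w | ∀ i, 0 ≤ bl b i w} = ⋂ i, {w | 0 ≤ bl b i w} := by ext; simp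
    rw [this]
    exact isClosed_iInter fun i => isClosed_le continuous_const (bl_cont b i)
  have hs := hDist_seg h hqD hz hw1
  have hn := hDist_nonneg h hwD hz
  have : w ∈ tint b := key w hwD (by linarith) (hcl hw2.1)
  rw [frontier, (tint_open b).interior_eq] at hw2
  exact hw2.2 this

lemma fwd {n : ℕ} {C : Set (Euc n)} (h : OBC C) {lam : ℝ} (hl : 0 < lam)
    (hL : ∀ φ : Euc 2 →ᵃⁱ[ℝ] Euc n, (φ ⁻¹' C).Nonempty → lambda1 (φ ⁻¹' C) ≥ lam) :
    ∃ δ : ℝ, 0 ≤ δ ∧ IsDeltaHyp C δ := by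
  obtain ⟨A, hA, hray⟩ := fat_ray
  set R : ℝ := A / lam + 1 with hR
  have hAl : 0 < A / lam := by positivity
  have hR0 : 0 < R := by positivity
  have hAR : A / R ^ 2 < lam := by
    rw [div_lt_iff₀ (by positivity)]
    have : A = lam * (A / lam) := by field_simp
    rw [this]
    apply mul_lt_mul_of_pos_left _ hl
    nlinarith
  set ρ := 2 * R + 1 with hρ
  have hc0 : 0 ≤ 4 * ρ + 1 := by positivity
  refine ⟨_, ?_, thin_hyp h (c := 4 * ρ + 1) hc0 ?_⟩
  · positivity
  intro x hx y hy z hz p hp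
  by_contra hcon
  push Not at hcon
  have hpC := seg_sub h hx hy hp
  by_cases hai : AffineIndependent ℝ ![x, y, z]
  · obtain ⟨φ, v, hv⟩ := exists_plane hai
    have hD := sec_obc h φ
    have hvi : AffineIndependent ℝ v := by
      apply AffineIndependent.of_comp φ.toAffineMap
      have : ⇑φ.toAffineMap ∘ v = ![x, y, z] := funext hv
      rw [this]; exact hai
    have htop : affineSpan ℝ (Set.range v) = ⊤ := by
      rw [hvi.affineSpan_eq_top_iff_card_eq_finrank_add_one]; simp
    let b : AffineBasis (Fin 3) ℝ (Euc 2) := ⟨v, hvi, htop⟩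
    have hbv : ∀ i, b i = v i := fun _ => rfl
    have hb0 : φ (b 0) = x := hv 0
    have hb1 : φ (b 1) = y := hv 1
    have hb2 : φ (b 2) = z := hv 2
    have hbD : ∀ i, b i ∈ φ ⁻¹' C := by
      intro i
      show φ (b i) ∈ C
      fin_cases i
      · exact hb0 ▸ hx
      · exact hb1 ▸ hy
      · exact hb2 ▸ hz
    have hseg : ∀ a c : Euc 2, segment ℝ (φ a) (φ c) = φ '' segment ℝ a c := fun a c =>
      (image_segment ℝ φ.toAffineMap a c).symm
    rw [← hb0, ← hb1, hseg] at hp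
    obtain ⟨p', hp', rfl⟩ := hp
    obtain ⟨q, hq, hqd⟩ := fat hD (hbD 0) (hbD 1) (hbD 2) hp' (ρ := ρ) (c := 4 * ρ + 1) (by positivity)
      (by linarith) (by
        intro w hw
        rw [sec_dist]
        apply hcon
        rw [← hb0, ← hb1, ← hb2, hseg, hseg]
        exact hw.imp (mem_image_of_mem _) (mem_image_of_mem _))
    obtain ⟨h1, h2⟩ := exists_fat_tri hD b hbD (by positivity) hq hqd
    have h3 := hray _ b q R hD hbD h1 hR0 h2
    have h4 := hL φ ⟨_, hbD 0⟩
    linarith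
  · rw [← collinear_iff_not_affineIndependent_set] at hai
    have hself := hDist_self (C := C) (p := p)
    have hn : p ∉ segment ℝ x z ∧ p ∉ segment ℝ y z := by
      constructor <;> intro hh
      · have := hcon p (Or.inl hh); linarith
      · have := hcon p (Or.inr hh); linarith
    rcases hai.wbtw_or_wbtw_or_wbtw with hw | hw | hw
    · exact hn.1 ((convex_segment (𝕜 := ℝ) x z).segment_subset (left_mem_segment _ _ _) hw.mem_segment hp)
    · have : p ∈ segment ℝ x z ∪ segment ℝ y z := by
        have hz'' : Wbtw ℝ x z y := hw.symm
        obtain ⟨t, ⟨ht0, ht1⟩, rfl⟩ := hz''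
        rw [segment_eq_image_lineMap] at hp
        obtain ⟨s, ⟨hs0, hs1⟩, rfl⟩ := hp
        rcases le_total s t with hst | hst
        · left
          rcases ht0.eq_or_lt with rfl | ht
          · have : s = 0 := le_antisymm hst hs0
            subst this; simp
          refine ⟨1 - s / t, s / t, by rw [sub_nonneg, div_le_one ht]; exact hst, by positivity, by ring, ?_⟩
          simp only [AffineMap.lineMap_apply, vsub_eq_sub, vadd_eq_add]
          match_scalars <;> field_simp <;> ring
        · right
          rcases ht1.eq_or_lt with rfl | ht
          · have : s = 1 := le_antisymm hs1 hst
            subst this; simp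
          have : 0 < 1 - t := by linarith
          refine ⟨1 - (1 - s) / (1 - t), (1 - s) / (1 - t), by rw [sub_nonneg, div_le_one this]; linarith,
            div_nonneg (by linarith) this.le, by ring, ?_⟩
          simp only [AffineMap.lineMap_apply, vsub_eq_sub, vadd_eq_add]
          match_scalars <;> field_simp <;> ring
      rcases this with hh | hh
      · exact hn.1 hh
      · exact hn.2 hh
    · rw [segment_symm ℝ x y] at hp
      exact hn.2 ((convex_segment (𝕜 := ℝ) y z).segment_subset (left_mem_segment _ _ _)
        (by rw [segment_symm]; exact hw.mem_segment) hp)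

end HG

namespace HG

/-- signed double area -/
def dt (a b c : Euc 2) : ℝ := (b 0 - a 0) * (c 1 - a 1) - (b 1 - a 1) * (c 0 - a 0)

lemma dt_cont : Continuous fun t : Euc 2 × Euc 2 × Euc 2 => dt t.1 t.2.1 t.2.2 := by
  unfold dt; fun_prop

lemma center {D : Set (Euc 2)} (h : OBC D) (hne : D.Nonempty) :
    ∃ o ∈ D, ∀ v, jg D o (-v) ≤ 2 * jg D o v := by
  have hK : IsCompact (closure D) := h.bd.isCompact_closure
  have hcv : Convex ℝ (closure D) := h.cv.closure
  obtain ⟨p, hp⟩ := hne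
  have hpc := subset_closure hp
  obtain ⟨⟨a, b, c⟩, ⟨ha, hb, hc⟩, hmax⟩ := (hK.prod (hK.prod hK)).exists_isMaxOn ⟨(p, p, p), hpc, hpc, hpc⟩
    dt_cont.continuousOn
  have hM : ∀ x y z, x ∈ closure D → y ∈ closure D → z ∈ closure D → dt x y z ≤ dt a b c :=
    fun x y z hx hy hz => hmax (a := (x, y, z)) ⟨hx, hy, hz⟩
  have hpos : 0 < dt a b c := by
    obtain ⟨r, hr, hball⟩ := Metric.isOpen_iff.1 h.op p hp
    have hm : ∀ i : Fin 2, p + (r / 2) • EuclideanSpace.single i (1 : ℝ) ∈ closure D := by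
      intro i
      apply subset_closure
      apply hball
      rw [Metric.mem_ball, dist_eq_norm, add_sub_cancel_left, norm_smul]
      simp only [Real.norm_eq_abs, PiLp.norm_single]
      rw [abs_of_pos (by positivity)]; norm_num; linarith
    refine lt_of_lt_of_le ?_ (hM p _ _ hpc (hm 0) (hm 1))
    simp [dt]; positivity
  set o : Euc 2 := (1 / 3 : ℝ) • a + (1 / 3 : ℝ) • b + (1 / 3 : ℝ) • c with ho
  have key : ∀ z ∈ closure D, o - (1 / 2 : ℝ) • (z - o) ∈ closure D := by
    intro z hz
    have h1 := hM z b c hz hb hc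
    have h2 := hM a z c ha hz hc
    have h3 := hM a b z ha hb hz
    have hsum : dt z b c + dt a z c + dt a b z = dt a b c := by unfold dt; ring
    have hz' : dt a b c • z = dt z b c • a + dt a z c • b + dt a b z • c := by
      ext i; fin_cases i <;> simp [dt] <;> ring
    set Δ := dt a b c
    have hz2 : z = (dt z b c / Δ) • a + (dt a z c / Δ) • b + (dt a b z / Δ) • c := by
      have : z = Δ⁻¹ • (Δ • z) := by rw [smul_smul, inv_mul_cancel₀ hpos.ne', one_smul]
      rw [hz'] at this
      refine this.trans ?_
      module
    have hd1 : dt z b c / Δ ≤ 1 := (div_le_one hpos).2 h1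
    have hd2 : dt a z c / Δ ≤ 1 := (div_le_one hpos).2 h2
    have hd3 : dt a b z / Δ ≤ 1 := (div_le_one hpos).2 h3
    have hs : dt z b c / Δ + dt a z c / Δ + dt a b z / Δ = 1 := by
      rw [← add_div, ← add_div, hsum, div_self hpos.ne']
    generalize dt z b c / Δ = s1 at *
    generalize dt a z c / Δ = s2 at *
    generalize dt a b z / Δ = s3 at *
    have h4 := hcv.sum_mem (t := Finset.univ) (w := ![1 / 2 - s1 / 2, 1 / 2 - s2 / 2, 1 / 2 - s3 / 2]) (z := ![a, b, c])
      (by intro i _; fin_cases i <;> simp <;> linarith) (by simp [Fin.sum_univ_three]; linarith)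
      (by intro i _; fin_cases i <;> simp [ha, hb, hc])
    convert h4 using 1
    simp only [Fin.sum_univ_three]
    simp only [Matrix.cons_val_zero, Matrix.cons_val_one, Matrix.cons_val]
    have hz3 := congrArg (fun w => o - (1 / 2 : ℝ) • (w - o)) hz2
    refine hz3.trans ?_
    rw [ho]; module
  have hoD : o ∈ D := by
    have h1 := key p hpc
    have h2 := h.cv.combo_closure_interior_mem_interior h1 (by rw [h.op.interior_eq]; exact hp)
      (a := 2 / 3) (b := 1 / 3) (by norm_num) (by norm_num) (by norm_num)
    rw [h.op.interior_eq] at h2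
    convert h2 using 1; module
  refine ⟨o, hoD, fun v => ?_⟩
  have h1 : ∀ v, jg D o v < 1 → jg D o (-v) ≤ 2 := by
    intro v hv
    rw [jg_lt_one h hoD] at hv
    have h2 := key _ (subset_closure hv)
    have h3 : o - (1 / 2 : ℝ) • (o + v - o) = o + (1 / 2 : ℝ) • (-v) := by module
    rw [h3] at h2
    have h2 := jg_le_one h hoD h2
    rw [jg_smul (by norm_num)] at h2
    linarith
  apply le_of_forall_pos_le_add
  intro ε hε
  have hv0 := jg_nonneg (C := D) (p := o) (v := v)
  set s := jg D o v + ε / 2 with hs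
  have hsp : 0 < s := by positivity
  have h2 := h1 (s⁻¹ • v) (by
    rw [jg_smul (by positivity), inv_mul_lt_iff₀ hsp]; linarith)
  rw [← smul_neg, jg_smul (by positivity), inv_mul_le_iff₀ hsp] at h2
  linarith

end HG

namespace HG

section contr
variable {n : ℕ} {D : Set (Euc n)} {o v : Euc n}

lemma supp_pt (h : OBC D) {Q : Euc n} (hQ : Q ∉ D) : ∃ l : Euc n →L[ℝ] ℝ, ∀ z ∈ D, 0 < l z + (-l Q) := by
  obtain ⟨f, hf⟩ := geometric_hahn_banach_point_open h.cv h.op hQ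
  exact ⟨f, fun z hz => by have := hf z hz; linarith⟩

lemma ray_supp (h : OBC D) (ho : o ∈ D) (v : Euc n) : ∃ (l : Euc n →L[ℝ] ℝ) (c : ℝ),
    (∀ z ∈ D, 0 < l z + c) ∧ l v = -(jg D o v * (l o + c)) := by
  by_cases hv : v = 0
  · exact ⟨0, 1, by simp, by simp [hv]⟩
  have hk := jg_pos h ho hv
  obtain ⟨l, hl⟩ := supp_pt h (Q := o + (jg D o v)⁻¹ • v) (by
    rw [mem_iff h ho (by positivity), inv_mul_cancel₀ hk.ne']; exact lt_irrefl _)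
  refine ⟨l, _, hl, ?_⟩
  simp only [map_add, map_smul, smul_eq_mul]
  field_simp
  ring

lemma ray_mem (h : OBC D) (ho : o ∈ D) {s : ℝ} (hs : 0 ≤ s) (hk : s * jg D o v < 1) : o + s • v ∈ D :=
  (mem_iff h ho hs).2 hk

lemma fk_ray (h : OBC D) (ho : o ∈ D) {s t : ℝ} (hs : 0 ≤ s) (hst : s ≤ t) (hk : t * jg D o v < 1) :
    fk D (o + s • v) (o + t • v) = (1 - t * jg D o v) / (1 - s * jg D o v) := by
  have hk0 := jg_nonneg (C := D) (p := o) (v := v)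
  have hsk : s * jg D o v < 1 := by nlinarith
  have h1 := jg_shift h ho hsk (ray_mem h ho hs hsk) (Or.inr rfl)
  unfold fk
  have : o + t • v - (o + s • v) = (t - s) • v := by module
  rw [this, jg_smul (by linarith), h1]
  have : 1 - s * jg D o v ≠ 0 := by linarith
  field_simp
  ring

lemma fk_back (h : OBC D) (ho : o ∈ D) (hsym : ∀ v, jg D o (-v) ≤ 2 * jg D o v) {s t : ℝ} (hs : 0 ≤ s) (hst : s ≤ t)
    (hk : t * jg D o v < 1) : 1 / 3 ≤ fk D (o + t • v) (o + s • v) := by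
  have hk0 := jg_nonneg (C := D) (p := o) (v := v)
  have hk1 := jg_nonneg (C := D) (p := o) (v := -v)
  have hsk : s * jg D o v < 1 := by nlinarith
  have hx := ray_mem h ho hs hsk
  have hy := ray_mem h ho (hs.trans hst) hk
  have hf := fk_pos h hy hx
  have h1 := one_add_jg h hx hy
  have e1 : o + s • v = o + (-s) • (-v) := by module
  have h2 := jg_shift h ho (v := -v) (t := -s) (by nlinarith) (by rw [← e1]; exact hx) (Or.inr rfl)
  rw [← e1] at h2
  have e2 : o + s • v - (o + t • v) = (t - s) • (-v) := by module
  rw [e2, jg_smul (by linarith), h2] at h1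
  have h3 : jg D o (-v) / (1 - -s * jg D o (-v)) ≤ 2 * jg D o v := by
    refine (div_le_self hk1 (by nlinarith)).trans (hsym v)
  have h4 : 1 / fk D (o + t • v) (o + s • v) ≤ 3 := by
    rw [← h1]
    have := mul_le_mul_of_nonneg_left h3 (sub_nonneg.2 hst)
    nlinarith
  rw [div_le_iff₀ hf] at h4
  linarith

lemma jg_homoth (h : OBC D) (ho : o ∈ D) {y : Euc n} (hy : y ∈ D) {τ : ℝ} (h0 : 0 < τ) (h1 : τ ≤ 1) (u : Euc n) :
    jg D (o + τ • (y - o)) (τ • u) ≤ jg D y u := by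
  have hx : o + τ • (y - o) ∈ D := seg_mem h ho hy h0.le h1
  apply le_of_forall_pos_le_add
  intro ε hε
  have hu := jg_nonneg (C := D) (p := y) (v := u)
  have hs : 0 < jg D y u + ε := by positivity
  have h2 : y + (jg D y u + ε)⁻¹ • u ∈ D := by
    rw [mem_iff h hy (by positivity), inv_mul_lt_iff₀ hs]; linarith
  have h3 := seg_mem h ho h2 h0.le h1
  have e : o + τ • (y + (jg D y u + ε)⁻¹ • u - o) = o + τ • (y - o) + (jg D y u + ε)⁻¹ • (τ • u) := by module
  rw [e, mem_iff h hx (by positivity), inv_mul_lt_iff₀ hs] at h3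
  linarith

/-- four-point form -/
lemma four_pt {δ : ℝ} (hd : IsDeltaHyp D δ) {a b c t : Euc n} (ha : a ∈ D) (hb : b ∈ D) (hc : c ∈ D) (ht : t ∈ D) :
    hDist D a b + hDist D c t ≤ hDist D a c + hDist D b t + 2 * δ ∨
    hDist D a b + hDist D c t ≤ hDist D b c + hDist D a t + 2 * δ := by
  have := hd a ha b hb c hc t ht
  unfold gromovProd at this
  rcases le_total ((hDist D a t + hDist D c t - hDist D a c) / 2) ((hDist D b t + hDist D c t - hDist D b c) / 2) with hh | hh
  · rw [min_eq_left hh] at this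
    left; linarith
  · rw [min_eq_right hh] at this
    right; linarith

set_option maxHeartbeats 1000000 in
lemma contr_core (h : OBC D) (ho : o ∈ D) (hsym : ∀ v, jg D o (-v) ≤ 2 * jg D o v) {δ : ℝ}
    (hd : IsDeltaHyp D δ) (hv : jg D o v = 1) {τ1 τ2 : ℝ} (h1 : 0 < τ1) (h2 : τ2 < 1) {ε M : ℝ} (hε : 0 < ε)
    (hε1 : ε < 1 / 2) (hM2 : 2 ≤ M) (hM : M * (1 - τ2) ≤ 1 - τ1)
    (hεδ : Real.log 6 + 2 * δ < -(1 / 2) * Real.log (2 * ε))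
    (hMδ : Real.log (2 / ε) + 2 * δ < (1 / 2) * Real.log M - Real.log 6 - (1 / 2) * Real.log (2 * ε))
    {u : Euc n} (hu1 : jg D (o + τ2 • v) (-u) = 1) (hu2 : jg D (o + τ2 • v) u ≤ 1) :
    jg D (o + τ1 • v) (-((τ1 / τ2) • u)) * (1 + ε) ≤ 1 := by
  by_contra hcon
  push Not at hcon
  have h22 : 2 * (1 - τ2) ≤ 1 - τ1 := (mul_le_mul_of_nonneg_right hM2 (by linarith)).trans hM
  have h12 : τ1 ≤ τ2 := by linarith
  have hτ2 : 0 < τ2 := by linarith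
  set τ := τ1 / τ2 with hτ
  have hτ0 : 0 < τ := by positivity
  have hτ1 : τ ≤ 1 := (div_le_one hτ2).2 h12
  have hττ : τ * τ2 = τ1 := by rw [hτ]; field_simp
  set x := o + τ1 • v with hx
  set y := o + τ2 • v with hy
  have hxy : x = o + τ • (y - o) := by rw [hx, hy, ← hττ]; module
  have hxD : x ∈ D := ray_mem h ho h1.le (by rw [hv]; linarith)
  have hyD : y ∈ D := ray_mem h ho hτ2.le (by rw [hv]; linarith)
  -- points
  set y1 := y + (1 - ε) • (-u) with hy1
  set x1 := x + (1 - ε) • (-(τ • u)) with hx1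
  clear_value x1 y1 x y τ
  have hxm : jg D x (-(τ • u)) ≤ 1 := by
    have := jg_homoth h ho hyD hτ0 hτ1 (-u)
    rw [← hxy, hu1] at this
    rwa [smul_neg] at this
  have hxm' : jg D x (τ • u) ≤ 1 := by
    have := jg_homoth h ho hyD hτ0 hτ1 u
    rw [← hxy] at this
    linarith
  have hy1D : y1 ∈ D := by rw [hy1, mem_iff h hyD (by linarith), hu1]; linarith
  have hx1D : x1 ∈ D := by
    rw [hx1, mem_iff h hxD (by linarith)]
    have := mul_le_mul_of_nonneg_left hxm (show 0 ≤ 1 - ε by linarith)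
    linarith
  -- closure info
  have hclo : ∀ (w : Euc n) (z : Euc n), z ∈ D → jg D z w ≤ 1 → ∀ (l : Euc n →L[ℝ] ℝ) (c : ℝ), (∀ z ∈ D, 0 < l z + c) →
      0 ≤ l z + c + l w := by
    intro w z hz hw l c hl
    by_contra hneg
    push Not at hneg
    have hlz := hl z hz
    -- slightly shorter
    set s := (l z + c) / (-(l w)) with hs
    have hlw : 0 < -(l w) := by linarith
    have hs1 : s < 1 := by rw [hs, div_lt_one hlw]; linarith
    have hs0 : 0 < s := by positivity
    have hmem : z + s • w ∈ D := by
      rw [mem_iff h hz hs0.le]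
      have := mul_le_mul_of_nonneg_left hw hs0.le
      linarith
    have := hl _ hmem
    rw [map_add, map_smul, smul_eq_mul] at this
    have e : s * l w = -(l z + c) := by rw [hs, div_mul_eq_mul_div, div_eq_iff hlw.ne']; ring
    linarith
  -- fk(y,x1)
  have hf1 : fk D y x1 ≤ 2 * ε := by
    obtain ⟨l, hl⟩ := supp_pt h (Q := x + (1 + ε) • (-(τ • u))) (by
      rw [mem_iff h hxD (by linarith)]; linarith)
    have e0 : ∀ z ∈ D, 0 ≤ l z + (-l (x + (1 + ε) • (-(τ • u)))) := fun z hz => (hl z hz).le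
    have e1 := fk_le_func h hyD (q := x1) l _ e0
    have e2 := hl x hxD
    have e3 := hl y hyD
    have e4 := hclo (-u) y hyD hu1.le l _ hl
    generalize hc : (-l (x + (1 + ε) • (-(τ • u)))) = c at *
    simp only [hx1, map_add, map_smul, map_neg, smul_eq_mul] at hc e1 e4
    rw [← hx1] at e1
    have e5 : fk D y x1 * (l y + c) ≤ (2 * ε) * (l y + c) := by
      refine e1.trans ?_
      have : l x + (1 - ε) * -(τ * l u) + c = (2 * ε) * (τ * l u) := by linear_combination (-1 : ℝ) * hc
      rw [this]
      apply mul_le_mul_of_nonneg_left _ (by linarith)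
      have hp : 0 < (1 + ε) * τ * l u := by linarith
      have hp2 : 0 < l u := pos_of_mul_pos_right hp (by positivity)
      have := mul_le_mul_of_nonneg_right hτ1 hp2.le
      linarith
    exact le_of_mul_le_mul_right e5 e3
  -- fk(x1,y)
  have hfxy : fk D x y = (1 - τ2) / (1 - τ1) := by
    have := fk_ray h ho (v := v) h1.le h12 (by rw [hv]; linarith)
    rw [hv, ← hx, ← hy] at this
    simpa using this
  have hf2 : fk D x1 y ≤ 2 * fk D x y := by
    obtain ⟨l, c, hl, hlv⟩ := ray_supp h ho v
    have e1 := fk_le_func h hx1D (q := y) l c (fun z hz => (hl z hz).le)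
    have e3 := hl o ho
    have e4 := hclo (-u) y hyD hu1.le l _ hl
    have e5 := hl x1 hx1D
    rw [hv, one_mul] at hlv
    have ey : l y + c = (1 - τ2) * (l o + c) := by
      rw [hy, map_add, map_smul, smul_eq_mul, hlv]; ring
    have ex : l x + c = (1 - τ1) * (l o + c) := by
      rw [hx, map_add, map_smul, smul_eq_mul, hlv]; ring
    have ex1 : l x1 + c = (l x + c) - (1 - ε) * (τ * l u) := by
      rw [hx1]; simp only [map_add, map_smul, map_neg, smul_eq_mul]; ring
    rw [map_neg] at e4
    have hle : l y + c ≤ (1 / 2) * (l x + c) := by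
      have := mul_le_mul_of_nonneg_right h22 e3.le
      rw [ey, ex]; linarith
    have hexpos := hl x hxD
    have hhalf : (1 / 2) * (l x + c) ≤ l x1 + c := by
      rw [ex1]
      rcases le_total 0 (l u) with hh | hh
      · have : (1 - ε) * (τ * l u) ≤ 1 * (1 * l u) := by gcongr; linarith
        linarith
      · have : (1 - ε) * (τ * l u) ≤ 0 := by
          apply mul_nonpos_of_nonneg_of_nonpos (by linarith)
          exact mul_nonpos_of_nonneg_of_nonpos hτ0.le hh
        linarith
    have hfp := fk_pos h hx1D hyD
    have e6 : fk D x1 y * ((1 / 2) * (l x + c)) ≤ l y + c := (mul_le_mul_of_nonneg_left hhalf hfp.le).trans e1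
    rw [ex, ey] at e6
    rw [hfxy, mul_div_assoc', le_div_iff₀ (by linarith)]
    have e7 : (fk D x1 y * (1 - τ1)) * (l o + c) ≤ (2 * (1 - τ2)) * (l o + c) := by linarith
    exact le_of_mul_le_mul_right e7 e3
  -- x1 y1 ray
  obtain ⟨v1, hv1⟩ : ∃ v1, v1 = v - ((1 - ε) / τ2) • u := ⟨_, rfl⟩
  have ey1 : y1 = o + τ2 • v1 := by
    rw [hy1, hv1, hy]; match_scalars <;> field_simp
  have ex1 : x1 = o + τ1 • v1 := by
    rw [hx1, hv1, hx, ← hττ]; match_scalars <;> field_simp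
  have hk1 : τ2 * jg D o v1 < 1 := by rw [← mem_iff h ho hτ2.le, ← ey1]; exact hy1D
  set k := jg D o v1 with hk
  have hk0 : 0 ≤ k := jg_nonneg
  have hτk' : τ1 * k ≤ τ2 * k := mul_le_mul_of_nonneg_right h12 hk0
  have hτk : τ1 * k < 1 := by linarith
  have hfxy1 : fk D x1 y1 = (1 - τ2 * k) / (1 - τ1 * k) := by
    rw [ex1, ey1]; exact fk_ray h ho h1.le h12 hk1
  have hf3 : fk D x y1 ≤ 2 * fk D x1 y1 := by
    obtain ⟨l, c, hl, hlv⟩ := ray_supp h ho v1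
    have e1 := fk_le_func h hxD (q := y1) l c (fun z hz => (hl z hz).le)
    have e3 := hl o ho
    have e4 := hclo u y hyD hu2 l _ hl
    rw [← hk] at hlv
    have ey : l y1 + c = (1 - τ2 * k) * (l o + c) := by
      rw [ey1, map_add, map_smul, smul_eq_mul, hlv]; ring
    have ex : l x1 + c = (1 - τ1 * k) * (l o + c) := by
      rw [ex1, map_add, map_smul, smul_eq_mul, hlv]; ring
    have exx : l x + c = (l x1 + c) + (1 - ε) * (τ * l u) := by
      rw [hx1]; simp only [map_add, map_smul, map_neg, smul_eq_mul]; ring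
    have eyy : l y + c = (l y1 + c) + (1 - ε) * l u := by
      rw [hy1]; simp only [map_add, map_smul, map_neg, smul_eq_mul]; ring
    have hle : l y1 + c ≤ l x1 + c := by
      rw [ey, ex]; apply mul_le_mul_of_nonneg_right _ e3.le; linarith
    have hp1 := hl x1 hx1D
    have hp2 := hl y1 hy1D
    have hhalf : (1 / 2) * (l x1 + c) ≤ l x + c := by
      rw [exx]
      rcases le_total 0 (l u) with hh | hh
      · have : 0 ≤ (1 - ε) * (τ * l u) := mul_nonneg (by linarith) (by positivity)
        linarith
      · have e8 : (1 - ε) * (τ * -l u) ≤ (1 - ε) * (1 * -l u) := by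
          apply mul_le_mul_of_nonneg_left _ (by linarith)
          exact mul_le_mul_of_nonneg_right hτ1 (by linarith)
        rw [eyy] at e4
        have e9 := mul_nonpos_of_nonneg_of_nonpos hε.le hh
        linarith
    have hfp := fk_pos h hxD hy1D
    have e6 : fk D x y1 * ((1 / 2) * (l x1 + c)) ≤ l y1 + c := (mul_le_mul_of_nonneg_left hhalf hfp.le).trans e1
    rw [ex, ey] at e6
    rw [hfxy1, mul_div_assoc', le_div_iff₀ (by linarith)]
    have e7 : (fk D x y1 * (1 - τ1 * k)) * (l o + c) ≤ (2 * (1 - τ2 * k)) * (l o + c) := by linarith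
    exact le_of_mul_le_mul_right e7 e3
  -- back factors
  have hb1 : 1 / 3 ≤ fk D y x := by
    rw [hx, hy]; exact fk_back h ho hsym h1.le h12 (by rw [hv]; linarith)
  have hb2 : 1 / 3 ≤ fk D y1 x1 := by
    rw [ex1, ey1]; exact fk_back h ho hsym h1.le h12 hk1
  -- short sides
  have short : ∀ (z w : Euc n), z ∈ D → z + (1 - ε) • (-w) ∈ D → jg D z (-w) ≤ 1 → jg D z w ≤ 1 →
      hDist D z (z + (1 - ε) • (-w)) ≤ (1 / 2) * Real.log (2 / ε) := by
    intro z w hz hzw hw1 hw2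
    rw [hDist_eq h hz hzw]
    have g1 : ε ≤ fk D z (z + (1 - ε) • (-w)) := by
      unfold fk
      rw [add_sub_cancel_left, jg_smul (by linarith)]
      have := mul_le_mul_of_nonneg_left hw1 (show 0 ≤ 1 - ε by linarith)
      linarith
    have g2 : 1 / 2 ≤ fk D (z + (1 - ε) • (-w)) z := by
      have hf := fk_pos h hzw hz
      have := one_add_jg h hz hzw
      have e : z - (z + (1 - ε) • (-w)) = (1 - ε) • w := by module
      rw [e, jg_smul (by linarith)] at this
      have h0 := jg_nonneg (C := D) (p := z) (v := w)
      have : 1 / fk D (z + (1 - ε) • (-w)) z ≤ 2 := by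
        rw [← this]
        have := mul_le_mul_of_nonneg_left hw2 (show 0 ≤ 1 - ε by linarith)
        linarith
      rw [div_le_iff₀ hf] at this
      linarith
    have l1 := Real.log_le_log hε g1
    have l2 := Real.log_le_log (by norm_num) g2
    rw [Real.log_div (by norm_num) hε.ne']
    rw [Real.log_div (by norm_num) (by norm_num), Real.log_one] at l2
    linarith
  have hs1 := short y u hyD (hy1 ▸ hy1D) hu1.le hu2
  have hs2 := short x (τ • u) hxD (hx1 ▸ hx1D) hxm hxm'
  rw [← hy1] at hs1
  rw [← hx1] at hs2
  -- conclude
  have p1 := fk_pos h hxD hyD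
  have p2 := fk_pos h hx1D hy1D
  have L1 := Real.log_le_log (fk_pos h hyD hx1D) hf1
  have L2 := Real.log_le_log (fk_pos h hx1D hyD) hf2
  have L3 := Real.log_le_log (fk_pos h hxD hy1D) hf3
  have L4 := Real.log_le_log (by norm_num) hb1
  have L5 := Real.log_le_log (by norm_num) hb2
  have L6 := Real.log_nonpos (fk_pos h hy1D hxD).le fk_le_one
  have L7 := Real.log_nonpos (fk_pos h hyD hxD).le fk_le_one
  have L8 : Real.log (fk D x y) ≤ -Real.log M := by
    rw [← Real.log_inv]
    apply Real.log_le_log p1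
    rw [hfxy, div_le_iff₀ (by linarith), inv_mul_eq_div, le_div_iff₀ (by linarith)]
    linarith
  rw [Real.log_mul (by norm_num) p1.ne'] at L2
  rw [Real.log_mul (by norm_num) p2.ne'] at L3
  rw [Real.log_div (by norm_num) (by norm_num), Real.log_one] at L4 L5
  have l6 : Real.log 6 = Real.log 2 + Real.log 3 := by
    rw [← Real.log_mul (by norm_num) (by norm_num)]; norm_num
  have E1 := hDist_eq h hx1D hyD
  have E2 := hDist_eq h hxD hy1D
  have E3 := hDist_eq h hxD hyD
  have E4 := hDist_eq h hx1D hy1D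
  have E5 := hDist_nonneg h hx1D hy1D
  have C1 := hDist_comm h hxD hx1D
  have C2 := hDist_comm h hyD hy1D
  have C3 := hDist_comm h hxD hyD
  have C4 := hDist_comm h hx1D hy1D
  have C5 := hDist_comm h hx1D hxD
  rcases four_pt hd hx1D hyD hxD hy1D with hh | hh
  · linarith
  · linarith

end contr

end HG

namespace HG

lemma contr {n : ℕ} {δ : ℝ} (hδ : 0 ≤ δ) : ∃ M κ : ℝ, 2 ≤ M ∧ 0 < κ ∧ κ < 1 ∧
    ∀ (D : Set (Euc n)) (o v : Euc n), OBC D → o ∈ D → (∀ v, jg D o (-v) ≤ 2 * jg D o v) → IsDeltaHyp D δ →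
    jg D o v = 1 → ∀ τ1 τ2 : ℝ, 0 ≤ τ1 → τ2 < 1 → M * (1 - τ2) ≤ 1 - τ1 → ∀ u,
    fNorm D (o + τ1 • v) (τ1 • u) ≤ κ * fNorm D (o + τ2 • v) (τ2 • u) := by
  set E := 2 * Real.log 6 + 4 * δ + 2 with hE
  have hl6 : 0 < Real.log 6 := Real.log_pos (by norm_num)
  set ε := (1 / 2) * Real.exp (-E) with hε
  have hε0 : 0 < ε := by positivity
  have hε1 : ε < 1 / 2 := by
    have : Real.exp (-E) < 1 := by rw [Real.exp_lt_one_iff]; linarith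
    rw [hε]; linarith
  have hle : Real.log (2 * ε) = -E := by
    rw [hε, ← mul_assoc]; norm_num
  have hl2e : 0 < Real.log (2 / ε) := Real.log_pos (by rw [lt_div_iff₀ hε0]; linarith)
  set M := Real.exp (2 * Real.log (2 / ε) + 4 * δ + 2 * Real.log 6 + 1) with hM
  have hM2 : 2 ≤ M := by
    have := Real.add_one_le_exp (2 * Real.log (2 / ε) + 4 * δ + 2 * Real.log 6 + 1)
    rw [← hM] at this; linarith
  have hlM : Real.log M = 2 * Real.log (2 / ε) + 4 * δ + 2 * Real.log 6 + 1 := Real.log_exp _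
  clear_value M ε
  have hk : 1 / (1 + ε) < 1 := by rw [div_lt_one (by linarith)]; linarith
  have hk0 : 0 < 1 / (1 + ε) := by positivity
  refine ⟨M, (1 + 1 / (1 + ε)) / 2, hM2, by positivity, by linarith, ?_⟩
  intro D o v h ho hsym hd hv τ1 τ2 h1 h2 h3 u
  have h22 : 2 * (1 - τ2) ≤ 1 - τ1 := (mul_le_mul_of_nonneg_right hM2 (by linarith)).trans h3
  have h12 : τ1 ≤ τ2 := by linarith
  have hyD : o + τ2 • v ∈ D := ray_mem h ho (h1.trans h12) (by rw [hv]; linarith)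
  have hxD : o + τ1 • v ∈ D := ray_mem h ho h1 (by rw [hv]; linarith)
  rcases h1.eq_or_lt with rfl | h1
  · rw [zero_smul ℝ u, fN_zero]
    have := fN_nonneg h hyD (u := τ2 • u)
    positivity
  have hτ2 : 0 < τ2 := by linarith
  have key : ∀ w, jg D (o + τ2 • v) w ≤ jg D (o + τ2 • v) (-w) →
      fNorm D (o + τ1 • v) ((τ1 / τ2) • w) ≤ (1 + 1 / (1 + ε)) / 2 * fNorm D (o + τ2 • v) w := by
    intro w hw
    by_cases hw0 : w = 0
    · simp [hw0, fN_zero]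
    have ha := jg_pos h hyD (neg_ne_zero.2 hw0)
    set a := jg D (o + τ2 • v) (-w) with hadef
    have hc := contr_core h ho hsym hd hv h1 h2 hε0 hε1 hM2 h3 (by rw [hle, hE]; linarith)
      (by rw [hle, hlM, hE]; linarith) (u := a⁻¹ • w)
      (by rw [← smul_neg, jg_smul (by positivity), ← hadef, inv_mul_cancel₀ ha.ne'])
      (by rw [jg_smul (by positivity), inv_mul_le_iff₀ ha]; linarith)
    have e : -((τ1 / τ2) • a⁻¹ • w) = a⁻¹ • (-((τ1 / τ2) • w)) := by module
    rw [e, jg_smul (by positivity), mul_assoc, inv_mul_le_iff₀ ha, mul_one] at hc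
    have hb := jg_homoth h ho hyD (τ := τ1 / τ2) (by positivity) ((div_le_one hτ2).2 h12) w
    have e2 : o + (τ1 / τ2) • (o + τ2 • v - o) = o + τ1 • v := by
      rw [add_sub_cancel_left, smul_smul, div_mul_cancel₀ _ hτ2.ne']
    rw [e2] at hb
    rw [fNorm_eq h hxD, fNorm_eq h hyD, ← hadef]
    have hc' : jg D (o + τ1 • v) (-((τ1 / τ2) • w)) ≤ (1 / (1 + ε)) * a := by
      rw [div_mul_eq_mul_div, one_mul, le_div_iff₀ (by linarith)]; exact hc
    have := mul_le_mul_of_nonneg_left hw (show 0 ≤ 1 - 1 / (1 + ε) by linarith)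
    linarith
  have e3 : ∀ u : Euc n, τ1 • u = (τ1 / τ2) • (τ2 • u) := by
    intro u; match_scalars; field_simp
  rcases le_total (jg D (o + τ2 • v) (τ2 • u)) (jg D (o + τ2 • v) (-(τ2 • u))) with hh | hh
  · rw [e3 u]; exact key _ hh
  · have := key (-(τ2 • u)) (by rw [neg_neg]; exact hh)
    rw [fN_neg h hyD, smul_neg, ← e3 u, fN_neg h hxD] at this
    exact this

lemma contr_mono {n : ℕ} {D : Set (Euc n)} {o v : Euc n} (h : OBC D) (ho : o ∈ D) (hv : jg D o v = 1) {τ1 τ2 : ℝ}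
    (h1 : 0 ≤ τ1) (h12 : τ1 ≤ τ2) (h2 : τ2 < 1) (u : Euc n) :
    fNorm D (o + τ1 • v) (τ1 • u) ≤ fNorm D (o + τ2 • v) (τ2 • u) := by
  have hyD : o + τ2 • v ∈ D := ray_mem h ho (h1.trans h12) (by rw [hv]; linarith)
  have hxD : o + τ1 • v ∈ D := ray_mem h ho h1 (by rw [hv]; linarith)
  rcases h1.eq_or_lt with rfl | h1
  · rw [zero_smul ℝ u, fN_zero]
    exact fN_nonneg h hyD
  have hτ2 : 0 < τ2 := by linarith
  have e2 : o + (τ1 / τ2) • (o + τ2 • v - o) = o + τ1 • v := by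
    rw [add_sub_cancel_left, smul_smul, div_mul_cancel₀ _ hτ2.ne']
  have e3 : ∀ u : Euc n, τ1 • u = (τ1 / τ2) • (τ2 • u) := by
    intro u; match_scalars; field_simp
  have hb := fun w => jg_homoth h ho hyD (τ := τ1 / τ2) (by positivity) ((div_le_one hτ2).2 h12) w
  rw [fNorm_eq h hxD, fNorm_eq h hyD, e3 u]
  have g1 := hb (τ2 • u)
  have g2 := hb (-(τ2 • u))
  rw [e2] at g1 g2
  rw [smul_neg] at g2
  linarith

lemma contr_pow {n : ℕ} {δ : ℝ} (hδ : 0 ≤ δ) : ∃ α κ : ℝ, 0 < α ∧ 0 < κ ∧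
    ∀ (D : Set (Euc n)) (o v : Euc n), OBC D → o ∈ D → (∀ v, jg D o (-v) ≤ 2 * jg D o v) → IsDeltaHyp D δ →
    jg D o v = 1 → ∀ τ1 τ2 : ℝ, 0 ≤ τ1 → τ1 ≤ τ2 → τ2 < 1 → ∀ u,
    fNorm D (o + τ1 • v) (τ1 • u) ≤ κ * ((1 - τ2) / (1 - τ1)) ^ α * fNorm D (o + τ2 • v) (τ2 • u) := by
  obtain ⟨M, κ, hM, hκ0, hκ1, hc⟩ := contr (n := n) hδ
  have hlM : 0 < Real.log M := Real.log_pos (by linarith)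
  have hlk : Real.log κ < 0 := Real.log_neg hκ0 hκ1
  refine ⟨-Real.log κ / Real.log M, κ⁻¹, div_pos (by linarith) hlM, by positivity, ?_⟩
  intro D o v h ho hsym hd hv τ1 τ2 h1 h12 h2 u
  have hM0 : 0 < M := by linarith
  have hyD : o + τ2 • v ∈ D := ray_mem h ho (h1.trans h12) (by rw [hv]; linarith)
  have hN : ∀ N : ℕ, ∀ τ1, 0 ≤ τ1 → M ^ N * (1 - τ2) ≤ 1 - τ1 →
      fNorm D (o + τ1 • v) (τ1 • u) ≤ κ ^ N * fNorm D (o + τ2 • v) (τ2 • u) := by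
    intro N
    induction N with
    | zero =>
      intro τ1 h1 h3
      rw [pow_zero, one_mul] at *
      exact contr_mono h ho hv h1 (by linarith) h2 u
    | succ N ih =>
      intro τ1 h1 h3
      have hp : 0 < M ^ N * (1 - τ2) := mul_pos (by positivity) (by linarith)
      have h4 : 1 * (M ^ N * (1 - τ2)) ≤ M * (M ^ N * (1 - τ2)) := by gcongr; linarith
      have h5 : M * (M ^ N * (1 - τ2)) ≤ 1 - τ1 := by rw [pow_succ] at h3; linarith
      have h6 := ih (1 - M ^ N * (1 - τ2)) (by linarith) (by linarith)
      have h7 := hc D o v h ho hsym hd hv τ1 (1 - M ^ N * (1 - τ2)) h1 (by linarith) (by linarith) u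
      refine h7.trans ?_
      rw [pow_succ', mul_assoc]
      exact mul_le_mul_of_nonneg_left h6 hκ0.le
  have hr : 1 ≤ (1 - τ1) / (1 - τ2) := by rw [one_le_div (by linarith)]; linarith
  obtain ⟨N, hN1, hN2⟩ := exists_nat_pow_near hr (show 1 < M by linarith)
  have h8 := hN N τ1 h1 (by rw [le_div_iff₀ (by linarith)] at hN1; exact hN1)
  refine h8.trans (mul_le_mul_of_nonneg_right ?_ (fN_nonneg h hyD))
  rw [show (1 - τ2) / (1 - τ1) = ((1 - τ1) / (1 - τ2))⁻¹ by rw [inv_div]]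
  set r := (1 - τ1) / (1 - τ2)
  have hr0 : 0 < r := by linarith
  have h9 : (M ^ (N + 1))⁻¹ ≤ r⁻¹ := inv_anti₀ hr0 hN2.le
  have h10 : ((M ^ (N + 1))⁻¹) ^ (-Real.log κ / Real.log M) ≤ (r⁻¹) ^ (-Real.log κ / Real.log M) :=
    Real.rpow_le_rpow (by positivity) h9 (div_nonneg (by linarith) hlM.le)
  have h11 : ((M ^ (N + 1))⁻¹) ^ (-Real.log κ / Real.log M) = κ ^ (N + 1) := by
    rw [Real.rpow_def_of_pos (by positivity), Real.log_inv, Real.log_pow]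
    have : -(((N + 1 : ℕ) : ℝ) * Real.log M) * (-Real.log κ / Real.log M) = ((N + 1 : ℕ) : ℝ) * Real.log κ := by
      field_simp
    rw [this, ← Real.log_pow, Real.exp_log (by positivity)]
  rw [h11, pow_succ] at h10
  rw [le_inv_mul_iff₀ hκ0, mul_comm]
  exact h10

/-- linear map from columns -/
noncomputable def lm (a b : Euc 2) : Euc 2 →ₗ[ℝ] Euc 2 where
  toFun z := z 0 • a + z 1 • b
  map_add' x y := by simp only [PiLp.add_apply]; module
  map_smul' c x := by simp only [PiLp.smul_apply, smul_eq_mul, RingHom.id_apply]; module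

lemma lm_det (a b : Euc 2) : LinearMap.det (lm a b) = a 0 * b 1 - a 1 * b 0 := by
  rw [← LinearMap.det_toMatrix (EuclideanSpace.basisFun (Fin 2) ℝ).toBasis, Matrix.det_fin_two]
  simp [LinearMap.toMatrix_apply, lm]
  ring

lemma area {D : Set (Euc 2)} (h : OBC D) {p q : Euc 2} (hp : p ∈ D) (hq : q ∈ D) {s K : ℝ} (hs : 0 < s) (hK : 0 < K)
    (hle : ∀ u, fNorm D q (s • u) ≤ K * fNorm D p u) {e : Euc 2} (he : e ≠ 0) :
    dens D q * s ^ 2 * fNorm D p e ≤ 64 * K * fNorm D q (s • e) * dens D p := by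
  have hse : s • e ≠ 0 := smul_ne_zero hs.ne' he
  have hNe := fN_pos h hp he
  have hNe' := fN_pos h hq hse
  set N := fNorm D p e with hN
  set N' := fNorm D q (s • e) with hN'
  let m : Euc 2 → ℝ := fun u => u 0 * e 1 - u 1 * e 0
  have hcomp : IsCompact {u | fNorm D p u = 1} := by
    apply Metric.isCompact_of_isClosed_isBounded
    · exact isClosed_eq (fN_cont h hp) continuous_const
    · obtain ⟨c, hc, hl⟩ := fN_lower h
      refine (Metric.isBounded_closedBall (x := (0 : Euc 2)) (r := c⁻¹)).subset ?_
      intro u hu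
      have h1 : fNorm D p u = 1 := hu
      rw [mem_closedBall_zero_iff, ← one_div, le_div_iff₀ hc, mul_comm, ← h1]
      exact hl p hp u
  have he2 : 0 < e 0 ^ 2 + e 1 ^ 2 := by
    by_contra hcon
    push Not at hcon
    apply he
    have h0 : e 0 = 0 := by nlinarith [sq_nonneg (e 0), sq_nonneg (e 1)]
    have h1 : e 1 = 0 := by nlinarith [sq_nonneg (e 0), sq_nonneg (e 1)]
    ext i; fin_cases i
    · exact h0
    · exact h1
  obtain ⟨u0, hu0, hmax⟩ := hcomp.exists_isMaxOn ⟨N⁻¹ • e, by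
      show fNorm D p (N⁻¹ • e) = 1
      rw [fN_smul_nonneg h hp (by positivity), ← hN, inv_mul_cancel₀ hNe.ne']⟩
    (f := m) (by fun_prop)
  have hu01 : fNorm D p u0 = 1 := hu0
  have hm1 : ∀ u, m u ≤ m u0 * fNorm D p u := by
    intro u
    by_cases hu : u = 0
    · simp [hu, m, fN_zero]
    have hpu := fN_pos h hp hu
    have h1 : m ((fNorm D p u)⁻¹ • u) ≤ m u0 := hmax (by
      show fNorm D p _ = 1
      rw [fN_smul_nonneg h hp (by positivity), inv_mul_cancel₀ hpu.ne'])
    have h2 : m ((fNorm D p u)⁻¹ • u) = (fNorm D p u)⁻¹ * m u := by simp [m]; ring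
    rw [h2, inv_mul_le_iff₀ hpu] at h1
    linarith
  have hm0 : 0 < m u0 := by
    have h1 := hm1 (!₂[e 1, -e 0])
    have h2 : m (!₂[e 1, -e 0]) = e 0 ^ 2 + e 1 ^ 2 := by simp [m]; ring
    rw [h2] at h1
    have h3 := fN_nonneg h hp (u := !₂[e 1, -e 0])
    by_contra hcon
    push Not at hcon
    nlinarith
  have hmabs : ∀ u, |m u| ≤ m u0 * fNorm D p u := by
    intro u
    rw [abs_le]
    have h1 := hm1 (-u)
    have h2 : m (-u) = - m u := by simp [m]; ring
    rw [h2, fN_neg h hp] at h1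
    exact ⟨by linarith, hm1 u⟩
  -- upper bound
  have hdet1 : LinearMap.det (lm u0 (N⁻¹ • e)) = N⁻¹ * m u0 := by
    rw [lm_det]; simp [m]; ring
  have hdet2 : LinearMap.det (lm ((s * K⁻¹) • u0) ((s * N'⁻¹) • e)) = s ^ 2 * K⁻¹ * N'⁻¹ * m u0 := by
    rw [lm_det]; simp [m]; ring
  have hsub1 : tangentBall D p 1 ⊆ lm u0 (N⁻¹ • e) '' Metric.ball 0 4 := by
    intro u hu
    have hu1 : fNorm D p u < 1 := hu
    set a := m u / m u0 with ha
    set w := u - a • u0 with hw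
    set b := (w 0 * e 0 + w 1 * e 1) / (e 0 ^ 2 + e 1 ^ 2) with hb
    have hmw : w 0 * e 1 - w 1 * e 0 = 0 := by
      have : w 0 * e 1 - w 1 * e 0 = m u - a * m u0 := by simp [hw, m]; ring
      rw [this, ha]; field_simp; ring
    have hwe : w = b • e := by
      ext i; fin_cases i
      · show w 0 = b * e 0
        rw [hb, div_mul_eq_mul_div, eq_div_iff he2.ne']
        linear_combination e 1 * hmw
      · show w 1 = b * e 1
        rw [hb, div_mul_eq_mul_div, eq_div_iff he2.ne']
        linear_combination -(e 0) * hmw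
    have ha1 : |a| < 1 := by
      rw [ha, abs_div, abs_of_pos hm0, div_lt_one hm0]
      refine (hmabs u).trans_lt ?_
      nlinarith
    have hb1 : |b| * N ≤ 2 := by
      rw [hN, ← fN_smul h hp, ← hwe, hw, sub_eq_add_neg]
      refine (fN_add h hp).trans ?_
      rw [fN_neg h hp, fN_smul h hp, hu01]
      linarith
    refine ⟨!₂[a, b * N], ?_, ?_⟩
    · rw [mem_ball_zero_iff]
      refine (norm2_le _).trans_lt ?_
      simp only [Matrix.cons_val_zero, Matrix.cons_val_one, PiLp.toLp_apply, Matrix.cons_val_fin_one]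
      rw [abs_mul, abs_of_pos hNe]
      linarith
    · show a • u0 + (b * N) • (N⁻¹ • e) = u
      rw [smul_smul, mul_assoc, mul_inv_cancel₀ hNe.ne', mul_one, ← hwe, hw]
      module
  have hsub2 : lm ((s * K⁻¹) • u0) ((s * N'⁻¹) • e) '' Metric.ball 0 (1 / 2) ⊆ tangentBall D q 1 := by
    rintro _ ⟨z, hz, rfl⟩
    rw [mem_ball_zero_iff] at hz
    show fNorm D q (z 0 • ((s * K⁻¹) • u0) + z 1 • ((s * N'⁻¹) • e)) < 1
    have hz0 : |z 0| ≤ ‖z‖ := PiLp.norm_apply_le z 0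
    have hz1 : |z 1| ≤ ‖z‖ := PiLp.norm_apply_le z 1
    have g0 : fNorm D q (s • u0) ≤ K := by have := hle u0; rw [hu01, mul_one] at this; exact this
    have e1 : z 0 • ((s * K⁻¹) • u0) = (z 0 * K⁻¹) • (s • u0) := by module
    have e2 : z 1 • ((s * N'⁻¹) • e) = (z 1 * N'⁻¹) • (s • e) := by module
    refine (fN_add h hq).trans_lt ?_
    rw [e1, e2, fN_smul h hq (u := s • u0), fN_smul h hq (u := s • e), ← hN', abs_mul, abs_mul, abs_of_pos (inv_pos.2 hK), abs_of_pos (inv_pos.2 hNe'),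
      mul_assoc _ N'⁻¹, inv_mul_cancel₀ hNe'.ne', mul_one, mul_assoc]
    have g1 : K⁻¹ * fNorm D q (s • u0) ≤ 1 := by rw [inv_mul_le_iff₀ hK]; linarith
    have g2 := mul_le_mul_of_nonneg_left g1 (abs_nonneg (z 0))
    linarith
  have hom := omega_pos (n := 2)
  have v1 := measure_mono (μ := volume) hsub1
  rw [Measure.addHaar_image_linearMap, hdet1, vol_ball_real (by norm_num), ← ENNReal.ofReal_mul (abs_nonneg _)] at v1
  have v1 := ENNReal.toReal_mono ENNReal.ofReal_ne_top v1
  rw [ENNReal.toReal_ofReal (by positivity), abs_of_pos (by positivity)] at v1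
  have v2 := measure_mono (μ := volume) hsub2
  rw [Measure.addHaar_image_linearMap, hdet2, vol_ball_real (by norm_num), ← ENNReal.ofReal_mul (abs_nonneg _),
    ENNReal.ofReal_le_iff_le_toReal (tb_vol_lt h hq).ne, abs_of_pos (by positivity)] at v2
  unfold dens
  have t1 := tb_real_pos h hp
  have t2 := tb_real_pos h hq
  set A := (volume (tangentBall D p 1)).toReal
  set B := (volume (tangentBall D q 1)).toReal
  have w1 : A * N ≤ 16 * (m u0 * omegaVol 2) := by
    calc A * N ≤ (N⁻¹ * m u0 * (4 ^ 2 * omegaVol 2)) * N := mul_le_mul_of_nonneg_right v1 hNe.le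
      _ = _ := by field_simp; ring
  have w2 : s ^ 2 * (m u0 * omegaVol 2) ≤ 4 * K * N' * B := by
    calc s ^ 2 * (m u0 * omegaVol 2) = 4 * K * N' * (s ^ 2 * K⁻¹ * N'⁻¹ * m u0 * ((1 / 2) ^ 2 * omegaVol 2)) := by
          field_simp; ring
      _ ≤ _ := mul_le_mul_of_nonneg_left v2 (by positivity)
  have w3 : A * N * s ^ 2 ≤ 64 * K * N' * B := by
    have := mul_le_mul_of_nonneg_right w1 (sq_nonneg s)
    linarith
  rw [div_mul_eq_mul_div, div_mul_eq_mul_div, mul_div_assoc', div_le_div_iff₀ t2 t1]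
  have := mul_le_mul_of_nonneg_left w3 hom.le
  linarith

end HG

namespace HG

lemma int_pow {α t : ℝ} (hα : 0 < α) (ht : 0 ≤ t) (ht1 : t < 1) :
    ∫⁻ s in Ioo (0:ℝ) 1, ENNReal.ofReal (t * (1 - t) ^ α * (1 - s * t) ^ (-1 - α)) ≤ ENNReal.ofReal (1 / α) := by
  have hpos : ∀ s ∈ Icc (0:ℝ) 1, 0 < 1 - s * t := fun s hs => by nlinarith [hs.1, hs.2]
  have hc : ContinuousOn (fun s : ℝ => t * (1 - t) ^ α * (1 - s * t) ^ (-1 - α)) (Icc 0 1) := by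
    refine continuousOn_const.mul (ContinuousOn.rpow_const (by fun_prop) ?_)
    intro s hs; left; exact (hpos s hs).ne'
  have hi : IntervalIntegrable (fun s : ℝ => t * (1 - t) ^ α * (1 - s * t) ^ (-1 - α)) volume 0 1 :=
    ContinuousOn.intervalIntegrable_of_Icc zero_le_one hc
  have hd : ∀ s ∈ uIcc (0:ℝ) 1, HasDerivAt (fun s : ℝ => (1 - t) ^ α * (1 - s * t) ^ (-α) / α)
      (t * (1 - t) ^ α * (1 - s * t) ^ (-1 - α)) s := by
    intro s hs
    rw [uIcc_of_le zero_le_one] at hs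
    have h1 : HasDerivAt (fun s : ℝ => 1 - s * t) (-t) s := by
      simpa using ((hasDerivAt_id s).mul_const t).const_sub 1
    have h2 := h1.rpow_const (p := -α) (Or.inl (hpos s hs).ne')
    have h3 := (h2.const_mul ((1 - t) ^ α)).div_const α
    refine h3.congr_deriv ?_
    rw [show -1 - α = -α - 1 by ring]
    field_simp
  have hI := intervalIntegral.integral_eq_sub_of_hasDerivAt hd hi
  rw [intervalIntegral.integral_of_le zero_le_one] at hI
  have h0 : 0 < (1 - t) ^ α := Real.rpow_pos_of_pos (by linarith) α
  rw [← restrict_Ioo_eq_restrict_Ioc] at hI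
  rw [← ofReal_integral_eq_lintegral_ofReal, hI]
  · apply ENNReal.ofReal_le_ofReal
    simp only [one_mul, zero_mul, sub_zero, Real.one_rpow, mul_one]
    rw [← Real.rpow_add (by linarith)]
    simp only [add_neg_cancel, Real.rpow_zero]
    have : 0 < (1 - t) ^ α / α := div_pos h0 hα
    linarith
  · rw [intervalIntegrable_iff_integrableOn_Ioo_of_le zero_le_one] at hi
    exact hi
  · filter_upwards [ae_restrict_mem measurableSet_Ioo] with s hs
    have := hpos s ⟨hs.1.le, hs.2.le⟩
    have : 0 < 1 - t := by linarith
    show (0:ℝ) ≤ _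
    positivity

lemma V_bound {δ : ℝ} (hδ : 0 ≤ δ) : ∃ K : ℝ, 0 < K ∧ ∀ (D : Set (Euc 2)) (o : Euc 2), OBC D → o ∈ D →
    (∀ v, jg D o (-v) ≤ 2 * jg D o v) → IsDeltaHyp D δ → ∀ p ∈ D,
    (∫⁻ s in Ioo (0:ℝ) 1, ENNReal.ofReal (dens D (o + s • (p - o)) * s)) * ENNReal.ofReal (fNorm D p (p - o)) ≤
      ENNReal.ofReal (K * dens D p) := by
  obtain ⟨α, κ, hα, hκ, hc⟩ := contr_pow (n := 2) hδ
  refine ⟨96 * κ / α, by positivity, ?_⟩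
  intro D o h ho hsym hd p hp
  rcases eq_or_ne p o with rfl | hpo
  · simp [fN_zero]
  have he : p - o ≠ 0 := sub_ne_zero.2 hpo
  set t := jg D o (p - o) with ht
  have ht0 : 0 < t := jg_pos h ho he
  have ht1 : t < 1 := by rw [ht, jg_lt_one h ho]; simpa using hp
  set v := t⁻¹ • (p - o) with hvd
  have hv : jg D o v = 1 := by rw [hvd, jg_smul (by positivity), ← ht, inv_mul_cancel₀ ht0.ne']
  have hpv : p - o = t • v := by rw [hvd, smul_smul, mul_inv_cancel₀ ht0.ne', one_smul]
  have hpo2 : o + t • v = p := by rw [← hpv]; abel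
  have hdp := dens_pos h hp
  clear_value v t
  rw [← lintegral_mul_const' _ _ ENNReal.ofReal_ne_top]
  calc _ ≤ ∫⁻ s in Ioo (0:ℝ) 1, ENNReal.ofReal (96 * κ * dens D p) *
        ENNReal.ofReal (t * (1 - t) ^ α * (1 - s * t) ^ (-1 - α)) := by
        apply setLIntegral_mono' measurableSet_Ioo
        intro s hs
        rw [← ENNReal.ofReal_mul' (fN_nonneg h hp), ← ENNReal.ofReal_mul (by positivity)]
        apply ENNReal.ofReal_le_ofReal
        have hs0 := hs.1
        have hst : 0 < s * t := mul_pos hs.1 ht0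
        have hst1 : s * t ≤ t := by nlinarith [hs.2]
        have h1st : 0 < 1 - s * t := by linarith
        have hp1 : o + (s * t) • v ∈ D := ray_mem h ho hst.le (by rw [hv]; linarith)
        have e1 : o + s • (p - o) = o + (s * t) • v := by rw [hpv, smul_smul]
        rw [e1]
        set K := κ * ((1 - t) / (1 - s * t)) ^ α with hK
        have hK0 : 0 < K := mul_pos hκ (Real.rpow_pos_of_pos (div_pos (by linarith) h1st) α)
        have hle : ∀ u, fNorm D (o + (s * t) • v) (s • u) ≤ K * fNorm D p u := by
          intro u
          have := hc D o v h ho hsym hd hv (s * t) t hst.le hst1 ht1 (t⁻¹ • u)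
          rwa [smul_smul, smul_smul, mul_inv_cancel₀ ht0.ne', one_smul, mul_assoc, mul_inv_cancel₀ ht0.ne', mul_one,
            hpo2] at this
        have hA := area h hp hp1 hs0 hK0 hle he
        have hF : fNorm D (o + (s * t) • v) (s • (p - o)) ≤ 3 / 2 * (s * t) / (1 - s * t) := by
          rw [hpv, smul_smul, fN_smul_nonneg h hp1 hst.le, fNorm_eq h hp1]
          have j1 := jg_shift h ho (v := v) (t := s * t) (by rw [hv]; linarith) hp1 (Or.inr rfl)
          have hn := jg_nonneg (C := D) (p := o) (v := -v)
          have e2 : o + (s * t) • v = o + (-(s * t)) • (-v) := by module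
          have j2 := jg_shift h ho (v := -v) (t := -(s * t)) (by nlinarith) (e2 ▸ hp1) (Or.inr rfl)
          rw [← e2] at j2
          have j3 : jg D (o + (s * t) • v) (-v) ≤ 2 / (1 - s * t) := by
            rw [j2]
            have := hsym v
            rw [hv] at this
            apply div_le_div₀ (by norm_num) (by linarith) h1st
            nlinarith
          rw [j1, hv, mul_one]
          calc s * t * (1 / 2 * (1 / (1 - s * t) + jg D (o + (s * t) • v) (-v)))
              ≤ s * t * (1 / 2 * (1 / (1 - s * t) + 2 / (1 - s * t))) := by gcongr
            _ = _ := by field_simp; norm_num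
        have hKe : K = κ * ((1 - t) ^ α * (1 - s * t) ^ (-α)) := by
          rw [hK, Real.div_rpow (by linarith) h1st.le, Real.rpow_neg h1st.le, div_eq_mul_inv]
        have hpe : (1 - s * t) ^ (-1 - α) = (1 - s * t) ^ (-α) / (1 - s * t) := by
          rw [show -1 - α = -α - 1 by ring, Real.rpow_sub_one h1st.ne']
        rw [hpe]
        have hB : dens D (o + (s * t) • v) * s ^ 2 * fNorm D p (p - o) ≤
            64 * K * (3 / 2 * (s * t) / (1 - s * t)) * dens D p :=
          hA.trans (by gcongr)
        rw [hKe] at hB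
        have hC : (dens D (o + (s * t) • v) * s * fNorm D p (p - o)) * s ≤
          (96 * κ * dens D p * (t * (1 - t) ^ α * ((1 - s * t) ^ (-α) / (1 - s * t)))) * s := by
          refine le_trans (le_of_eq (by ring)) (hB.trans (le_of_eq (by ring)))
        exact le_of_mul_le_mul_right hC hs0
    _ ≤ ENNReal.ofReal (96 * κ * dens D p) * ENNReal.ofReal (1 / α) := by
        rw [lintegral_const_mul' _ _ ENNReal.ofReal_ne_top]
        exact mul_le_mul_right (int_pow hα ht0.le ht1) _
    _ = _ := by
        rw [← ENNReal.ofReal_mul (by positivity)]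
        congr 1; ring

end HG

namespace HG

/-- radial integrand -/
noncomputable def gF (f : Euc 2 → ℝ) (o z : Euc 2) : ℝ≥0∞ :=
  ENNReal.ofReal (2 * |f z| * |fderiv ℝ f z (z - o)|) + {x | DifferentiableAt ℝ f x}ᶜ.indicator (fun _ => ⊤) z

lemma gF_meas {f : Euc 2 → ℝ} (hf : Continuous f) (o : Euc 2) : Measurable (gF f o) := by
  unfold gF
  have h0 : Measurable ({x | DifferentiableAt ℝ f x}ᶜ.indicator (fun _ => (⊤ : ℝ≥0∞))) :=
    measurable_const.indicator (measurableSet_of_differentiableAt ℝ f).compl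
  refine Measurable.add ?_ h0
  refine Measurable.ennreal_ofReal (((hf.measurable.norm).const_mul 2).mul ?_)
  have h1 : Measurable fun z : Euc 2 => (fderiv ℝ f z, z - o) :=
    (measurable_fderiv ℝ f).prodMk (measurable_id.sub_const o)
  have h2 : Continuous fun x : (Euc 2 →L[ℝ] ℝ) × Euc 2 => x.1 x.2 := by fun_prop
  exact (h2.measurable.comp h1).norm

lemma inv_image : (fun s : ℝ => s⁻¹) '' Ioo 0 1 = Ioi 1 := by
  ext r; constructor
  · rintro ⟨s, hs, rfl⟩
    exact (one_lt_inv₀ hs.1).2 hs.2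
  · intro hr
    have hr : 1 < r := hr
    exact ⟨r⁻¹, ⟨by positivity, inv_lt_one_of_one_lt₀ hr⟩, inv_inv r⟩

lemma ptw {f : Euc 2 → ℝ} {K : ℝ≥0} (hf : LipschitzWith K f) (hc : HasCompactSupport f) {o p : Euc 2} (hpo : p ≠ o) :
    ENNReal.ofReal (f p ^ 2) ≤ ∫⁻ s in Ioo (0:ℝ) 1, ENNReal.ofReal s⁻¹ * gF f o (o + s⁻¹ • (p - o)) := by
  have he : p - o ≠ 0 := sub_ne_zero.2 hpo
  have hn : 0 < ‖p - o‖ := norm_pos_iff.2 he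
  set e := p - o with hed
  obtain ⟨B, hB⟩ := hc.isCompact.isBounded.subset_closedBall o
  set R := max 1 ((B + 1) / ‖e‖) with hR
  have hR1 : 1 ≤ R := le_max_left _ _
  have hfR : f (o + R • e) = 0 := by
    by_contra hcon
    have h1 := hB (subset_tsupport f hcon)
    rw [mem_closedBall_iff_norm, add_sub_cancel_left, norm_smul, Real.norm_of_nonneg (by linarith)] at h1
    have h2 : (B + 1) / ‖e‖ ≤ R := le_max_right _ _
    rw [div_le_iff₀ hn] at h2
    linarith
  have hl : LipschitzWith (K * ‖e‖₊) fun r : ℝ => f (o + r • e) := by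
    refine hf.comp (g := fun r : ℝ => o + r • e) (LipschitzWith.of_dist_le_mul fun x y => ?_)
    rw [dist_add_left, dist_eq_norm, ← sub_smul, norm_smul, coe_nnnorm, mul_comm, dist_eq_norm]
  have hac : AbsolutelyContinuousOnInterval (fun r : ℝ => f (o + r • e)) 1 R :=
    (hl.lipschitzOnWith (s := uIcc 1 R)).absolutelyContinuousOnInterval
  have hac2 := hac.fun_mul hac
  have hI := hac2.integral_deriv_eq_sub
  have hp1 : o + (1:ℝ) • e = p := by rw [hed]; simp
  rw [hfR, hp1] at hI
  have h3 : f p ^ 2 ≤ ∫ r in Ioc 1 R, ‖deriv (fun r : ℝ => f (o + r • e) * f (o + r • e)) r‖ := by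
    have h4 := intervalIntegral.norm_integral_le_integral_norm (μ := volume) (f := deriv (fun r : ℝ => f (o + r • e) * f (o + r • e))) hR1
    rw [hI, intervalIntegral.integral_of_le hR1] at h4
    refine le_trans ?_ h4
    rw [Real.norm_eq_abs, mul_zero, zero_sub, abs_neg, abs_mul_self, sq]
  have hint := hac2.intervalIntegrable_deriv
  rw [intervalIntegrable_iff_integrableOn_Ioc_of_le hR1] at hint
  have h5 := ENNReal.ofReal_le_ofReal h3
  rw [ofReal_integral_eq_lintegral_ofReal hint.norm (ae_of_all _ fun _ => norm_nonneg _)] at h5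
  refine h5.trans ?_
  calc _ ≤ ∫⁻ r in Ioc 1 R, ENNReal.ofReal r⁻¹ * gF f o (o + r • e) := by
        apply setLIntegral_mono' measurableSet_Ioc
        intro r hr
        have hr0 : 0 < r := by linarith [hr.1]
        by_cases hd : DifferentiableAt ℝ f (o + r • e)
        · have g1 : HasDerivAt (fun r : ℝ => o + r • e) e r := by
            simpa using ((hasDerivAt_id r).smul_const e).const_add o
          have g2 := hd.hasFDerivAt.comp_hasDerivAt r g1
          have g3 := g2.mul g2
          have g4 : deriv (fun r : ℝ => f (o + r • e) * f (o + r • e)) r =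
            fderiv ℝ f (o + r • e) e * f (o + r • e) + f (o + r • e) * fderiv ℝ f (o + r • e) e := g3.deriv
          rw [g4, gF, add_sub_cancel_left, map_smul, mul_add, ← ENNReal.ofReal_mul (by positivity)]
          refine le_trans (ENNReal.ofReal_le_ofReal (le_of_eq ?_)) le_self_add
          rw [smul_eq_mul, abs_mul, abs_of_pos hr0, Real.norm_eq_abs, show ∀ a b : ℝ, a * b + b * a = 2 * b * a by intros; ring,
            abs_mul, abs_mul, abs_of_pos (show (0:ℝ) < 2 by norm_num)]
          field_simp
        · rw [gF, indicator_of_mem (show o + r • e ∈ {x | DifferentiableAt ℝ f x}ᶜ from hd), add_top, ENNReal.mul_top]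
          · exact le_top
          · simpa using hr0
    _ ≤ ∫⁻ r in Ioi 1, ENNReal.ofReal r⁻¹ * gF f o (o + r • e) := lintegral_mono_set Ioc_subset_Ioi_self
    _ = ∫⁻ s in Ioo (0:ℝ) 1, ENNReal.ofReal |-(s ^ 2)⁻¹| * (ENNReal.ofReal (s⁻¹)⁻¹ * gF f o (o + s⁻¹ • e)) := by
        rw [← inv_image]
        apply lintegral_image_eq_lintegral_abs_deriv_mul measurableSet_Ioo
        · intro s hs
          exact (hasDerivAt_inv hs.1.ne').hasDerivWithinAt
        · exact fun a _ b _ hab => inv_injective hab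
    _ = _ := by
        apply setLIntegral_congr_fun measurableSet_Ioo
        intro s hs
        have hs0 := hs.1
        show _ * (_ * _) = _
        rw [← mul_assoc, ← ENNReal.ofReal_mul (abs_nonneg _)]
        congr 2
        rw [abs_neg, abs_of_pos (by positivity)]
        field_simp

lemma lint_scale (o : Euc 2) {s : ℝ} (hs : 0 < s) {Φ : Euc 2 → ℝ≥0∞} (hΦ : Measurable Φ) :
    ∫⁻ p, Φ p = ENNReal.ofReal (s ^ 2) * ∫⁻ z, Φ (o + s • (z - o)) := by
  have h1 := Measure.map_addHaar_smul (volume : Measure (Euc 2)) hs.ne'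
  have h2 : ∫⁻ z, Φ (o + s • (z - o)) = ∫⁻ z, Φ (o + s • z) :=
    lintegral_sub_right_eq_self (fun z => Φ (o + s • z)) o
  have h3 : ∫⁻ z, Φ (o + s • z) = ∫⁻ y, Φ (o + y) ∂(Measure.map (s • ·) (volume : Measure (Euc 2))) := by
    rw [lintegral_map (by fun_prop) (by fun_prop)]
  rw [h2, h3, h1, lintegral_smul_measure, lintegral_add_left_eq_self Φ o, smul_eq_mul, ← mul_assoc,
    ← ENNReal.ofReal_mul (by positivity)]
  have : s ^ 2 * |(s ^ Module.finrank ℝ (Euc 2))⁻¹| = 1 := by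
    rw [finrank_euclideanSpace_fin, abs_of_pos (by positivity)]; field_simp
  rw [this]; simp

lemma tonelli (o : Euc 2) {σ G : Euc 2 → ℝ≥0∞} (hσ : Measurable σ) (hG : Measurable G) :
    ∫⁻ p, σ p * ∫⁻ s in Ioo (0:ℝ) 1, ENNReal.ofReal s⁻¹ * G (o + s⁻¹ • (p - o)) =
      ∫⁻ z, G z * ∫⁻ s in Ioo (0:ℝ) 1, σ (o + s • (z - o)) * ENNReal.ofReal s := by
  have m1 : Measurable fun x : Euc 2 × ℝ => o + x.2⁻¹ • (x.1 - o) :=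
    measurable_const.add (measurable_snd.inv.smul (measurable_fst.sub_const o))
  have m2 : Measurable fun x : Euc 2 × ℝ => o + x.2 • (x.1 - o) :=
    measurable_const.add (measurable_snd.smul (measurable_fst.sub_const o))
  have n1 : Measurable fun x : Euc 2 × ℝ => σ x.1 * (ENNReal.ofReal x.2⁻¹ * G (o + x.2⁻¹ • (x.1 - o))) :=
    (hσ.comp measurable_fst).mul (measurable_snd.inv.ennreal_ofReal.mul (hG.comp m1))
  have n2 : Measurable fun x : Euc 2 × ℝ => G x.1 * (σ (o + x.2 • (x.1 - o)) * ENNReal.ofReal x.2) :=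
    (hG.comp measurable_fst).mul ((hσ.comp m2).mul measurable_snd.ennreal_ofReal)
  calc _ = ∫⁻ p, ∫⁻ s in Ioo (0:ℝ) 1, σ p * (ENNReal.ofReal s⁻¹ * G (o + s⁻¹ • (p - o))) := by
        refine lintegral_congr fun p => (lintegral_const_mul _ ?_).symm
        exact measurable_inv.ennreal_ofReal.mul (hG.comp (m1.comp (measurable_prodMk_left (x := p))))
    _ = ∫⁻ s in Ioo (0:ℝ) 1, ∫⁻ p, σ p * (ENNReal.ofReal s⁻¹ * G (o + s⁻¹ • (p - o))) :=
        lintegral_lintegral_swap n1.aemeasurable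
    _ = ∫⁻ s in Ioo (0:ℝ) 1, ∫⁻ z, G z * (σ (o + s • (z - o)) * ENNReal.ofReal s) := by
        apply setLIntegral_congr_fun measurableSet_Ioo
        intro s hs
        have hs0 := hs.1
        show ∫⁻ p, σ p * (ENNReal.ofReal s⁻¹ * G (o + s⁻¹ • (p - o))) = _
        rw [lint_scale o hs0 (Φ := fun p => σ p * (ENNReal.ofReal s⁻¹ * G (o + s⁻¹ • (p - o)))) (n1.comp (measurable_prodMk_right (y := s))), ← lintegral_const_mul' _ _ ENNReal.ofReal_ne_top]
        refine lintegral_congr fun z => ?_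
        have e1 : o + s⁻¹ • (o + s • (z - o) - o) = z := by
          rw [add_sub_cancel_left, smul_smul, inv_mul_cancel₀ hs0.ne', one_smul]; abel
        have e2 : ENNReal.ofReal s = ENNReal.ofReal (s ^ 2) * ENNReal.ofReal s⁻¹ := by
          rw [← ENNReal.ofReal_mul (by positivity)]; congr 1; field_simp
        show ENNReal.ofReal (s ^ 2) * (σ (o + s • (z - o)) * (ENNReal.ofReal s⁻¹ * G (o + s⁻¹ • (o + s • (z - o) - o)))) = _
        rw [e1, e2]; ring
    _ = ∫⁻ z, ∫⁻ s in Ioo (0:ℝ) 1, G z * (σ (o + s • (z - o)) * ENNReal.ofReal s) :=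
        (lintegral_lintegral_swap n2.aemeasurable).symm
    _ = _ := by
        refine lintegral_congr fun z => lintegral_const_mul _ ?_
        exact (hσ.comp (m2.comp (measurable_prodMk_left (x := z)))).mul measurable_id.ennreal_ofReal

end HG

namespace HG

section bwd
variable {D : Set (Euc 2)}

lemma lint_ineq (h : OBC D) {o : Euc 2} (ho : o ∈ D) {K : ℝ} (hK : 0 < K)
    (hV : ∀ p ∈ D, (∫⁻ s in Ioo (0:ℝ) 1, ENNReal.ofReal (dens D (o + s • (p - o)) * s)) *
      ENNReal.ofReal (fNorm D p (p - o)) ≤ ENNReal.ofReal (K * dens D p)) {f : Euc 2 → ℝ} {L : ℝ≥0}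
    (hf : LipschitzWith L f) (hc : HasCompactSupport f) (hs : tsupport f ⊆ D) :
    ∫⁻ x, ENNReal.ofReal (f x ^ 2) ∂(hMeasure D) ≤
      ∫⁻ x, ENNReal.ofReal (2 * K * |f x| * D.indicator (fun p => dualNorm D p (fderiv ℝ f p)) x) ∂(hMeasure D) := by
  have hD := h.op.measurableSet
  have hfc := hf.continuous
  have hm2 : Measurable fun x => ENNReal.ofReal (2 * K * |f x| * D.indicator (fun p => dualNorm D p (fderiv ℝ f p)) x) :=
    ((hfc.measurable.norm.const_mul (2 * K)).mul (dual_meas h f)).ennreal_ofReal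
  rw [hM_lint h _ (by fun_prop), hM_lint h _ hm2.aemeasurable]
  set σ : Euc 2 → ℝ≥0∞ := fun p => ENNReal.ofReal (D.indicator (dens D) p) with hσ
  have hσm : Measurable σ := (dens_meas h).ennreal_ofReal
  have hσD : ∀ p ∈ D, σ p = ENNReal.ofReal (dens D p) := by
    intro p hp; rw [hσ]; simp only [indicator_of_mem hp]
  calc _ ≤ ∫⁻ p, σ p * ∫⁻ s in Ioo (0:ℝ) 1, ENNReal.ofReal s⁻¹ * gF f o (o + s⁻¹ • (p - o)) := by
        rw [← lintegral_indicator hD]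
        apply lintegral_mono_ae
        have : ∀ᵐ p : Euc 2, p ≠ o := by simp [ae_iff]
        filter_upwards [this] with p hp
        by_cases hpD : p ∈ D
        · rw [indicator_of_mem hpD, hσD p hpD]
          exact mul_le_mul_right (ptw hf hc hp) _
        · rw [indicator_of_notMem hpD]; exact zero_le
    _ = ∫⁻ z, gF f o z * ∫⁻ s in Ioo (0:ℝ) 1, σ (o + s • (z - o)) * ENNReal.ofReal s :=
        tonelli o hσm (gF_meas hfc o)
    _ ≤ _ := by
        rw [← lintegral_indicator hD]
        apply lintegral_mono_ae
        filter_upwards [hf.ae_differentiableAt] with z hz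
        have hnz : z ∉ {x | DifferentiableAt ℝ f x}ᶜ := fun hn => hn hz
        rw [gF, indicator_of_notMem hnz, add_zero]
        by_cases hzD : z ∈ D
        · rw [indicator_of_mem hzD, indicator_of_mem hzD]
          have e1 : ∫⁻ s in Ioo (0:ℝ) 1, σ (o + s • (z - o)) * ENNReal.ofReal s =
              ∫⁻ s in Ioo (0:ℝ) 1, ENNReal.ofReal (dens D (o + s • (z - o)) * s) := by
            apply setLIntegral_congr_fun measurableSet_Ioo
            intro s hs
            have hm : o + s • (z - o) ∈ D := h.cv.add_smul_sub_mem ho hzD ⟨hs.1.le, hs.2.le⟩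
            show σ _ * _ = _
            rw [hσD _ hm]
            exact (ENNReal.ofReal_mul (dens_pos h hm).le).symm
          rw [e1]
          have hdn := dual_nonneg h hzD (fderiv ℝ f z)
          have hd := abs_dual_le h hzD (fderiv ℝ f z) (z - o)
          have hF := fN_nonneg h hzD (u := z - o)
          calc _ ≤ ENNReal.ofReal (2 * |f z| * dualNorm D z (fderiv ℝ f z)) * ENNReal.ofReal (fNorm D z (z - o)) *
                ∫⁻ s in Ioo (0:ℝ) 1, ENNReal.ofReal (dens D (o + s • (z - o)) * s) := by
                rw [← ENNReal.ofReal_mul (by positivity)]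
                refine mul_le_mul_left (ENNReal.ofReal_le_ofReal ?_) _
                rw [mul_assoc (2 * |f z|)]
                exact mul_le_mul_of_nonneg_left hd (by positivity)
            _ ≤ ENNReal.ofReal (2 * |f z| * dualNorm D z (fderiv ℝ f z)) * ENNReal.ofReal (K * dens D z) := by
                rw [mul_assoc]
                refine mul_le_mul_right ?_ _
                rw [mul_comm]; exact hV z hzD
            _ = _ := by
                rw [← ENNReal.ofReal_mul (by positivity), ← ENNReal.ofReal_mul (dens_pos h hzD).le]
                congr 1; ring
        · have : f z = 0 := image_eq_zero_of_notMem_tsupport fun hh => hzD (hs hh)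
          simp [this]

lemma compact_fin (h : OBC D) {S : Set (Euc 2)} (hS : IsCompact S) (hSD : S ⊆ D) : hMeasure D S < ⊤ := by
  obtain ⟨ε, hε, hsub⟩ := hS.exists_thickening_subset_open h.op hSD
  rw [hM_apply h hS.measurableSet hSD]
  have hb : 0 < (volume (Metric.ball (0 : Euc 2) ε)).toReal :=
    ENNReal.toReal_pos (Metric.measure_ball_pos _ _ hε).ne' measure_ball_lt_top.ne
  calc _ ≤ ∫⁻ _ in S, ENNReal.ofReal (omegaVol 2 / (volume (Metric.ball (0 : Euc 2) ε)).toReal) := by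
        apply setLIntegral_mono' hS.measurableSet
        intro p hp
        have hpD := hSD hp
        apply ENNReal.ofReal_le_ofReal
        unfold dens
        apply div_le_div_of_nonneg_left omega_pos.le hb
        apply ENNReal.toReal_mono (tb_vol_lt h hpD).ne
        apply measure_mono
        intro u hu
        rw [mem_ball_zero_iff] at hu
        have hm : ∀ w : Euc 2, ‖w‖ < ε → jg D p w < 1 := by
          intro w hw
          rw [jg_lt_one h hpD]
          apply hsub
          rw [Metric.mem_thickening_iff]
          exact ⟨p, hp, by rw [dist_eq_norm, add_sub_cancel_left]; exact hw⟩
        show fNorm D p u < 1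
        rw [fNorm_eq h hpD]
        have h1 := hm u hu
        have h2 := hm (-u) (by rwa [norm_neg])
        linarith
    _ < ⊤ := by
        rw [setLIntegral_const]
        exact ENNReal.mul_lt_top ENNReal.ofReal_lt_top hS.measure_lt_top

lemma int_bdd (h : OBC D) {S : Set (Euc 2)} (hS : IsCompact S) (hSD : S ⊆ D) {g : Euc 2 → ℝ} (hg : Measurable g) {M : ℝ}
    (hM : ∀ x, |g x| ≤ M) (h0 : ∀ x, x ∉ S → g x = 0) : Integrable g (hMeasure D) := by
  refine Integrable.mono' (g := S.indicator (fun _ => M))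
    ((integrable_indicator_iff hS.measurableSet).2 (integrableOn_const (compact_fin h hS hSD).ne)) hg.aestronglyMeasurable ?_
  filter_upwards with x
  by_cases hx : x ∈ S
  · rw [indicator_of_mem hx]; exact hM x
  · rw [indicator_of_notMem hx, h0 x hx, norm_zero]

lemma ray_lower (h : OBC D) {o : Euc 2} (ho : o ∈ D) {K : ℝ} (hK : 0 < K)
    (hV : ∀ p ∈ D, (∫⁻ s in Ioo (0:ℝ) 1, ENNReal.ofReal (dens D (o + s • (p - o)) * s)) *
      ENNReal.ofReal (fNorm D p (p - o)) ≤ ENNReal.ofReal (K * dens D p)) {f : Euc 2 → ℝ}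
    (hf : f ∈ testFuns D) : 1 / (4 * K ^ 2) ≤ rayleigh D D f := by
  obtain ⟨⟨L, hL⟩, hne, hc, hs⟩ := hf
  set d := D.indicator (fun p => dualNorm D p (fderiv ℝ f p)) with hd
  have hdm : Measurable d := dual_meas h f
  have hd0 : ∀ x, 0 ≤ d x := fun x => indicator_nonneg (fun y hy => dual_nonneg h hy _) x
  have hfz : ∀ x, x ∉ tsupport f → f x = 0 := fun x hx => image_eq_zero_of_notMem_tsupport hx
  have hdz : ∀ x, x ∉ tsupport f → d x = 0 := by
    intro x hx
    by_cases hxD : x ∈ D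
    · rw [hd, indicator_of_mem hxD]
      refine le_antisymm (dual_ub h hxD _ le_rfl fun u => ?_) (dual_nonneg h hxD _)
      rw [fderiv_of_notMem_tsupport ℝ hx]; simp
    · rw [hd, indicator_of_notMem hxD]
  obtain ⟨c, hc0, hcl⟩ := fN_lower h
  have hdb : ∀ x, d x ≤ L / c := by
    intro x
    by_cases hxD : x ∈ D
    · rw [hd, indicator_of_mem hxD]
      refine dual_ub h hxD _ (by positivity) fun u => ?_
      have h1 := (le_abs_self _).trans ((fderiv ℝ f x).le_opNorm u)
      have h2 := norm_fderiv_le_of_lipschitz ℝ hL (x₀ := x)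
      calc fderiv ℝ f x u ≤ L * ‖u‖ := h1.trans (by gcongr)
        _ = L / c * (c * ‖u‖) := by field_simp
        _ ≤ _ := by gcongr; exact hcl x hxD u
    · rw [hd, indicator_of_notMem hxD]; positivity
  obtain ⟨M, hM⟩ := hc.exists_bound_of_continuous hL.continuous
  have if2 : Integrable (fun x => f x ^ 2) (hMeasure D) := by
    refine int_bdd h hc.isCompact hs (hL.continuous.measurable.pow_const 2) (M := M ^ 2) (fun x => ?_) fun x hx => by rw [hfz x hx]; norm_num
    rw [abs_pow]
    exact pow_le_pow_left₀ (abs_nonneg _) (hM x) 2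
  have id2 : Integrable (fun x => d x ^ 2) (hMeasure D) := by
    refine int_bdd h hc.isCompact hs (hdm.pow_const 2) (M := (L / c) ^ 2) (fun x => ?_) fun x hx => by rw [hdz x hx]; norm_num
    rw [abs_pow, abs_of_nonneg (hd0 x)]
    exact pow_le_pow_left₀ (hd0 x) (hdb x) 2
  have isum : Integrable (fun x => 1 / 2 * f x ^ 2 + 2 * K ^ 2 * d x ^ 2) (hMeasure D) := (if2.const_mul _).add (id2.const_mul _)
  have key := lint_ineq h ho hK hV hL hc hs
  have key2 : ∫⁻ x, ENNReal.ofReal (f x ^ 2) ∂(hMeasure D) ≤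
      ∫⁻ x, ENNReal.ofReal (1 / 2 * f x ^ 2 + 2 * K ^ 2 * d x ^ 2) ∂(hMeasure D) := by
    refine key.trans (lintegral_mono fun x => ENNReal.ofReal_le_ofReal ?_)
    rw [← hd]
    have := sq_nonneg (|f x| - 2 * K * d x)
    rw [← sq_abs (f x)]
    nlinarith
  rw [← ofReal_integral_eq_lintegral_ofReal if2 (ae_of_all _ fun _ => sq_nonneg _),
    ← ofReal_integral_eq_lintegral_ofReal isum (ae_of_all _ fun x => by
      show (0:ℝ) ≤ 1 / 2 * f x ^ 2 + 2 * K ^ 2 * d x ^ 2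
      positivity),
    ENNReal.ofReal_le_ofReal_iff (integral_nonneg fun x => by
      show (0:ℝ) ≤ 1 / 2 * f x ^ 2 + 2 * K ^ 2 * d x ^ 2
      positivity), integral_add (if2.const_mul _) (id2.const_mul _), integral_const_mul, integral_const_mul] at key2
  have hpos : 0 < ∫ x, f x ^ 2 ∂(hMeasure D) := by
    rw [integral_pos_iff_support_of_nonneg (fun x => sq_nonneg (f x)) if2]
    have e1 : (Function.support fun x => f x ^ 2) = Function.support f := by
      ext x; simp
    have hU : IsOpen (Function.support f) := hL.continuous.isOpen_support
    have hUD : Function.support f ⊆ D := (subset_tsupport f).trans hs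
    rw [e1, hM_eq h, withDensity_apply _ hU.measurableSet, Measure.restrict_restrict hU.measurableSet, inter_eq_left.2 hUD,
      setLIntegral_pos_iff (dens_meas h).ennreal_ofReal]
    refine lt_of_lt_of_le (hU.measure_pos volume (Function.support_nonempty_iff.2 hne)) (measure_mono fun x hx => ⟨?_, hx⟩)
    rw [Function.mem_support, indicator_of_mem (hUD hx)]
    simpa using dens_pos h (hUD hx)
  have e2 : ∫ p in D, dualNorm D p (fderiv ℝ f p) ^ 2 ∂(hMeasure D) = ∫ x, d x ^ 2 ∂(hMeasure D) := by
    conv_rhs => rw [← hM_restrict h]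
    apply setIntegral_congr_fun h.op.measurableSet
    intro x hx
    show _ = d x ^ 2
    rw [hd, indicator_of_mem hx]
  unfold rayleigh
  rw [e2, hM_restrict h, div_le_div_iff₀ (by positivity) hpos]
  linarith

lemma test_ne (h : OBC D) {o : Euc 2} (ho : o ∈ D) : (testFuns D).Nonempty := by
  obtain ⟨ε, hε, hb⟩ := Metric.nhds_basis_closedBall.mem_iff.1 (h.op.mem_nhds ho)
  refine ⟨fun x => max (ε - dist x o) 0, ⟨_, ((LipschitzWith.const ε).sub (LipschitzWith.dist_left o)).max_const 0⟩, ?_, ?_⟩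
  · intro hcon
    have := congrFun hcon o
    simp at this
    linarith
  have hsup : tsupport (fun x => max (ε - dist x o) 0) ⊆ Metric.closedBall o ε := by
    apply closure_minimal _ Metric.isClosed_closedBall
    intro x hx
    by_contra hn
    apply hx
    rw [Metric.mem_closedBall, not_le] at hn
    exact max_eq_right (by linarith)
  exact ⟨(isCompact_closedBall o ε).of_isClosed_subset (isClosed_tsupport _) hsup, hsup.trans hb⟩

lemma bwd {n : ℕ} {C : Set (Euc n)} (h : OBC C) {δ : ℝ} (hδ : 0 ≤ δ) (hd : IsDeltaHyp C δ) :
    ∃ lam, 0 < lam ∧ ∀ φ : Euc 2 →ᵃⁱ[ℝ] Euc n, (φ ⁻¹' C).Nonempty → lambda1 (φ ⁻¹' C) ≥ lam := by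
  obtain ⟨K, hK, hV⟩ := V_bound hδ
  refine ⟨1 / (4 * K ^ 2), by positivity, fun φ hne => ?_⟩
  have hD := sec_obc h φ
  obtain ⟨o, ho, hsym⟩ := center hD hne
  refine le_csInf ((test_ne hD ho).image _) ?_
  rintro _ ⟨f, hf, rfl⟩
  exact ray_lower hD ho hK (hV _ o hD ho hsym (sec_hyp hd φ)) hf

end bwd

end HG

/-- For a bounded open convex subset `C` of `ℝⁿ`, there is a uniform
positive lower bound on `λ₁` of all planar sections of `C` (planar sections being
realized as preimages under affine isometric embeddings of `ℝ²`) if and only if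
`(C, d_C)` is `δ`-hyperbolic for some `δ ≥ 0`. -/
theorem stmt1 {n : ℕ} (C : Set (Euc n)) (hconv : Convex ℝ C) (hopen : IsOpen C)
    (hbdd : Bornology.IsBounded C) (hne : C.Nonempty) :
    (∃ lam : ℝ, 0 < lam ∧
        ∀ φ : Euc 2 →ᵃⁱ[ℝ] Euc n, (φ ⁻¹' C).Nonempty → lambda1 (φ ⁻¹' C) ≥ lam) ↔
      ∃ δ : ℝ, 0 ≤ δ ∧ IsDeltaHyp C δ := by
  exact ⟨fun ⟨lam, hl, hL⟩ => HG.fwd ⟨hconv, hopen, hbdd⟩ hl hL,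
    fun ⟨_, h0, hd⟩ => HG.bwd ⟨hconv, hopen, hbdd⟩ h0 hd⟩
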